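/- Assume the Framework. Then there exist, for each p ∈ P, a Borel α|Γ_p-invariant partition X = ⊔_{k∈K(p)} X_k; for each q ∈ Q, a Borel β|Λ_q-invariant partition Y = ⊔_{l∈L(q)} Y_l; and a bijection θ : ⊔_{p∈P} K(p) → ⊔_{q∈Q} L(q) between the index sets, such that for every k ∈ ⊔_{p∈P} K(p) the restriction to X_k of the orbit relation of α|Γ_k is stably orbit equivalent with the restriction to Y_{θ(k)} of the orbit relation of β|Λ_{θ(k)}, where Γ_k := Γ_p for the unique p with k ∈ K(p) and Λ_{θ(k)} := Λ_q for the unique q with θ(k) ∈ L(q). -/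

import Mathlib

open MeasureTheory

/-- A countable Borel equivalence relation on `X`, defined on a Borel domain `dom`:
it is Borel as a subset of `X × X`, is an equivalence relation on `dom`, and has
countable classes. -/
structure CBER (X : Type) [MeasurableSpace X] where
  dom : Set X
  dom_meas : MeasurableSet dom
  rel : X → X → Prop
  rel_meas : MeasurableSet {p : X × X | rel p.1 p.2}
  rel_dom : ∀ {x y : X}, rel x y → x ∈ dom ∧ y ∈ dom
  refl : ∀ x ∈ dom, rel x x
  symm : ∀ {x y : X}, rel x y → rel y x
  trans : ∀ {x y z : X}, rel x y → rel y z → rel x z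
  countable_classes : ∀ x : X, {y | rel x y}.Countable

/-- The class of `x`. -/
def CBER.cls {X : Type} [MeasurableSpace X] (R : CBER X) (x : X) : Set X := {y | R.rel x y}

/-- The `R`-saturation of a set `A`: the union of the `R`-classes meeting `A`. -/
def CBER.sat {X : Type} [MeasurableSpace X] (R : CBER X) (A : Set X) : Set X :=
  {y | ∃ x ∈ A, R.rel x y}

/-- A complete section: a Borel subset of the domain meeting every class. -/
def CBER.IsCompleteSection {X : Type} [MeasurableSpace X] (R : CBER X) (A : Set X) : Prop :=
  MeasurableSet A ∧ A ⊆ R.dom ∧ ∀ x ∈ R.dom, ∃ y ∈ A, R.rel x y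

/-- A smooth CBER: one admitting a Borel fundamental domain (a Borel set meeting
every class exactly once). -/
def CBER.Smooth {X : Type} [MeasurableSpace X] (R : CBER X) : Prop :=
  ∃ D : Set X, MeasurableSet D ∧ D ⊆ R.dom ∧ ∀ x ∈ R.dom, ∃! y, y ∈ D ∧ R.rel x y

/-- Smoothness of the restriction `R|A`. -/
def CBER.SmoothOn {X : Type} [MeasurableSpace X] (R : CBER X) (A : Set X) : Prop :=
  ∃ D : Set X, MeasurableSet D ∧ D ⊆ A ∧ ∀ x ∈ R.dom ∩ A, ∃! y, y ∈ D ∧ R.rel x y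

/-- All classes are finite. -/
def CBER.FiniteClasses {X : Type} [MeasurableSpace X] (R : CBER X) : Prop :=
  ∀ x ∈ R.dom, (R.cls x).Finite

/-- Aperiodic: all classes are infinite (on the domain). -/
def CBER.Aperiodic {X : Type} [MeasurableSpace X] (R : CBER X) : Prop :=
  ∀ x ∈ R.dom, (R.cls x).Infinite

/-- Trivial: all classes are singletons. -/
def CBER.TrivialClasses {X : Type} [MeasurableSpace X] (R : CBER X) : Prop :=
  ∀ x y, R.rel x y → x = y

/-- The restriction `R|U` of `R` to a Borel set `U`. -/
def CBER.restrict {X : Type} [MeasurableSpace X] (R : CBER X) (U : Set X)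
    (hU : MeasurableSet U) : CBER X where
  dom := R.dom ∩ U
  dom_meas := R.dom_meas.inter hU
  rel x y := R.rel x y ∧ x ∈ U ∧ y ∈ U
  rel_meas := by
    have h : {p : X × X | R.rel p.1 p.2 ∧ p.1 ∈ U ∧ p.2 ∈ U} =
        {p : X × X | R.rel p.1 p.2} ∩ (Prod.fst ⁻¹' U ∩ Prod.snd ⁻¹' U) := by
      ext p
      simp only [Set.mem_setOf_eq, Set.mem_inter_iff, Set.mem_preimage, and_assoc]
    rw [h]
    exact R.rel_meas.inter ((measurable_fst hU).inter (measurable_snd hU))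
  rel_dom := fun h => ⟨⟨(R.rel_dom h.1).1, h.2.1⟩, ⟨(R.rel_dom h.1).2, h.2.2⟩⟩
  refl := fun x hx => ⟨R.refl x hx.1, hx.2, hx.2⟩
  symm := fun h => ⟨R.symm h.1, h.2.2, h.2.1⟩
  trans := fun h h' => ⟨R.trans h.1 h'.1, h.2.1, h'.2.2⟩
  countable_classes := fun x =>
    Set.Countable.mono (fun y hy => hy.1) (R.countable_classes x)

/-- `S` is a subrelation of `R`. -/
def CBER.IsSubrelOf {X : Type} [MeasurableSpace X] (S R : CBER X) : Prop :=
  S.dom ⊆ R.dom ∧ ∀ x y, S.rel x y → R.rel x y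

/-- A partial Borel isomorphism between Borel subsets `src` and `tgt` of `X`. -/
structure PBI (X : Type) [MeasurableSpace X] where
  src : Set X
  tgt : Set X
  src_meas : MeasurableSet src
  tgt_meas : MeasurableSet tgt
  toFun : X → X
  invFun : X → X
  meas_toFun : Measurable toFun
  meas_invFun : Measurable invFun
  mapsTo : Set.MapsTo toFun src tgt
  mapsTo_inv : Set.MapsTo invFun tgt src
  left_inv : ∀ x ∈ src, invFun (toFun x) = x
  right_inv : ∀ y ∈ tgt, toFun (invFun y) = y

/-- Membership in the full pseudogroup `[[R]]`: a partial Borel isomorphism whose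
graph is contained in `R`. -/
def CBER.InPseudogroup {X : Type} [MeasurableSpace X] (R : CBER X) (φ : PBI X) : Prop :=
  φ.src ⊆ R.dom ∧ ∀ x ∈ φ.src, R.rel x (φ.toFun x)

/-- Two subrelations `S₁`, `S₂` of `R` are inner conjugate in `R` if some element of the
full pseudogroup of `R` with domain `D(S₂)` and target `D(S₁)` conjugates one to the other. -/
def InnerConjugate {X : Type} [MeasurableSpace X] (R S₁ S₂ : CBER X) : Prop :=
  ∃ φ : PBI X, R.InPseudogroup φ ∧ φ.src = S₂.dom ∧ φ.tgt = S₁.dom ∧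
    ∀ x ∈ φ.src, ∀ y ∈ φ.src, (S₂.rel x y ↔ S₁.rel (φ.toFun x) (φ.toFun y))

/-- `R` preserves the measure `μ`: every element of its full pseudogroup preserves `μ`. -/
def CBER.IsPMP {X : Type} [MeasurableSpace X] (R : CBER X) (μ : Measure X) : Prop :=
  ∀ φ : PBI X, R.InPseudogroup φ → ∀ A : Set X, A ⊆ φ.src → MeasurableSet A →
    μ (φ.toFun '' A) = μ A

/-- Free independence of a family of equivalence relations: any cycle alternating
nontrivially among the factors must have two consecutive steps in the same factor. -/
def FreelyIndep {X : Type} [MeasurableSpace X] {ι : Type} (Rf : ι → CBER X) : Prop :=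
  ∀ (n : ℕ) (x : ℕ → X) (i : ℕ → ι), 2 ≤ n → x n = x 0 →
    (∀ j < n, x j ≠ x (j + 1)) → (∀ j < n, (Rf (i j)).rel (x j) (x (j + 1))) →
    ∃ j, j + 1 < n ∧ i j = i (j + 1)

/-- `R` is the free product of the family `Rf`: the family is freely independent and `R`
is the smallest equivalence relation on the union of the domains containing every `Rf i`. -/
def IsFreeProduct {X : Type} [MeasurableSpace X] {ι : Type} (R : CBER X)
    (Rf : ι → CBER X) : Prop :=
  FreelyIndep Rf ∧ R.dom = (⋃ i, (Rf i).dom) ∧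
    ∀ x y, R.rel x y ↔
      (x ∈ R.dom ∧ Relation.EqvGen (fun a b => ∃ i, (Rf i).rel a b) x y)

/-- The partition `U = ⊔ⱼ Uⱼ` trivializes the free product decomposition `R = *ⱼ Rf j`:
`U` is a complete section for `R`, the partition is `R|U`-invariant, and
`R|Uⱼ = (Rf j)|Uⱼ` for every `j`. -/
def Trivializes {X : Type} [MeasurableSpace X] {ι : Type}
    (R : CBER X) (Rf : ι → CBER X) (U : ι → Set X) : Prop :=
  (∀ j, MeasurableSet (U j)) ∧ (∀ j, U j ⊆ R.dom) ∧
  Pairwise (Function.onFun Disjoint U) ∧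
  (∀ x ∈ R.dom, ∃ y ∈ ⋃ j, U j, R.rel x y) ∧
  (∀ i j : ι, ∀ x ∈ U i, ∀ y ∈ U j, R.rel x y → i = j) ∧
  (∀ j, ∀ x ∈ U j, ∀ y ∈ U j, (R.rel x y ↔ (Rf j).rel x y))

/-- A free product decomposition is inessential if it admits a trivialization. -/
def Inessential {X : Type} [MeasurableSpace X] {ι : Type}
    (R : CBER X) (Rf : ι → CBER X) : Prop :=
  ∃ U : ι → Set X, Trivializes R Rf U

/-- Freely indecomposable (Borel context): every free product decomposition is inessential. -/
def FreelyIndecomposable {X : Type} [MeasurableSpace X] (R : CBER X) : Prop :=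
  ∀ (ι : Type) (_ : Countable ι) (Rf : ι → CBER X), IsFreeProduct R Rf → Inessential R Rf

/-- Inessential decomposition in the measured context: a trivialization up to `μ`-null sets. -/
def InessentialMod {X : Type} [MeasurableSpace X] (μ : Measure X) {ι : Type}
    (R : CBER X) (Rf : ι → CBER X) : Prop :=
  ∃ (U : ι → Set X) (C : Set X),
    (∀ j, MeasurableSet (U j)) ∧ (∀ j, U j ⊆ R.dom) ∧
    Pairwise (Function.onFun Disjoint U) ∧
    MeasurableSet C ∧ μ Cᶜ = 0 ∧
    (∀ x ∈ R.dom ∩ C, ∃ y ∈ ⋃ j, U j, R.rel x y) ∧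
    (∀ i j : ι, ∀ x ∈ U i ∩ C, ∀ y ∈ U j ∩ C, R.rel x y → i = j) ∧
    (∀ j, ∀ x ∈ U j ∩ C, ∀ y ∈ U j ∩ C, (R.rel x y ↔ (Rf j).rel x y))

/-- Freely indecomposable (measured context): every free product decomposition is
inessential up to `μ`-null sets. -/
def FreelyIndecomposableMod {X : Type} [MeasurableSpace X] (μ : Measure X)
    (R : CBER X) : Prop :=
  ∀ (ι : Type) (_ : Countable ι) (Rf : ι → CBER X), IsFreeProduct R Rf →
    InessentialMod μ R Rf

/-- One step of a word in a graphing: apply `φ` (if `e = true`) or `φ⁻¹` (if `e = false`). -/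
def PBIStep {X : Type} [MeasurableSpace X] (φ : PBI X) : Bool → X → X → Prop
  | true, a, b => a ∈ φ.src ∧ φ.toFun a = b
  | false, a, b => a ∈ φ.tgt ∧ φ.invFun a = b

/-- A treeing: any cyclic word in the generators and their inverses admits a reduction. -/
def IsTreeing {X : Type} [MeasurableSpace X] {ι : Type} (Φ : ι → PBI X) : Prop :=
  ∀ (n : ℕ) (i : ℕ → ι) (ε : ℕ → Bool) (x : ℕ → X),
    0 < n → x n = x 0 → (∀ j < n, PBIStep (Φ (i j)) (ε j) (x j) (x (j + 1))) →
    ∃ j, j + 1 < n ∧ i j = i (j + 1) ∧ ε j ≠ ε (j + 1)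

/-- The graphing `Φ` generates `R`: `R` is the smallest equivalence relation on the union of
the sources and targets containing the graphs of the `Φ i`. -/
def GeneratesCBER {X : Type} [MeasurableSpace X] {ι : Type} (Φ : ι → PBI X)
    (R : CBER X) : Prop :=
  R.dom = (⋃ i, ((Φ i).src ∪ (Φ i).tgt)) ∧ (∀ i, R.InPseudogroup (Φ i)) ∧
    ∀ x y, R.rel x y ↔ (x ∈ R.dom ∧
      Relation.EqvGen (fun a b => ∃ i, a ∈ (Φ i).src ∧ (Φ i).toFun a = b) x y)

/-- Treeable: generated by some (countable) treeing. -/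
def CBER.Treeable {X : Type} [MeasurableSpace X] (R : CBER X) : Prop :=
  ∃ Φ : ℕ → PBI X, IsTreeing Φ ∧ GeneratesCBER Φ R

/-- Hyperfinite: increasing union of finite Borel subrelations. -/
def CBER.Hyperfinite {X : Type} [MeasurableSpace X] (R : CBER X) : Prop :=
  ∃ S : ℕ → CBER X, (∀ n, (S n).IsSubrelOf R) ∧ (∀ n, (S n).FiniteClasses) ∧
    (∀ n, (S n).dom = R.dom) ∧ (∀ n, ∀ x y, (S n).rel x y → (S (n + 1)).rel x y) ∧
    ∀ x y, R.rel x y → ∃ n, (S n).rel x y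

/-- Ergodicity of a measured CBER: every invariant Borel set is null or conull. -/
def ErgodicCBER {X : Type} [MeasurableSpace X] (R : CBER X) (μ : Measure X) : Prop :=
  ∀ A : Set X, MeasurableSet A → (∀ x ∈ A, ∀ y, R.rel x y → y ∈ A) →
    μ A = 0 ∨ μ Aᶜ = 0

/-- A stable orbit equivalence between measured CBERs: a Borel isomorphism between
complete sections (mod null sets), sending the normalized measure to the normalized
measure, and preserving the relations a.e. -/
structure SOEquiv {X Y : Type} [MeasurableSpace X] [MeasurableSpace Y]
    (R : CBER X) (μ : Measure X) (S : CBER Y) (ν : Measure Y) where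
  A : Set X
  B : Set Y
  toFun : X → Y
  invFun : Y → X
  measA : MeasurableSet A
  measB : MeasurableSet B
  A_sub : A ⊆ R.dom
  B_sub : B ⊆ S.dom
  A_pos : 0 < μ A
  B_pos : 0 < ν B
  A_section : ∀ᵐ x ∂μ, x ∈ R.dom → ∃ y ∈ A, R.rel x y
  B_section : ∀ᵐ y ∂ν, y ∈ S.dom → ∃ z ∈ B, S.rel y z
  meas_toFun : Measurable toFun
  meas_invFun : Measurable invFun
  mapsTo : Set.MapsTo toFun A B
  mapsTo_inv : Set.MapsTo invFun B A
  left_inv : ∀ x ∈ A, invFun (toFun x) = x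
  right_inv : ∀ y ∈ B, toFun (invFun y) = y
  measure_eq : ∀ E : Set X, E ⊆ A → MeasurableSet E →
    (μ A)⁻¹ * μ E = (ν B)⁻¹ * ν (toFun '' E)
  rel_iff : ∃ C : Set X, MeasurableSet C ∧ μ (A \ C) = 0 ∧
    ∀ x ∈ A ∩ C, ∀ y ∈ A ∩ C, (R.rel x y ↔ S.rel (toFun x) (toFun y))

/-- Stable orbit equivalence. -/
def SOE {X Y : Type} [MeasurableSpace X] [MeasurableSpace Y]
    (R : CBER X) (μ : Measure X) (S : CBER Y) (ν : Measure Y) : Prop :=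
  Nonempty (SOEquiv R μ S ν)

/-- Orbit equivalence: a stable orbit equivalence where one can take the complete
sections to be the full spaces. -/
def OE {X Y : Type} [MeasurableSpace X] [MeasurableSpace Y]
    (R : CBER X) (μ : Measure X) (S : CBER Y) (ν : Measure Y) : Prop :=
  ∃ E : SOEquiv R μ S ν, E.A = Set.univ ∧ E.B = Set.univ

/-- A probability measure preserving action of a group `G` on a measured space. -/
structure PMPAction (G : Type) [Group G] (X : Type) [MeasurableSpace X]
    (μ : Measure X) where
  act : G → X → X
  act_one : ∀ x, act 1 x = x
  act_mul : ∀ g h x, act (g * h) x = act g (act h x)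
  measurePreserving : ∀ g, MeasurePreserving (act g) μ μ

/-- Essential freeness: a.e. point has trivial stabilizer. -/
def PMPAction.IsFree {G X : Type} [Group G] [MeasurableSpace X] {μ : Measure X}
    (α : PMPAction G X μ) : Prop :=
  ∀ᵐ x ∂μ, ∀ g : G, α.act g x = x → g = 1

/-- `R` is the orbit equivalence relation of the action `α` restricted to the subgroup `H`. -/
def IsOrbitRel {G X : Type} [Group G] [MeasurableSpace X] {μ : Measure X}
    (α : PMPAction G X μ) (H : Subgroup G) (R : CBER X) : Prop :=
  R.dom = Set.univ ∧ ∀ x y, (R.rel x y ↔ ∃ g ∈ H, α.act g x = y)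

/-- A countable group is measurably freely indecomposable (MFI) if the orbit equivalence
relation of every free p.m.p. action of it on a standard probability space is freely
indecomposable. -/
def MFI (G : Type) [Group G] [Countable G] : Prop :=
  ∀ (X : Type) [MeasurableSpace X] [StandardBorelSpace X]
    (μ : Measure X) [IsProbabilityMeasure μ]
    (α : PMPAction G X μ) (R : CBER X),
    α.IsFree → IsOrbitRel α ⊤ R → FreelyIndecomposableMod μ R

/-- `G` is the internal free product of the family of subgroups `H`. -/
def IsFreeProductOf (G : Type) [Group G] {ι : Type} (H : ι → Subgroup G) : Prop :=
  Function.Bijective (Monoid.CoprodI.lift fun i => (H i).subtype)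

/-- A Borel fundamental domain for an action, of the coupling kind: meets a.e. orbit,
and meets each orbit at most once mod null. -/
def IsFundamentalDomainFor {G : Type} [Group G] {Ω : Type} [MeasurableSpace Ω]
    (ν : Measure Ω) (a : G → Ω → Ω) (D : Set Ω) : Prop :=
  MeasurableSet D ∧ (∀ᵐ x ∂ν, ∃ g : G, a g x ∈ D) ∧
    ∀ g : G, g ≠ 1 → ν (D ∩ a g ⁻¹' D) = 0

/-- A measure equivalence coupling between `G` and `H`: a standard σ-finite measure space
with commuting measure-preserving essentially free actions of `G` and `H`, each admitting
a Borel fundamental domain of finite positive measure. -/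
structure MECoupling (G : Type) [Group G] (H : Type) [Group H] where
  (Ω : Type)
  [mΩ : MeasurableSpace Ω]
  [sbΩ : StandardBorelSpace Ω]
  (ν : Measure Ω)
  sigmaFinite : SigmaFinite ν
  aG : G → Ω → Ω
  aH : H → Ω → Ω
  DG : Set Ω
  DH : Set Ω
  aG_one : ∀ x, aG 1 x = x
  aG_mul : ∀ g g' x, aG (g * g') x = aG g (aG g' x)
  aH_one : ∀ x, aH 1 x = x
  aH_mul : ∀ h h' x, aH (h * h') x = aH h (aH h' x)
  comm : ∀ g h x, aG g (aH h x) = aH h (aG g x)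
  mp_aG : ∀ g, MeasurePreserving (aG g) ν ν
  mp_aH : ∀ h, MeasurePreserving (aH h) ν ν
  free_aG : ∀ᵐ x ∂ν, ∀ g, aG g x = x → g = 1
  free_aH : ∀ᵐ x ∂ν, ∀ h, aH h x = x → h = 1
  fund_DG : IsFundamentalDomainFor ν aG DG
  fund_DH : IsFundamentalDomainFor ν aH DH
  DG_pos : 0 < ν DG
  DG_fin : ν DG < ⊤
  DH_pos : 0 < ν DH
  DH_fin : ν DH < ⊤

/-- The generalized index (compression constant) of a measure equivalence coupling. -/
noncomputable def MECoupling.index {G : Type} [Group G] {H : Type} [Group H]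
    (c : MECoupling G H) : ENNReal :=
  c.ν c.DH / c.ν c.DG

/-- Measure equivalence of countable groups. -/
def MeasureEquivalent (G : Type) [Group G] (H : Type) [Group H] : Prop :=
  Nonempty (MECoupling G H)

/-- Measure equivalence with a prescribed generalized index. -/
def MEwithIndex (G : Type) [Group G] (H : Type) [Group H] (κ : ENNReal) : Prop :=
  ∃ c : MECoupling G H, c.index = κ

/-- Free independence follows from cuts: every nontrivial class of every factor is separated by a
map which is injective on that class and constant along all other classes. -/
theorem freelyIndep_of_cut {X ι : Type} [MeasurableSpace X] (T : CBER X) (Rf : ι → CBER X)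
    (hsub : ∀ i x y, (Rf i).rel x y → T.rel x y)
    (hcut : ∀ i x₀ x₁, (Rf i).rel x₀ x₁ → x₀ ≠ x₁ → ∃ f : X → X,
      (∀ w w', (Rf i).rel x₀ w → (Rf i).rel x₀ w' → f w = f w' → w = w') ∧
      ∀ j w w', T.rel x₀ w → (Rf j).rel w w' → (j ≠ i ∨ ¬ (Rf i).rel x₀ w) → f w = f w') :
    FreelyIndep Rf := by
  suffices H : ∀ (n : ℕ) (x : ℕ → X) (i : ℕ → ι), 1 ≤ n → x n = x 0 →
      (∀ j < n, x j ≠ x (j + 1)) → (∀ j < n, (Rf (i j)).rel (x j) (x (j + 1))) →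
      ∃ j, j + 1 < n ∧ i j = i (j + 1) from
    fun n x i hn => H n x i (by omega)
  intro n
  induction n using Nat.strong_induction_on with
  | _ n ih =>
  intro x i hn hx hne hrel
  by_contra hcon
  push Not at hcon
  obtain ⟨f, hinj, hconst⟩ := hcut (i 0) (x 0) (x 1) (hrel 0 (by omega)) (hne 0 (by omega))
  have hT : ∀ j ≤ n, T.rel (x 0) (x j) := by
    intro j
    induction j with
    | zero =>
      intro _
      have := hsub _ _ _ (hrel 0 (by omega))
      exact T.trans this (T.symm this)
    | succ k ihk => exact fun hk => T.trans (ihk (by omega)) (hsub _ _ _ (hrel k (by omega)))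
  have h01 : (Rf (i 0)).rel (x 0) (x 1) := hrel 0 (by omega)
  have h00 : (Rf (i 0)).rel (x 0) (x 0) := (Rf (i 0)).trans h01 ((Rf (i 0)).symm h01)
  classical
  have key : ∀ m, 1 ≤ m → m ≤ n →
      (∀ j, 1 ≤ j → j < m → ¬ (i j = i 0 ∧ (Rf (i 0)).rel (x 0) (x j))) → f (x 1) = f (x m) := by
    intro m hm
    induction m, hm using Nat.le_induction with
    | base => intros; rfl
    | succ k hk ihk =>
      intro hkn hno
      rw [ihk (by omega) (fun j h1 h2 => hno j h1 (by omega))]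
      refine hconst (i k) _ _ (hT k (by omega)) (hrel k (by omega)) ?_
      by_contra hc
      push Not at hc
      exact hno k hk (by omega) hc
  by_cases hex : ∃ j, 1 ≤ j ∧ j < n ∧ i j = i 0 ∧ (Rf (i 0)).rel (x 0) (x j)
  · have hmin := Nat.find_spec hex
    set j := Nat.find hex with hj
    obtain ⟨hj1, hjn, hij, hrj⟩ := hmin
    have hj2 : 2 ≤ j := by
      rcases Nat.lt_or_ge 1 j with h | h
      · exact h
      · have : j = 1 := by omega
        rw [this] at hij
        exact absurd hij.symm (hcon 0 (by omega))
    have hfe := key j hj1 hjn.le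
      (fun k hk1 hk2 hk3 => Nat.find_min hex hk2 ⟨hk1, by omega, hk3⟩)
    have hxe : x 1 = x j := hinj _ _ h01 hrj hfe
    obtain ⟨k, hk, hki⟩ := ih (j - 1) (by omega) (fun k => x (k + 1)) (fun k => i (k + 1))
      (by omega) (by simp only [Nat.sub_add_cancel hj1, zero_add]; exact hxe.symm)
      (fun k hk => hne (k + 1) (by omega)) (fun k hk => hrel (k + 1) (by omega))
    exact hcon (k + 1) (by omega) hki
  · push Not at hex
    have hfe := key n hn le_rfl (fun j h1 h2 h3 => hex j h1 h2 h3.1 h3.2)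
    rw [hx] at hfe
    exact hne 0 (by omega) (hinj _ _ h00 h01 hfe.symm)

/-- A walk of length `n` from `a` to `b` in a graphing which avoids the edge `(i₀, y₀)`. -/
def WalkAvoiding {Y : Type} [MeasurableSpace Y] (Φ : ℕ → PBI Y) (i₀ : ℕ) (y₀ a b : Y)
    (n : ℕ) : Prop :=
  ∃ (i : ℕ → ℕ) (ε : ℕ → Bool) (x : ℕ → Y), x 0 = a ∧ x n = b ∧
    (∀ j < n, PBIStep (Φ (i j)) (ε j) (x j) (x (j + 1))) ∧
    ∀ j < n, ¬ (i j = i₀ ∧ ((ε j = true ∧ x j = y₀) ∨ (ε j = false ∧ x (j + 1) = y₀)))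

theorem PBIStep.invert {Y : Type} [MeasurableSpace Y] {φ : PBI Y} {e : Bool} {a b : Y}
    (h : PBIStep φ e a b) : PBIStep φ (!e) b a := by
  cases e with
  | true =>
    obtain ⟨h1, rfl⟩ := h
    exact ⟨φ.mapsTo h1, φ.left_inv _ h1⟩
  | false =>
    obtain ⟨h1, rfl⟩ := h
    exact ⟨φ.mapsTo_inv h1, φ.right_inv _ h1⟩

theorem PBIStep.unique {Y : Type} [MeasurableSpace Y] {φ : PBI Y} {e : Bool} {a b c : Y}
    (h : PBIStep φ e a b) (h' : PBIStep φ e a c) : b = c := by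
  cases e <;> exact h.2.symm.trans h'.2

theorem WalkAvoiding.snoc {Y : Type} [MeasurableSpace Y] {Φ : ℕ → PBI Y} {i₀ : ℕ} {y₀ a b c : Y}
    {n : ℕ} (h : WalkAvoiding Φ i₀ y₀ a b n) (k : ℕ) (e : Bool) (hs : PBIStep (Φ k) e b c)
    (hk : ¬ (k = i₀ ∧ ((e = true ∧ b = y₀) ∨ (e = false ∧ c = y₀)))) :
    WalkAvoiding Φ i₀ y₀ a c (n + 1) := by
  obtain ⟨i, ε, x, h0, hn, hst, hav⟩ := h
  refine ⟨fun j => if j < n then i j else k, fun j => if j < n then ε j else e,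
    fun j => if j ≤ n then x j else c, by simp [h0], by simp, ?_, ?_⟩
  · intro j hj
    rcases Nat.lt_or_ge j n with h | h
    · simpa [h, h.le, Nat.succ_le_of_lt h] using hst j h
    · have : j = n := by omega
      subst this
      simpa [hn] using hs
  · intro j hj
    rcases Nat.lt_or_ge j n with h | h
    · simpa [h, h.le, Nat.succ_le_of_lt h] using hav j h
    · have : j = n := by omega
      subst this
      simpa [hn] using hk

/-- In a treeing, removing an edge separates its two endpoints. -/
theorem IsTreeing.exists_cut {Y : Type} [MeasurableSpace Y] {Φ : ℕ → PBI Y} (hΦ : IsTreeing Φ)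
    (i₀ : ℕ) (y₀ : Y) (hy₀ : y₀ ∈ (Φ i₀).src) :
    ∃ τ : Y → Prop, τ y₀ ∧ ¬ τ ((Φ i₀).toFun y₀) ∧
      ∀ i y, y ∈ (Φ i).src → ¬ (i = i₀ ∧ y = y₀) → (τ y ↔ τ ((Φ i).toFun y)) := by
  refine ⟨fun y => ∃ n, WalkAvoiding Φ i₀ y₀ y₀ y n, ?_, ?_, ?_⟩
  · exact ⟨0, fun _ => 0, fun _ => true, fun _ => y₀, rfl, rfl, by simp, by simp⟩
  · intro hex
    classical
    have hspec := Nat.find_spec hex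
    have hmin := fun m => Nat.find_min hex (m := m)
    set n := Nat.find hex
    obtain ⟨i, ε, x, h0, hn, hst, hav⟩ := hspec
    obtain ⟨j, hj, hij, hεj⟩ := hΦ (n + 1) (fun j => if j < n then i j else i₀)
      (fun j => if j < n then ε j else false) (fun j => if j ≤ n then x j else y₀)
      (by omega) (by simp [h0]) (by
        intro j hj
        rcases Nat.lt_or_ge j n with h | h
        · simpa [h, h.le, Nat.succ_le_of_lt h] using hst j h
        · have : j = n := by omega
          subst this
          simp only [le_refl, if_true, lt_irrefl, if_false, hn]
          simpa using PBIStep.invert (show PBIStep (Φ i₀) true y₀ _ from ⟨hy₀, rfl⟩))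
    have hjn : j < n := by omega
    simp only [hjn, if_true] at hij hεj
    rcases Nat.lt_or_ge (j + 1) n with h | h
    · simp only [h, if_true] at hij hεj
      have hback : x (j + 2) = x j := by
        have h1 := (hst j hjn).invert
        have h2 := hst (j + 1) h
        rw [← hij] at h2
        have he : ε (j + 1) = !(ε j) := by
          revert hεj
          cases ε j <;> cases ε (j + 1) <;> simp
        rw [he] at h2
        exact h2.unique h1
      refine hmin (n - 2) (by omega) ⟨fun k => if k < j then i k else i (k + 2),
        fun k => if k < j then ε k else ε (k + 2), fun k => if k < j then x k else x (k + 2),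
        ?_, ?_, ?_, ?_⟩
      · rcases Nat.eq_zero_or_pos j with hj0 | hj0
        · subst hj0; simpa [h0] using hback
        · simp [hj0, h0]
      · have : ¬ (n - 2 < j) := by omega
        simp only [this, if_false]
        rw [Nat.sub_add_cancel (by omega), hn]
      · intro k hk
        rcases lt_trichotomy (k + 1) j with h3 | h3 | h3
        · simpa [h3, show k < j by omega] using hst k (by omega)
        · subst h3
          simp only [lt_add_iff_pos_right, zero_lt_one, if_true, lt_irrefl, if_false]
          rw [show k + 1 + 2 = k + 1 + 2 from rfl, hback]
          exact hst k (by omega)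
        · simpa [show ¬ (k < j) by omega, show ¬ (k + 1 < j) by omega, add_right_comm] using
            hst (k + 2) (by omega)
      · intro k hk
        rcases lt_trichotomy (k + 1) j with h3 | h3 | h3
        · simpa [h3, show k < j by omega] using hav k (by omega)
        · subst h3
          simp only [lt_add_iff_pos_right, zero_lt_one, if_true, lt_irrefl, if_false]
          rw [hback]
          exact hav k (by omega)
        · simpa [show ¬ (k < j) by omega, show ¬ (k + 1 < j) by omega, add_right_comm] using
            hav (k + 2) (by omega)
    · have hjn' : j + 1 = n := by omega
      simp only [show ¬ (j + 1 < n) by omega, if_false] at hij hεj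
      have he : ε j = true := by simpa using hεj
      have h1 := hst j hjn
      rw [hij, he, hjn', hn] at h1
      have hxj : x j = y₀ := by
        have := (Φ i₀).left_inv _ h1.1
        rw [h1.2, (Φ i₀).left_inv _ hy₀] at this
        exact this.symm
      exact hav j hjn ⟨hij, Or.inl ⟨he, hxj⟩⟩
  · intro i y hy hne
    constructor
    · rintro ⟨n, hn⟩
      exact ⟨n + 1, hn.snoc i true ⟨hy, rfl⟩ (by simpa using hne)⟩
    · rintro ⟨n, hn⟩
      refine ⟨n + 1, hn.snoc i false ?_ (by simpa using hne)⟩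
      simpa using PBIStep.invert (show PBIStep (Φ i) true y _ from ⟨hy, rfl⟩)

section FreeProductWords

open Monoid Monoid.CoprodI

variable {ι : Type} {M : ι → Type} [∀ i, Group (M i)] [DecidableEq ι] [∀ i, DecidableEq (M i)]

theorem fstIdx_equiv_of_ne (i j : ι) (m : M i) (hij : i ≠ j) :
    (Word.equiv (of m : CoprodI M)).fstIdx ≠ some j := by
  by_cases hm : m = 1
  · subst hm
    simp [Word.equiv, Word.fstIdx, Word.empty]
  · have h0 : (Word.empty : Word M).fstIdx ≠ some i := by simp [Word.fstIdx, Word.empty]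
    have : Word.equiv (of m : CoprodI M) = Word.cons m Word.empty h0 hm := by
      rw [Word.cons_eq_smul]; rfl
    rw [this, Word.fstIdx_cons]
    simpa using hij

theorem fstIdx_equiv_mul_of (i : ι) (m : M i) (w : Word M) : ∀ j, w.fstIdx ≠ some j →
    (i ≠ j ∨ w ≠ Word.empty) → (Word.equiv (w.prod * of m)).fstIdx ≠ some j := by
  induction w using Word.consRecOn with
  | empty =>
    intro j _ h
    rw [Word.prod_empty, one_mul]
    exact fstIdx_equiv_of_ne i j m (by simpa using h)
  | cons k mk w' h1 h2 ih =>
    intro j hj _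
    rw [Word.fstIdx_cons] at hj
    rw [Word.prod_cons, mul_assoc]
    by_cases hc : i ≠ k ∨ w' ≠ Word.empty
    · have h3 := ih k h1 hc
      have : Word.equiv (of mk * (w'.prod * of m)) =
          Word.cons mk (Word.equiv (w'.prod * of m)) h3 h2 := by
        rw [Word.cons_eq_smul]
        exact mul_smul (of mk : CoprodI M) (w'.prod * of m) (Word.empty : Word M)
      rw [this, Word.fstIdx_cons]
      exact hj
    · push Not at hc
      obtain ⟨rfl, rfl⟩ := hc
      rw [Word.prod_empty, one_mul, ← map_mul]
      exact fstIdx_equiv_of_ne _ _ _ (by simpa using hj)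

theorem equivPair_head_of_mul (j : ι) (m : M j) (g : CoprodI M) :
    (Word.equivPair j (Word.equiv (of m * g))).head = m * (Word.equivPair j (Word.equiv g)).head := by
  have : Word.equiv (of m * g) = of m • Word.equiv g :=
    mul_smul (of m : CoprodI M) g (Word.empty : Word M)
  rw [this, Word.equivPair_smul_same]

theorem equivPair_head_mul_of (i j : ι) (m : M i) (g : CoprodI M)
    (h : i ≠ j ∨ g ∉ Set.range (of : M j → CoprodI M)) :
    (Word.equivPair j (Word.equiv (g * of m))).head = (Word.equivPair j (Word.equiv g)).head := by
  set p := Word.equivPair j (Word.equiv g) with hp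
  have hg : g = of p.head * p.tail.prod := by
    rw [← Word.prod_rcons, ← Word.equivPair_symm, hp, Equiv.symm_apply_apply]
    exact (Word.equiv.symm_apply_apply g).symm
  have hne : (Word.equiv (p.tail.prod * of m)).fstIdx ≠ some j := by
    refine fstIdx_equiv_mul_of i m p.tail j p.fstIdx_ne ?_
    refine h.imp id fun hr he => hr ⟨p.head, ?_⟩
    rw [hg, he, Word.prod_empty, mul_one]
  have h1 : Word.equivPair j (Word.equiv (g * of m)) =
      Word.equivPair j (Word.equiv (of p.head * (p.tail.prod * of m))) := by
    rw [← mul_assoc, ← hg]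
  rw [h1, equivPair_head_of_mul, Word.equivPair_eq_of_fstIdx_ne hne, mul_one]

end FreeProductWords

/-- In a free product, the last letter of an element in a given factor, with value `1` if the
reduced word of the element does not end in that factor. -/
theorem IsFreeProductOf.exists_lastLetter {H ι : Type} [Group H] {Λ : ι → Subgroup H}
    (hH : IsFreeProductOf H Λ) (j : ι) :
    ∃ ρ : H → H, (∀ h, ρ h ∈ Λ j) ∧ (∀ h, ∀ l ∈ Λ j, ρ (h * l) = ρ h * l) ∧ ρ 1 = 1 ∧
      ∀ i, ∀ l ∈ Λ i, ∀ h, (i = j ∧ h ∈ Λ j) ∨ ρ (l * h) = ρ h := by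
  classical
  let e : Monoid.CoprodI (fun i => Λ i) ≃* H := MulEquiv.ofBijective _ hH
  have he : ∀ i (l : Λ i), e (Monoid.CoprodI.of l) = l := fun i l =>
    Monoid.CoprodI.lift_of (fun i => (Λ i).subtype) l
  have he' : ∀ i (l : Λ i), e.symm l = Monoid.CoprodI.of (M := fun i => Λ i) l := fun i l => by
    exact e.symm_apply_eq.mpr (he i l).symm
  let σ : H → Λ j := fun h =>
    (Monoid.CoprodI.Word.equivPair j (Monoid.CoprodI.Word.equiv (e.symm h))).head
  have hσ1 : σ 1 = 1 := by
    have h0 : Monoid.CoprodI.Word.equiv (1 : Monoid.CoprodI (fun i => Λ i)) =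
        Monoid.CoprodI.Word.empty :=
      one_smul (Monoid.CoprodI (fun i => Λ i)) (Monoid.CoprodI.Word.empty (M := fun i => Λ i))
    simp only [σ, map_one, h0]
    rw [Monoid.CoprodI.Word.equivPair_eq_of_fstIdx_ne]
    simp [Monoid.CoprodI.Word.fstIdx, Monoid.CoprodI.Word.empty]
  have hσl : ∀ (l : Λ j) h, σ (l * h) = l * σ h := fun l h => by
    simp only [σ, map_mul, he']
    exact equivPair_head_of_mul (M := fun i => Λ i) j l _
  have hσr : ∀ i (l : Λ i) h, (i = j ∧ h ∈ Λ j) ∨ σ (h * l) = σ h := fun i l h => by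
    by_cases hc : i = j ∧ h ∈ Λ j
    · exact Or.inl hc
    · right
      simp only [σ, map_mul, he']
      refine equivPair_head_mul_of (M := fun i => Λ i) i j l _ ?_
      by_contra hcon
      push Not at hcon
      obtain ⟨hij, l', hl'⟩ := hcon
      refine hc ⟨hij, ?_⟩
      rw [← e.apply_symm_apply h, ← hl', he]
      exact l'.2
  refine ⟨fun h => (σ h⁻¹ : H)⁻¹, fun h => inv_mem (σ h⁻¹).2, fun h l hl => ?_, by simp [hσ1],
    fun i l hl h => ?_⟩
  · have := hσl ⟨l⁻¹, inv_mem hl⟩ h⁻¹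
    simp only at this
    simp only [mul_inv_rev, this]
    simp
  · refine (hσr i ⟨l⁻¹, inv_mem hl⟩ h⁻¹).imp (fun hh => ⟨hh.1, by simpa using hh.2⟩) fun hh => ?_
    simp only at hh
    simp only [mul_inv_rev, hh]

theorem IsFreeProductOf.induction {H ι : Type} [Group H] {Λ : ι → Subgroup H}
    (hH : IsFreeProductOf H Λ) {motive : H → Prop} (one : motive 1)
    (mul : ∀ i, ∀ l ∈ Λ i, ∀ h, motive h → motive (l * h)) (h : H) : motive h := by
  obtain ⟨w, rfl⟩ := hH.2 h
  induction w using Monoid.CoprodI.induction_left with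
  | one => simpa using one
  | mul m x ih =>
    rw [map_mul, Monoid.CoprodI.lift_of]
    exact mul _ _ m.2 _ ih

namespace PMPAction

variable {G X : Type} [Group G] [MeasurableSpace X] {μ : Measure X} (α : PMPAction G X μ)

theorem measurable_act (g : G) : Measurable (α.act g) := (α.measurePreserving g).measurable

theorem act_inv_act (g : G) (x : X) : α.act g⁻¹ (α.act g x) = x := by
  rw [← α.act_mul, inv_mul_cancel, α.act_one]

theorem act_act_inv (g : G) (x : X) : α.act g (α.act g⁻¹ x) = x := by
  rw [← α.act_mul, mul_inv_cancel, α.act_one]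

theorem measure_preimage_act (g : G) {U : Set X} (hU : MeasurableSet U) :
    μ (α.act g ⁻¹' U) = μ U :=
  (α.measurePreserving g).measure_preimage hU.nullMeasurableSet

theorem null_preimage_act (g : G) {N : Set X} (hN : μ N = 0) : μ (α.act g ⁻¹' N) = 0 :=
  (α.measurePreserving g).quasiMeasurePreserving.preimage_null hN

/-- The union of the translates of a null set is null. -/
theorem null_translates [Countable G] {N : Set X} (hN : μ N = 0) :
    μ {x | ∃ g, α.act g x ∈ N} = 0 := by
  have : {x | ∃ g, α.act g x ∈ N} = ⋃ g, α.act g ⁻¹' N := by ext; simp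
  rw [this]
  exact measure_iUnion_null fun g => α.null_preimage_act g hN

theorem eq_of_act_eq {x : X} (hx : ∀ g, α.act g x = x → g = 1) {g h : G}
    (hgh : α.act g x = α.act h x) : g = h := by
  have : α.act (h⁻¹ * g) x = x := by rw [α.act_mul, hgh, α.act_inv_act]
  exact (inv_mul_eq_one.mp (hx _ this)).symm

/-- A Borel set meeting almost every orbit of an infinite group in at most two points is null. -/
theorem null_of_orbit_le_two [Countable G] [IsFiniteMeasure μ] (hfree : α.IsFree) (Γ : Subgroup G)
    [Infinite Γ] {U : Set X} (hU : MeasurableSet U)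
    (h : ∀ x ∈ U, ∀ g₁ ∈ Γ, ∀ g₂ ∈ Γ, α.act g₁ x ∈ U → α.act g₂ x ∈ U →
      α.act g₁ x = x ∨ α.act g₂ x = x ∨ α.act g₁ x = α.act g₂ x) : μ U = 0 := by
  have hbound : ∀ n : ℕ, (n : ENNReal) * μ U ≤ 2 * μ Set.univ := by
    intro n
    obtain ⟨s, hs⟩ := Infinite.exists_subset_card_eq Γ n
    have h1 : (n : ENNReal) * μ U = ∫⁻ x, ∑ γ ∈ s, U.indicator 1 (α.act γ x) ∂μ := by
      rw [lintegral_finsetSum]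
      · have : ∀ γ ∈ s, ∫⁻ x, U.indicator (1 : X → ENNReal) (α.act γ x) ∂μ = μ U := by
          intro γ _
          rw [(α.measurePreserving (γ : G)).lintegral_comp (measurable_one.indicator hU),
            lintegral_indicator_one hU]
        rw [Finset.sum_congr rfl this, Finset.sum_const, hs, nsmul_eq_mul]
      · exact fun γ _ => (measurable_one.indicator hU).comp (α.measurable_act γ)
    rw [h1]
    calc _ ≤ ∫⁻ _, (2 : ENNReal) ∂μ := by
            refine lintegral_mono_ae ?_
            filter_upwards [hfree] with x hx
            classical
            have : ∑ γ ∈ s, U.indicator (1 : X → ENNReal) (α.act γ x) =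
                ((s.filter fun γ : Γ => α.act γ x ∈ U).card : ENNReal) := by
              rw [Finset.card_filter]
              push_cast
              exact Finset.sum_congr rfl fun γ _ => by simp [Set.indicator_apply]
            rw [this]
            suffices hc : (s.filter fun γ : Γ => α.act γ x ∈ U).card ≤ 2 by exact_mod_cast hc
            by_contra hcon
            obtain ⟨a, ha, b, hb, c, hc, hab, hac, hbc⟩ := Finset.two_lt_card.mp (not_le.mp hcon)
            simp only [Finset.mem_filter] at ha hb hc
            have e : ∀ d : Γ, α.act (d * (a : G)⁻¹) (α.act a x) = α.act d x := fun d => by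
              rw [α.act_mul, α.act_inv_act]
            have := h (α.act a x) ha.2 (b * (a : G)⁻¹) (mul_mem b.2 (inv_mem a.2))
              (c * (a : G)⁻¹) (mul_mem c.2 (inv_mem a.2)) (by rw [e]; exact hb.2)
              (by rw [e]; exact hc.2)
            rw [e, e] at this
            rcases this with h | h | h
            · exact hab (Subtype.ext (α.eq_of_act_eq hx h)).symm
            · exact hac (Subtype.ext (α.eq_of_act_eq hx h)).symm
            · exact hbc (Subtype.ext (α.eq_of_act_eq hx h))
      _ = 2 * μ Set.univ := by simp
  by_contra hne
  have hfin : 2 * μ Set.univ / μ U ≠ ⊤ :=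
    ENNReal.div_ne_top (ENNReal.mul_ne_top (by simp) (measure_ne_top _ _)) hne
  obtain ⟨n, hn⟩ := ENNReal.exists_nat_gt hfin
  rw [ENNReal.div_lt_iff (Or.inl hne) (Or.inl (measure_ne_top _ _))] at hn
  exact absurd (hbound n) (not_le.mpr hn)

end PMPAction

theorem exists_seq_measurableSet_separating (X : Type) [MeasurableSpace X]
    [StandardBorelSpace X] : ∃ S : ℕ → Set X, (∀ n, MeasurableSet (S n)) ∧
      ∀ x y, x ≠ y → ∃ n, x ∈ S n ∧ y ∉ S n := by
  obtain ⟨S, hS, hsep⟩ := exists_seq_separating X (p := MeasurableSet) MeasurableSet.empty Set.univ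
  refine ⟨fun n => if Even n then S (n / 2) else (S (n / 2))ᶜ, fun n => ?_, fun x y hxy => ?_⟩
  · dsimp only
    split_ifs
    exacts [hS _, (hS _).compl]
  · by_contra hcon
    push Not at hcon
    refine hxy (hsep x (Set.mem_univ _) y (Set.mem_univ _) fun n => ⟨fun h => ?_, fun h => ?_⟩)
    · simpa [h] using hcon (2 * n)
    · have := hcon (2 * n + 1)
      rw [if_neg (by simp), show (2 * n + 1) / 2 = n by omega] at this
      by_contra hx
      exact this hx h

/-- The equivalence relation with full domain obtained by adding the diagonal to a Borel partial
equivalence relation contained in `T`. -/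
def CBER.ofSubrel {X : Type} [MeasurableSpace X] [StandardBorelSpace X] (T : CBER X)
    (r : X → X → Prop) (hmeas : MeasurableSet {p : X × X | r p.1 p.2})
    (hsub : ∀ x y, r x y → T.rel x y) (hsymm : ∀ x y, r x y → r y x)
    (htrans : ∀ x y z, r x y → r y z → x = z ∨ r x z) : CBER X where
  dom := Set.univ
  dom_meas := MeasurableSet.univ
  rel x y := x = y ∨ r x y
  rel_meas := (measurableSet_eq_fun measurable_fst measurable_snd).union hmeas
  rel_dom _ := ⟨trivial, trivial⟩
  refl x _ := Or.inl rfl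
  symm := fun h => h.imp Eq.symm (hsymm _ _)
  trans := by
    rintro x y z (rfl | h) (rfl | h')
    exacts [Or.inl rfl, Or.inr h', Or.inr h, htrans _ _ _ h h']
  countable_classes x := ((T.countable_classes x).insert x).mono fun y hy =>
    hy.imp Eq.symm (hsub _ _)

theorem Relation.EqvGen.of_le {X : Type} {r : X → X → Prop} {s : X → X → Prop}
    (hr : ∀ x y, r x y → s x y) (hs : Equivalence s) {x y : X} (h : Relation.EqvGen r x y) :
    s x y := by
  induction h with
  | rel _ _ h => exact hr _ _ h
  | refl _ => exact hs.refl _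
  | symm _ _ _ ih => exact hs.symm ih
  | trans _ _ _ _ _ ih ih' => exact hs.trans ih ih'

/-- If the orbit relation of `Γ` is freely indecomposable and is decomposed, in a tree-like
fashion, into partial subrelations `W b` and single edges `x ↦ g a • x` for `x ∈ D a`, then
almost every orbit is, up to passing to a complete section, carried by a single `W b`. -/
theorem FreelyIndecomposableMod.exists_section_core {G X : Type} [Group G] [Countable G]
    [MeasurableSpace X] [StandardBorelSpace X] {μ : Measure X} [IsFiniteMeasure μ]
    {α : PMPAction G X μ} (hfree : α.IsFree) {Γ : Subgroup G} [Infinite Γ] {T : CBER X}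
    (hT : IsOrbitRel α Γ T) (hFI : FreelyIndecomposableMod μ T)
    {A B : Type} [Countable A] [Countable B] {X₀ : Set X} (hX₀ : MeasurableSet X₀)
    (hX₀c : μ X₀ᶜ = 0) (hX₀inv : ∀ x ∈ X₀, ∀ γ ∈ Γ, α.act γ x ∈ X₀)
    (W : B → X → X → Prop) (hWm : ∀ b, MeasurableSet {p : X × X | W b p.1 p.2})
    (hWsymm : ∀ b x y, W b x y → W b y x)
    (hWtrans : ∀ b x y z, W b x y → W b y z → W b x z)
    (hWsub : ∀ b x y, W b x y → x ∈ X₀ ∧ T.rel x y)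
    (D : A → Set X) (hDm : ∀ a, MeasurableSet (D a)) (hDX₀ : ∀ a, D a ⊆ X₀)
    (g : A → G) (hg : ∀ a, g a ∈ Γ) (hne : ∀ a, ∀ x ∈ D a, α.act (g a) x ≠ x)
    (conn : ∀ x ∈ X₀, ∀ y, T.rel x y →
      Relation.EqvGen (fun u v => (∃ b, W b u v) ∨ ∃ a, u ∈ D a ∧ α.act (g a) u = v) x y)
    (cutW : ∀ b x₀, W b x₀ x₀ → ∃ f : X → X,
      (∀ w w', W b x₀ w → W b x₀ w' → f w = f w' → w = w') ∧
      (∀ b' w w', T.rel x₀ w → W b' w w' → (b' ≠ b ∨ ¬ W b x₀ w) → f w = f w') ∧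
      ∀ a w, T.rel x₀ w → w ∈ D a → f w = f (α.act (g a) w))
    (cutE : ∀ a, ∀ x₀ ∈ D a, ∃ f : X → Prop, f x₀ ∧ ¬ f (α.act (g a) x₀) ∧
      (∀ b w w', T.rel x₀ w → W b w w' → (f w ↔ f w')) ∧
      ∀ a' w, T.rel x₀ w → w ∈ D a' → ¬ (a' = a ∧ w = x₀) → (f w ↔ f (α.act (g a') w))) :
    ∃ U : B → Set X, (∀ b, MeasurableSet (U b)) ∧ (∀ b, U b ⊆ X₀) ∧
      (∀ᵐ x ∂μ, ∃ b, ∃ γ ∈ Γ, α.act γ x ∈ U b) ∧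
      ∀ b b' x γ, x ∈ U b → γ ∈ Γ → α.act γ x ∈ U b' →
        b = b' ∧ (α.act γ x = x ∨ W b x (α.act γ x)) := by
  classical
  obtain ⟨S, hSm, hS⟩ := exists_seq_measurableSet_separating X
  have hTr : ∀ x γ, γ ∈ Γ → T.rel x (α.act γ x) := fun x γ hγ => (hT.2 _ _).mpr ⟨γ, hγ, rfl⟩
  have hTX₀ : ∀ x y, T.rel x y → x ∈ X₀ → y ∈ X₀ := by
    intro x y h hx
    obtain ⟨γ, hγ, rfl⟩ := (hT.2 _ _).mp h
    exact hX₀inv x hx γ hγ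
  have hinj : ∀ a x y, α.act (g a) x = α.act (g a) y → x = y := fun a x y h => by
    rw [← α.act_inv_act (g a) x, h, α.act_inv_act]
  -- edges split into pieces whose sources and targets are disjoint
  let E : A × ℕ → Set X := fun a => {x | x ∈ D a.1 ∧ (x ∈ S a.2 ∧ α.act (g a.1) x ∉ S a.2) ∧
    ∀ m < a.2, ¬ (x ∈ S m ∧ α.act (g a.1) x ∉ S m)}
  have hSg : ∀ a m, MeasurableSet {x | x ∈ S m ∧ α.act (g a) x ∉ S m} := fun a m =>
    (hSm m).inter ((α.measurable_act _) (hSm m).compl)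
  have hEm : ∀ a, MeasurableSet (E a) := fun a => by
    refine (hDm a.1).inter ((hSg _ _).inter ?_)
    have : {x | ∀ m < a.2, ¬ (x ∈ S m ∧ α.act (g a.1) x ∉ S m)} =
      ⋂ m, ⋂ (_ : m < a.2), {x | x ∈ S m ∧ α.act (g a.1) x ∉ S m}ᶜ := by ext; simp
    change MeasurableSet {x | ∀ m < a.2, ¬ (x ∈ S m ∧ α.act (g a.1) x ∉ S m)}
    rw [this]
    exact MeasurableSet.iInter fun m => MeasurableSet.iInter fun _ => (hSg _ _).compl
  have hEex : ∀ a, ∀ x ∈ D a, ∃ n, x ∈ E (a, n) := fun a x hx => by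
    have hex := hS x (α.act (g a) x) (hne a x hx).symm
    exact ⟨Nat.find hex, hx, Nat.find_spec hex, fun m hm => Nat.find_min hex hm⟩
  have hEuniq : ∀ a x n m, x ∈ E (a, n) → x ∈ E (a, m) → n = m := by
    intro a x n m hn hm
    rcases lt_trichotomy n m with h | h | h
    · exact absurd hn.2.1 (hm.2.2 n h)
    · exact h
    · exact absurd hm.2.1 (hn.2.2 m h)
  let rE : A × ℕ → X → X → Prop := fun a x y =>
    (x ∈ E a ∧ α.act (g a.1) x = y) ∨ (y ∈ E a ∧ α.act (g a.1) y = x)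
  have hrEm : ∀ a, MeasurableSet {p : X × X | rE a p.1 p.2} := fun a =>
    ((measurable_fst (hEm a)).inter (measurableSet_eq_fun ((α.measurable_act _).comp
      measurable_fst) measurable_snd)).union
    ((measurable_snd (hEm a)).inter (measurableSet_eq_fun ((α.measurable_act _).comp
      measurable_snd) measurable_fst))
  have hrEsub : ∀ a x y, rE a x y → T.rel x y := by
    rintro a x y (⟨-, rfl⟩ | ⟨-, rfl⟩)
    exacts [hTr _ _ (hg _), T.symm (hTr _ _ (hg _))]
  have hrEtrans : ∀ a x y z, rE a x y → rE a y z → x = z := by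
    rintro a x y z (⟨h1, rfl⟩ | ⟨h1, rfl⟩) (⟨h2, h3⟩ | ⟨h2, h3⟩)
    · exact absurd h2.2.1.1 h1.2.1.2
    · exact (hinj _ _ _ h3).symm
    · exact h3
    · exact absurd h1.2.1.1 (by rw [← h3]; exact h2.2.1.2)
  let Rf : B ⊕ (A × ℕ) ⊕ Unit → CBER X := Sum.elim
    (fun b => T.ofSubrel (W b) (hWm b) (fun x y h => (hWsub b x y h).2) (hWsymm b)
      fun x y z h h' => Or.inr (hWtrans b x y z h h'))
    (Sum.elim (fun a => T.ofSubrel (rE a) (hrEm a) (hrEsub a) (fun x y h => h.symm)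
      fun x y z h h' => Or.inl (hrEtrans a x y z h h'))
    (fun _ => T.ofSubrel (fun x y => x ∉ X₀ ∧ T.rel x y)
      ((measurable_fst hX₀.compl).inter T.rel_meas) (fun x y h => h.2)
      (fun x y h => ⟨fun hy => h.1 (hTX₀ _ _ (T.symm h.2) hy), T.symm h.2⟩)
      fun x y z h h' => Or.inr ⟨h.1, T.trans h.2 h'.2⟩))
  have hTrefl : ∀ x, T.rel x x := fun x => T.refl x (by rw [hT.1]; trivial)
  have hsub : ∀ i x y, (Rf i).rel x y → T.rel x y := by
    rintro (b | a | u) x y (rfl | h)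
    · exact hTrefl _
    · exact (hWsub b x y h).2
    · exact hTrefl _
    · exact hrEsub a x y h
    · exact hTrefl _
    · exact h.2
  have hindep : FreelyIndep Rf := by
    refine freelyIndep_of_cut T Rf hsub ?_
    rintro (b | a | u) x₀ x₁ (h | h) hx
    · exact absurd h hx
    · have h0 : W b x₀ x₀ := hWtrans _ _ _ _ h (hWsymm _ _ _ h)
      obtain ⟨f, hf1, hf2, hf3⟩ := cutW b x₀ h0
      refine ⟨f, ?_, ?_⟩
      · intro w w' hw hw'
        refine hf1 w w' ?_ ?_
        · rcases hw with rfl | hw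
          exacts [h0, hw]
        · rcases hw' with rfl | hw
          exacts [h0, hw]
      · rintro (b' | a' | u') w w' hw (rfl | hww') hcond
        · rfl
        · refine hf2 b' w w' hw hww' ?_
          rcases hcond with hc | hc
          · exact Or.inl fun h => hc (by rw [h])
          · exact Or.inr fun h => hc (Or.inr h)
        · rfl
        · rcases hww' with ⟨h1, rfl⟩ | ⟨h1, rfl⟩
          · exact hf3 _ _ hw h1.1
          · exact (hf3 _ _ (T.trans hw (T.symm (hTr _ _ (hg _)))) h1.1).symm
        · rfl
        · exact absurd (hTX₀ _ _ hw (hWsub _ _ _ h0).1) hww'.1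
    · exact absurd h hx
    · obtain ⟨e, he, hcase⟩ : ∃ e, e ∈ E a ∧ ((e = x₀ ∧ α.act (g a.1) e = x₁) ∨
          (e = x₁ ∧ α.act (g a.1) e = x₀)) := by
        rcases h with ⟨h1, h2⟩ | ⟨h1, h2⟩
        exacts [⟨_, h1, Or.inl ⟨rfl, h2⟩⟩, ⟨_, h1, Or.inr ⟨rfl, h2⟩⟩]
      have hcls : ∀ w, (Rf (Sum.inr (Sum.inl a))).rel x₀ w → w = e ∨ w = α.act (g a.1) e := by
        have h01 : ∀ w, (Rf (Sum.inr (Sum.inl a))).rel x₀ w → w = x₀ ∨ w = x₁ := by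
          rintro w (rfl | hw)
          · exact Or.inl rfl
          · exact Or.inr (hrEtrans a x₁ x₀ w h.symm hw).symm
        intro w hw
        rcases h01 w hw with h | h <;> rcases hcase with ⟨h1, h2⟩ | ⟨h1, h2⟩
        exacts [Or.inl (h.trans h1.symm), Or.inr (h.trans h2.symm), Or.inr (h.trans h2.symm),
          Or.inl (h.trans h1.symm)]
      have hex₀ : T.rel x₀ e := by
        rcases hcase with ⟨rfl, -⟩ | ⟨-, rfl⟩
        exacts [hTrefl _, T.symm (hTr _ _ (hg _))]
      obtain ⟨F, hF1, hF2, hF3, hF4⟩ := cutE a.1 e he.1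
      have hF : ∀ w w', (if F w then e else α.act (g a.1) e) =
          (if F w' then e else α.act (g a.1) e) ↔ (F w ↔ F w') := by
        intro w w'
        have := hne a.1 e he.1
        by_cases h1 : F w <;> by_cases h2 : F w' <;> simp [h1, h2, this, this.symm]
      refine ⟨fun w => if F w then e else α.act (g a.1) e, ?_, ?_⟩
      · intro w w' hw hw' hf
        rw [hF] at hf
        rcases hcls w hw with rfl | rfl <;> rcases hcls w' hw' with rfl | rfl
        · rfl
        · exact absurd (hf.mp hF1) hF2
        · exact absurd (hf.mpr hF1) hF2
        · rfl
      · rintro (b' | a' | u') w w' hw (rfl | hww') hcond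
        · rfl
        · exact (hF _ _).mpr (hF3 _ _ _ (T.trans (T.symm hex₀) hw) hww')
        · rfl
        · refine (hF _ _).mpr ?_
          have key : ∀ v, T.rel e v → v ∈ E a' → ¬ (a' = a ∧ v = e) →
              (F v ↔ F (α.act (g a'.1) v)) := by
            intro v hv hvE hc
            refine hF4 a'.1 v hv hvE.1 ?_
            rintro ⟨h1, rfl⟩
            obtain ⟨a1, n1⟩ := a'
            obtain ⟨a2, n2⟩ := a
            subst h1
            exact hc ⟨by rw [hEuniq _ _ _ _ hvE he], rfl⟩
          have key2 : ∀ v v', rE a' v v' → (w = v ∨ w = v') → v ∈ E a' → ¬ (a' = a ∧ v = e) := by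
            rintro v v' hvv' hwv hv ⟨rfl, rfl⟩
            rcases hcond with hc | hc
            · exact hc rfl
            · apply hc
              have hx₀w : ∀ u, (u = v ∨ rE a' v u) → (Rf (Sum.inr (Sum.inl a'))).rel x₀ u := by
                intro u hu
                refine (Rf (Sum.inr (Sum.inl a'))).trans (y := v) ?_ ?_
                · rcases hcase with ⟨h1, h2⟩ | ⟨h1, h2⟩
                  · exact Or.inl h1.symm
                  · exact Or.inr (Or.inr ⟨hv, h2⟩)
                · exact hu.imp Eq.symm id
              rcases hwv with rfl | rfl
              · exact hx₀w _ (Or.inl rfl)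
              · exact hx₀w _ (Or.inr hvv')
          rcases hww' with ⟨h1, rfl⟩ | ⟨h1, rfl⟩
          · exact key w (T.trans (T.symm hex₀) hw) h1
              (key2 _ _ (Or.inl ⟨h1, rfl⟩) (Or.inl rfl) h1)
          · exact (key w' (T.trans (T.trans (T.symm hex₀) hw) (T.symm (hTr _ _ (hg _)))) h1
              (key2 _ _ (Or.inl ⟨h1, rfl⟩) (Or.inr rfl) h1)).symm
        · rfl
        · exact absurd (hTX₀ _ _ (T.trans (T.symm hex₀) hw) (hDX₀ _ he.1)) hww'.1
    · exact absurd h hx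
    · refine ⟨id, fun w w' _ _ h => h, ?_⟩
      have hw0 : ∀ w, T.rel x₀ w → w ∉ X₀ := fun w hw hw' => h.1 (hTX₀ _ _ (T.symm hw) hw')
      rintro (b' | a' | u') w w' hw (rfl | hww') hcond
      · rfl
      · exact absurd (hWsub _ _ _ hww').1 (hw0 _ hw)
      · rfl
      · rcases hww' with ⟨h1, rfl⟩ | ⟨h1, rfl⟩
        · exact absurd (hDX₀ _ h1.1) (hw0 _ hw)
        · exact absurd (hTX₀ _ _ (hTr _ _ (hg _)) (hDX₀ _ h1.1)) (hw0 _ hw)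
      · rfl
      · rcases hcond with hc | hc
        · exact absurd rfl hc
        · exact absurd (Or.inr ⟨h.1, hw⟩) hc
  have hprod : IsFreeProduct T Rf := by
    refine ⟨hindep, ?_, fun x y => ⟨fun h => ⟨by rw [hT.1]; trivial, ?_⟩, fun h => ?_⟩⟩
    · rw [hT.1]
      refine (Set.eq_univ_of_forall fun x => Set.mem_iUnion.mpr ⟨Sum.inr (Sum.inr ()), ?_⟩).symm
      exact Set.mem_univ x
    · by_cases hx : x ∈ X₀
      · refine (conn x hx y h).of_le ?_ (Relation.EqvGen.is_equivalence _)
        rintro u v (⟨b, hb⟩ | ⟨a, ha, hav⟩)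
        · exact .rel _ _ ⟨Sum.inl b, Or.inr hb⟩
        · obtain ⟨n, hn⟩ := hEex a u ha
          exact .rel _ _ ⟨Sum.inr (Sum.inl (a, n)), Or.inr (Or.inl ⟨hn, hav⟩)⟩
      · exact .rel _ _ ⟨Sum.inr (Sum.inr ()), Or.inr ⟨hx, h⟩⟩
    · exact h.2.of_le (fun u v ⟨i, hi⟩ => hsub i u v hi)
        ⟨hTrefl, fun h => T.symm h, fun h h' => T.trans h h'⟩
  obtain ⟨U, C, hUm, -, -, hCm, hC, hUex, hUinv, hUrel⟩ := hFI _ inferInstance Rf hprod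
  let C' : Set X := X₀ ∩ {x | ∀ γ : Γ, α.act γ x ∈ C}
  have hC'eq : {x | ∀ γ : Γ, α.act γ x ∈ C} = ⋂ γ : Γ, α.act γ ⁻¹' C := by ext; simp
  have hC'm : MeasurableSet C' := by
    refine hX₀.inter ?_
    rw [hC'eq]
    exact MeasurableSet.iInter fun γ => α.measurable_act _ hCm
  have hC'C : C' ⊆ C := fun x hx => by simpa [α.act_one] using hx.2 1
  have hC'inv : ∀ x ∈ C', ∀ γ ∈ Γ, α.act γ x ∈ C' := fun x hx γ hγ =>
    ⟨hX₀inv x hx.1 γ hγ, fun γ' => by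
      have := hx.2 (γ' * ⟨γ, hγ⟩)
      rwa [Subgroup.coe_mul, α.act_mul] at this⟩
  have hC'ae : ∀ᵐ x ∂μ, x ∈ C' := by
    have h1 : ∀ᵐ x ∂μ, x ∈ X₀ := hX₀c
    have h2 : ∀ᵐ x ∂μ, ∀ γ : Γ, α.act γ x ∈ C := by
      rw [ae_all_iff]
      intro γ
      exact α.null_preimage_act _ hC
    filter_upwards [h1, h2] with x h1 h2 using ⟨h1, h2⟩
  have hnull : ∀ i, μ (U (Sum.inr i) ∩ C') = 0 := by
    intro i
    refine α.null_of_orbit_le_two hfree Γ ((hUm _).inter hC'm) ?_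
    intro x hx g₁ hg₁ g₂ hg₂ h1 h2
    have r1 := (hUrel _ x ⟨hx.1, hC'C hx.2⟩ _ ⟨h1.1, hC'C h1.2⟩).mp (hTr _ _ hg₁)
    have r2 := (hUrel _ x ⟨hx.1, hC'C hx.2⟩ _ ⟨h2.1, hC'C h2.2⟩).mp (hTr _ _ hg₂)
    rcases i with a | u
    · rcases r1 with r1 | r1
      · exact Or.inl r1.symm
      rcases r2 with r2 | r2
      · exact Or.inr (Or.inl r2.symm)
      exact Or.inr (Or.inr (hrEtrans a _ _ _ (Or.symm r1) r2))
    · rcases r1 with r1 | r1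
      · exact Or.inl r1.symm
      · exact absurd hx.2.1 r1.1
  refine ⟨fun b => U (Sum.inl b) ∩ C', fun b => (hUm _).inter hC'm, fun b x hx => hx.2.1, ?_, ?_⟩
  · have hnull' : ∀ᵐ x ∂μ, ¬ ∃ γ, α.act γ x ∈ ⋃ i, (U (Sum.inr i) ∩ C') :=
      ae_iff.mpr (by simpa using α.null_translates (measure_iUnion_null hnull))
    filter_upwards [hC'ae, hnull'] with x hx hx'
    obtain ⟨y, hy, hxy⟩ := hUex x ⟨by rw [hT.1]; trivial, hC'C hx⟩
    obtain ⟨γ, hγ, rfl⟩ := (hT.2 _ _).mp hxy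
    obtain ⟨i, hi⟩ := Set.mem_iUnion.mp hy
    rcases i with b | i
    · exact ⟨b, γ, hγ, hi, hC'inv x hx γ hγ⟩
    · exact absurd ⟨γ, Set.mem_iUnion.mpr ⟨i, hi, hC'inv x hx γ hγ⟩⟩ hx'
  · intro b b' x γ hx hγ hx'
    have hbb := hUinv _ _ x ⟨hx.1, hC'C hx.2⟩ _ ⟨hx'.1, hC'C hx'.2⟩ (hTr _ _ hγ)
    obtain rfl : b = b' := Sum.inl.inj hbb
    exact ⟨rfl, ((hUrel _ x ⟨hx.1, hC'C hx.2⟩ _ ⟨hx'.1, hC'C hx'.2⟩).mp (hTr _ _ hγ)).imp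
      Eq.symm id⟩

attribute [fun_prop] PMPAction.measurable_act

@[fun_prop]
theorem Measurable.eq_prop {Z X : Type} [MeasurableSpace Z] [MeasurableSpace X]
    [StandardBorelSpace X] {f g : Z → X} (hf : Measurable f) (hg : Measurable g) :
    Measurable fun z => f z = g z :=
  measurableSet_setOfPred.mp (measurableSet_eq_fun hf hg)

theorem exists_minimal_of_encode {ι : Type} (enc : ι → ℕ) {p : ι → Prop} (h : ∃ i, p i) :
    ∃ i, p i ∧ ∀ j, enc j < enc i → ¬ p j := by
  obtain ⟨i, hi, hmin⟩ := WellFounded.has_min (InvImage.wf enc Nat.lt_wfRel.wf) {i | p i} h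
  exact ⟨i, hi, fun j hj hpj => hmin j hpj hj⟩

theorem eq_of_minimal_of_encode {ι : Type} {enc : ι → ℕ} (henc : Function.Injective enc)
    {p : ι → Prop} {i j : ι} (hi : p i) (hi' : ∀ k, enc k < enc i → ¬ p k) (hj : p j)
    (hj' : ∀ k, enc k < enc j → ¬ p k) : i = j := by
  rcases lt_trichotomy (enc i) (enc j) with h | h | h
  exacts [absurd hi (hj' _ h), henc h, absurd hj (hi' _ h)]

/-- A Borel correspondence between the orbits of two actions: `E x y` relates a point of `X` to a
point of `Y`, in such a way that it induces a bijection between orbits. -/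
structure OrbitCorr {G H X Y : Type} [Group G] [Group H] [MeasurableSpace X] [MeasurableSpace Y]
    {μ : Measure X} {ν : Measure Y} (α : PMPAction G X μ) (β : PMPAction H Y ν) where
  E : X → Y → Prop
  meas : Measurable (Function.uncurry E)
  smul_left : ∀ {x y}, E x y → ∀ g, E (α.act g x) y
  smul_right : ∀ {x y}, E x y → ∀ h, E x (β.act h y)
  exists_right : ∀ {x y y'}, E x y → E x y' → ∃ h, β.act h y = y'
  exists_left : ∀ {x x' y}, E x y → E x' y → ∃ g, α.act g x = x'
  free_left : ∀ {x y}, E x y → ∀ g, α.act g x = x → g = 1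
  free_right : ∀ {x y}, E x y → ∀ h, β.act h y = y → h = 1
  toRight : X → Y
  meas_toRight : Measurable toRight
  toRight_spec : ∀ {x y}, E x y → E x (toRight x)
  toLeft : Y → X
  meas_toLeft : Measurable toLeft
  toLeft_spec : ∀ {x y}, E x y → E (toLeft y) y

namespace OrbitCorr

variable {G H X Y : Type} [Group G] [Group H] [MeasurableSpace X] [MeasurableSpace Y]
    {μ : Measure X} {ν : Measure Y} {α : PMPAction G X μ} {β : PMPAction H Y ν}
    (L : OrbitCorr α β)

attribute [fun_prop] meas meas_toRight meas_toLeft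

theorem of_smul_left {x y g} (h : L.E (α.act g x) y) : L.E x y := by
  simpa only [α.act_inv_act] using L.smul_left h g⁻¹

/-- A Borel choice of one point in each nonempty intersection of a `Γ`-orbit with a fiber of `P`. -/
theorem exists_selection [Countable G] [StandardBorelSpace X] (Γ : Subgroup G) {P : X → Y → Prop}
    (hPm : Measurable (Function.uncurry P)) (hPE : ∀ x y, P x y → L.E x y) :
    ∃ S : X → Y → Prop, Measurable (Function.uncurry S) ∧ (∀ x y, S x y → P x y) ∧
      (∀ x y, P x y → ∃ γ ∈ Γ, S (α.act γ x) y) ∧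
      ∀ x y, ∀ γ ∈ Γ, S x y → S (α.act γ x) y → α.act γ x = x := by
  obtain ⟨enc, henc⟩ := exists_injective_nat G
  refine ⟨fun x y => P x y ∧ ∃ g, α.act g (L.toLeft y) = x ∧ ∀ g', enc g' < enc g → ∀ γ ∈ Γ,
    α.act g' (L.toLeft y) = α.act γ x → ¬ P (α.act g' (L.toLeft y)) y, ?_, ?_, ?_, ?_⟩
  · unfold Function.uncurry
    fun_prop
  · exact fun x y h => h.1
  · intro x y hxy
    have hE := hPE x y hxy
    obtain ⟨g₀, hg₀⟩ := L.exists_left (L.toLeft_spec hE) hE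
    obtain ⟨g, ⟨⟨γ, hγ, hgγ⟩, hP⟩, hmin⟩ := exists_minimal_of_encode enc
      (p := fun g => (∃ γ ∈ Γ, α.act g (L.toLeft y) = α.act γ x) ∧ P (α.act g (L.toLeft y)) y)
      ⟨g₀, ⟨1, one_mem _, by rw [hg₀, α.act_one]⟩, by rwa [hg₀]⟩
    rw [hgγ] at hP
    refine ⟨γ, hγ, hP, g, hgγ, fun g' hg' γ' hγ' he hP' => hmin g' hg' ⟨?_, hP'⟩⟩
    exact ⟨γ' * γ, mul_mem hγ' hγ, by rw [he, α.act_mul]⟩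
  · rintro x y γ hγ ⟨hP, g, hg, hmin⟩ ⟨hP', g', hg', hmin'⟩
    rcases lt_trichotomy (enc g) (enc g') with h | h | h
    · refine absurd ?_ (hmin' g h γ⁻¹ (inv_mem hγ) (by rw [hg, α.act_inv_act]))
      rwa [hg]
    · rw [← hg', ← henc h, hg]
    · refine absurd ?_ (hmin g' h γ hγ hg')
      rwa [hg']

/-- Borel choice, for each `y`, of a root in each `Γ`-orbit corresponding to `y`, compatible with
the retractions of the graph `Adj`. -/
theorem exists_roots [Countable G] [Countable H] [StandardBorelSpace X] [StandardBorelSpace Y]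
    (Γ : Subgroup G) (Adj : Y → Y → Prop) (hAm : Measurable (Function.uncurry Adj))
    (hAsymm : ∀ y y', Adj y y' → Adj y' y) (hAorb : ∀ y y', Adj y y' → ∃ h, β.act h y = y')
    (hAconn : ∀ y h, Relation.EqvGen Adj y (β.act h y)) :
    ∃ Rt : X → Y → Prop, Measurable (Function.uncurry Rt) ∧ (∀ x y, Rt x y → L.E x y) ∧
      (∀ x y, ∀ γ ∈ Γ, Rt x y → Rt (α.act γ x) y → α.act γ x = x) ∧
      (∀ x y, L.E x y → ∃ γ ∈ Γ, Rt (α.act γ x) y) ∧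
      ∀ (ρ : Y → Y) x y, Rt x y →
        (∀ y₁ y₂, L.E x y₁ → Adj y₁ y₂ → ρ y₁ = ρ y₂ ∨ (ρ y₁ = y₁ ∧ ρ y₂ = y₂)) →
        ∀ γ ∈ Γ, (Rt (α.act γ x) (ρ (L.toRight x)) ↔ Rt (α.act γ x) (ρ y)) := by
  classical
  obtain ⟨enc, henc⟩ := exists_injective_nat H
  obtain ⟨S, hSm, hSP, hSex, hSuniq⟩ := L.exists_selection Γ
    (P := fun x y => L.E x y ∧ L.toRight x = y) (by unfold Function.uncurry; fun_prop)
    (fun x y h => h.1)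
  let N : (X → Y → Prop) → H → X → Y → Prop := fun R h x y =>
    Adj y (β.act h y) ∧ ∃ γ ∈ Γ, R (α.act γ x) (β.act h y)
  let step : (X → Y → Prop) → X → Y → Prop := fun R x y => R x y ∨
    (L.E x y ∧ (∀ γ ∈ Γ, ¬ R (α.act γ x) y) ∧ ∃ h, Adj y (β.act h y) ∧ R x (β.act h y) ∧
      ∀ h', enc h' < enc h → ¬ N R h' x y)
  let Rn : ℕ → X → Y → Prop := fun n => n.rec S fun _ R => step R
  have hRn : ∀ n, Rn (n + 1) = step (Rn n) := fun n => rfl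
  have hRnm : ∀ n, Measurable (Function.uncurry (Rn n)) := by
    intro n
    induction n with
    | zero => exact hSm
    | succ n ih =>
      rw [hRn]
      simp only [step, N]
      unfold Function.uncurry
      fun_prop
  have hRnE : ∀ n x y, Rn n x y → L.E x y := by
    intro n
    induction n with
    | zero => exact fun x y h => (hSP x y h).1
    | succ n ih => exact fun x y h => h.elim (ih x y) fun h => h.1
  have hmono : ∀ n m, n ≤ m → ∀ x y, Rn n x y → Rn m x y := by
    intro n m hnm
    induction hnm with
    | refl => exact fun x y h => h
    | step _ ih => exact fun x y h => Or.inl (ih x y h)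
  have hNinv : ∀ n h x y, ∀ γ ∈ Γ, N (Rn n) h (α.act γ x) y ↔ N (Rn n) h x y := by
    rintro n h x y γ hγ
    refine and_congr_right fun _ => ⟨?_, ?_⟩
    · rintro ⟨γ', hγ', h'⟩
      exact ⟨γ' * γ, mul_mem hγ' hγ, by rwa [α.act_mul]⟩
    · rintro ⟨γ', hγ', h'⟩
      exact ⟨γ' * γ⁻¹, mul_mem hγ' (inv_mem hγ), by rwa [α.act_mul, α.act_inv_act]⟩
  have huniq : ∀ n x y, ∀ γ ∈ Γ, Rn n x y → Rn n (α.act γ x) y → α.act γ x = x := by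
    intro n
    induction n with
    | zero => exact fun x y γ hγ => hSuniq x y γ hγ
    | succ n ih =>
      rintro x y γ hγ (h | ⟨-, hno, h, hA, hR, hmin⟩) (h' | ⟨-, hno', h', hA', hR', hmin'⟩)
      · exact ih x y γ hγ h h'
      · exact absurd (by rwa [α.act_inv_act]) (hno' γ⁻¹ (inv_mem hγ))
      · exact absurd h' (hno γ hγ)
      · have : h = h' := eq_of_minimal_of_encode henc (p := fun h => N (Rn n) h x y)
          ⟨hA, 1, one_mem _, by rwa [α.act_one]⟩ hmin ⟨hA', γ, hγ, hR'⟩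
          fun k hk hN => hmin' k hk ((hNinv n k x y γ hγ).mpr hN)
        subst this
        exact ih x _ γ hγ hR hR'
  have hAE : ∀ x y y', L.E x y → Adj y y' → L.E x y' := by
    intro x y y' hE hA
    obtain ⟨h, rfl⟩ := hAorb _ _ hA
    exact L.smul_right hE h
  have hex_step : ∀ x y y', L.E x y → Adj y y' → (∃ n, ∃ γ ∈ Γ, Rn n (α.act γ x) y') →
      ∃ n, ∃ γ ∈ Γ, Rn n (α.act γ x) y := by
    rintro x y y' hE hA ⟨n, γ, hγ, hR⟩
    rcases Classical.em (∃ γ ∈ Γ, Rn n (α.act γ x) y) with hno | hno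
    · exact ⟨n, hno⟩
    obtain ⟨h₀, rfl⟩ := hAorb _ _ hA
    obtain ⟨h, ⟨hA', γ', hγ', hR'⟩, hmin⟩ := exists_minimal_of_encode enc
      (p := fun h => N (Rn n) h x y) ⟨h₀, hA, γ, hγ, hR⟩
    refine ⟨n + 1, γ', hγ', Or.inr ⟨L.smul_left hE _, fun γ'' hγ'' => ?_, h, hA', hR', ?_⟩⟩
    · rw [← α.act_mul]
      exact fun hR'' => hno ⟨_, mul_mem hγ'' hγ', hR''⟩
    · exact fun k hk hN => hmin k hk ((hNinv n k x y γ' hγ').mp hN)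
  have hex : ∀ x y, L.E x y → ∃ n, ∃ γ ∈ Γ, Rn n (α.act γ x) y := by
    intro x y hE
    have h0 : ∃ n, ∃ γ ∈ Γ, Rn n (α.act γ x) (L.toRight x) := by
      obtain ⟨γ, hγ, h⟩ := hSex x (L.toRight x) ⟨L.toRight_spec hE, rfl⟩
      exact ⟨0, γ, hγ, h⟩
    obtain ⟨h, hh⟩ := L.exists_right hE (L.toRight_spec hE)
    have key : ∀ y y', Relation.EqvGen Adj y y' → ((L.E x y ↔ L.E x y') ∧ (L.E x y →
        ((∃ n, ∃ γ ∈ Γ, Rn n (α.act γ x) y) ↔ (∃ n, ∃ γ ∈ Γ, Rn n (α.act γ x) y')))) := by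
      intro y y' hyy'
      induction hyy' with
      | rel u v huv =>
        refine ⟨⟨fun h => hAE _ _ _ h huv, fun h => hAE _ _ _ h (hAsymm _ _ huv)⟩,
          fun h => ⟨hex_step _ _ _ (hAE _ _ _ h huv) (hAsymm _ _ huv), hex_step _ _ _ h huv⟩⟩
      | refl u => exact ⟨Iff.rfl, fun _ => Iff.rfl⟩
      | symm u v _ ih => exact ⟨ih.1.symm, fun h => (ih.2 (ih.1.mpr h)).symm⟩
      | trans u v w _ _ ih ih' =>
        exact ⟨ih.1.trans ih'.1, fun h => (ih.2 h).trans (ih'.2 (ih.1.mp h))⟩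
    have := hAconn y h
    rw [hh] at this
    exact ((key _ _ this).2 hE).mpr h0
  have huniq' : ∀ x y, ∀ γ ∈ Γ, (∃ n, Rn n x y) → (∃ n, Rn n (α.act γ x) y) →
      α.act γ x = x := by
    rintro x y γ hγ ⟨n, hn⟩ ⟨m, hm⟩
    exact huniq (max n m) x y γ hγ (hmono n _ (le_max_left _ _) _ _ hn)
      (hmono m _ (le_max_right _ _) _ _ hm)
  refine ⟨fun x y => ∃ n, Rn n x y, ?_, fun x y ⟨n, h⟩ => hRnE n x y h, huniq', ?_, ?_⟩
  · unfold Function.uncurry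
    exact Measurable.exists fun n => hRnm n
  · intro x y hE
    obtain ⟨n, γ, hγ, h⟩ := hex x y hE
    exact ⟨γ, hγ, n, h⟩
  · rintro ρ x y ⟨n, hR⟩ hρ γ hγ
    induction n generalizing y with
    | zero => rw [(hSP x y hR).2]
    | succ n ih =>
      rcases hR with hR | ⟨hE, hno, h, hA, hR, hmin⟩
      · exact ih y hR
      · refine (ih _ hR).trans ?_
        rcases hρ _ _ hE hA with h1 | ⟨h1, h2⟩
        · rw [h1]
        · rw [h1, h2]
          have hxy : ∃ n, Rn n x y := ⟨n + 1, Or.inr ⟨hE, hno, h, hA, hR, hmin⟩⟩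
          constructor
          · intro h'
            rw [huniq' x _ γ hγ ⟨n, hR⟩ h']
            exact hxy
          · intro h'
            rw [huniq' x _ γ hγ hxy h']
            exact ⟨n, hR⟩

end OrbitCorr

attribute [fun_prop] PBI.meas_toFun PBI.meas_invFun

/-- Adjacency in the orbit graph associated with a family of subgroups and a graphing. -/
def CosetAdj {H Y Q : Type} [Group H] [MeasurableSpace Y] {ν : Measure Y} (β : PMPAction H Y ν)
    (Λ : Q → Subgroup H) (Φ : ℕ → PBI Y) (y y' : Y) : Prop :=
  (∃ q, ∃ l ∈ Λ q, β.act l y = y') ∨ (∃ i, y ∈ (Φ i).src ∧ (Φ i).toFun y = y') ∨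
    ∃ i, y' ∈ (Φ i).src ∧ (Φ i).toFun y' = y

section

variable {H Y Q : Type} [Group H] [MeasurableSpace Y] {ν : Measure Y} {β : PMPAction H Y ν}
    {Λ : Q → Subgroup H} {Λ₀ : Subgroup H} {Φ : ℕ → PBI Y} {R₀ : CBER Y}

theorem CosetAdj.measurable [Countable H] [Countable Q] [StandardBorelSpace Y] :
    Measurable (Function.uncurry (CosetAdj β Λ Φ)) := by
  have h : ∀ i, Measurable fun y => y ∈ (Φ i).src := fun i =>
    measurableSet_setOfPred.mp (Φ i).src_meas
  have h1 : ∀ i, Measurable fun p : Y × Y => p.1 ∈ (Φ i).src := fun i =>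
    (h i).comp measurable_fst
  have h2 : ∀ i, Measurable fun p : Y × Y => p.2 ∈ (Φ i).src := fun i =>
    (h i).comp measurable_snd
  unfold Function.uncurry CosetAdj
  fun_prop

theorem CosetAdj.symm {y y' : Y} (h : CosetAdj β Λ Φ y y') : CosetAdj β Λ Φ y' y := by
  rcases h with ⟨q, l, hl, rfl⟩ | h | h
  · exact Or.inl ⟨q, l⁻¹, inv_mem hl, β.act_inv_act _ _⟩
  · exact Or.inr (Or.inr h)
  · exact Or.inr (Or.inl h)

theorem GeneratesCBER.exists_mem (hR₀ : IsOrbitRel β Λ₀ R₀) (hΦ : GeneratesCBER Φ R₀) (i : ℕ) {y : Y}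
    (hy : y ∈ (Φ i).src) : ∃ l ∈ Λ₀, β.act l y = (Φ i).toFun y :=
  (hR₀.2 _ _).mp ((hΦ.2.1 i).2 y hy)

theorem CosetAdj.exists_act (hR₀ : IsOrbitRel β Λ₀ R₀) (hΦ : GeneratesCBER Φ R₀) {y y' : Y}
    (h : CosetAdj β Λ Φ y y') : ∃ h, β.act h y = y' := by
  rcases h with ⟨q, l, hl, rfl⟩ | ⟨i, hi, rfl⟩ | ⟨i, hi, rfl⟩
  · exact ⟨l, rfl⟩
  · obtain ⟨l, -, hl⟩ := hΦ.exists_mem hR₀ i hi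
    exact ⟨l, hl⟩
  · obtain ⟨l, -, hl⟩ := hΦ.exists_mem hR₀ i hi
    exact ⟨l⁻¹, by rw [← hl, β.act_inv_act]⟩

theorem CosetAdj.connected (hH : IsFreeProductOf H (fun j : Option Q => j.elim Λ₀ Λ))
    (hR₀ : IsOrbitRel β Λ₀ R₀) (hΦ : GeneratesCBER Φ R₀) (y : Y) (h : H) :
    Relation.EqvGen (CosetAdj β Λ Φ) y (β.act h y) := by
  induction h using hH.induction with
  | one => rw [β.act_one]; exact .refl _
  | mul j l hl h ih =>
    refine ih.trans _ _ _ ?_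
    rw [β.act_mul]
    rcases j with _ | q
    · refine (((hΦ.2.2 _ _).mp ((hR₀.2 _ _).mpr ⟨l, hl, rfl⟩)).2).mono ?_
      rintro u v ⟨i, hi⟩
      exact Or.inr (Or.inl ⟨i, hi⟩)
    · exact .rel _ _ (Or.inl ⟨q, l, hl, rfl⟩)

/-- Extension of a map defined on the group to the orbit of a free point. -/
theorem PMPAction.exists_orbit_map (β : PMPAction H Y ν) {y₀ : Y} (hy₀ : ∀ h, β.act h y₀ = y₀ → h = 1)
    (f : H → Y) : ∃ ρ : Y → Y, ∀ h, ρ (β.act h y₀) = f h := by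
  classical
  refine ⟨fun y => if hy : ∃ h, β.act h y₀ = y then f hy.choose else y, fun h => ?_⟩
  have hex : ∃ h', β.act h' y₀ = β.act h y₀ := ⟨h, rfl⟩
  dsimp only
  rw [dif_pos hex, β.eq_of_act_eq hy₀ hex.choose_spec]

/-- Retraction of the orbit of a free point onto a coset of `Λ q`. -/
theorem exists_coset_retraction (hH : IsFreeProductOf H (fun j : Option Q => j.elim Λ₀ Λ))
    (hR₀ : IsOrbitRel β Λ₀ R₀) (hΦ : GeneratesCBER Φ R₀) {y₀ : Y}
    (hy₀ : ∀ h, β.act h y₀ = y₀ → h = 1) (q : Q) :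
    ∃ ρ : Y → Y, (∀ l ∈ Λ q, ρ (β.act l y₀) = β.act l y₀) ∧
      (∀ h, ∃ l ∈ Λ q, ρ (β.act h y₀) = β.act l y₀) ∧
      (∀ q', ∀ l ∈ Λ q', ∀ h, (q' = q ∧ h ∈ Λ q) ∨
        ρ (β.act l (β.act h y₀)) = ρ (β.act h y₀)) ∧
      (∀ i h, β.act h y₀ ∈ (Φ i).src → ρ ((Φ i).toFun (β.act h y₀)) = ρ (β.act h y₀)) ∧
      ∀ h y', CosetAdj β Λ Φ (β.act h y₀) y' → ρ (β.act h y₀) = ρ y' ∨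
        (ρ (β.act h y₀) = β.act h y₀ ∧ ρ y' = y') := by
  obtain ⟨r, hr1, hr2, hr3, hr4⟩ := hH.exists_lastLetter (some q)
  obtain ⟨ρ, hρ⟩ := β.exists_orbit_map hy₀ fun h => β.act (r h) y₀
  have hfix : ∀ l ∈ Λ q, ρ (β.act l y₀) = β.act l y₀ := by
    intro l hl
    have := hr2 1 l hl
    rw [hr3, one_mul] at this
    rw [hρ, this]
  have hbig : ∀ q', ∀ l ∈ Λ q', ∀ h, (q' = q ∧ h ∈ Λ q) ∨
      ρ (β.act l (β.act h y₀)) = ρ (β.act h y₀) := by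
    intro q' l hl h
    rw [← β.act_mul, hρ, hρ]
    rcases hr4 (some q') l hl h with ⟨h1, h2⟩ | h1
    · exact Or.inl ⟨Option.some.inj h1, h2⟩
    · exact Or.inr (by rw [h1])
  have hsmall : ∀ i h, β.act h y₀ ∈ (Φ i).src →
      ρ ((Φ i).toFun (β.act h y₀)) = ρ (β.act h y₀) := by
    intro i h hi
    obtain ⟨l, hl, hl'⟩ := hΦ.exists_mem hR₀ i hi
    rw [← hl', ← β.act_mul, hρ, hρ]
    rcases hr4 none l hl h with ⟨h1, h2⟩ | h1
    · exact absurd h1 (by simp)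
    · rw [h1]
  refine ⟨ρ, hfix, fun h => ⟨r h, hr1 h, hρ h⟩, hbig, hsmall, ?_⟩
  rintro h y' (⟨q', l, hl, rfl⟩ | ⟨i, hi, rfl⟩ | ⟨i, hi, he⟩)
  · rcases hbig q' l hl h with ⟨rfl, h2⟩ | h1
    · refine Or.inr ⟨hfix h h2, ?_⟩
      rw [← β.act_mul]
      exact hfix _ (mul_mem hl h2)
    · exact Or.inl h1.symm
  · exact Or.inl (hsmall i h hi).symm
  · obtain ⟨l, hl, hl'⟩ := hΦ.exists_mem hR₀ i hi
    have : y' = β.act (l⁻¹ * h) y₀ := by rw [β.act_mul, ← he, ← hl', β.act_inv_act]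
    subst this
    rw [← he]
    exact Or.inl (hsmall i _ hi)

/-- Retraction of the orbit of a free point onto an edge of a treeing. -/
theorem exists_edge_retraction (hH : IsFreeProductOf H (fun j : Option Q => j.elim Λ₀ Λ))
    (hR₀ : IsOrbitRel β Λ₀ R₀) (hΦ : GeneratesCBER Φ R₀) (hΦt : IsTreeing Φ) {y₀ : Y}
    (hy₀ : ∀ h, β.act h y₀ = y₀ → h = 1) {i₀ : ℕ} (hi₀ : y₀ ∈ (Φ i₀).src) :
    ∃ ρ : Y → Y, ρ y₀ = y₀ ∧ ρ ((Φ i₀).toFun y₀) = (Φ i₀).toFun y₀ ∧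
      (∀ h, ρ (β.act h y₀) = y₀ ∨ ρ (β.act h y₀) = (Φ i₀).toFun y₀) ∧
      (∀ q', ∀ l ∈ Λ q', ∀ h, ρ (β.act l (β.act h y₀)) = ρ (β.act h y₀)) ∧
      (∀ i h, β.act h y₀ ∈ (Φ i).src → ¬ (i = i₀ ∧ β.act h y₀ = y₀) →
        ρ ((Φ i).toFun (β.act h y₀)) = ρ (β.act h y₀)) ∧
      ∀ h y', CosetAdj β Λ Φ (β.act h y₀) y' → ρ (β.act h y₀) = ρ y' ∨
        (ρ (β.act h y₀) = β.act h y₀ ∧ ρ y' = y') := by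
  classical
  obtain ⟨τ, hτ1, hτ2, hτ⟩ := hΦt.exists_cut i₀ y₀ hi₀
  obtain ⟨r, hr1, hr2, hr3, hr4⟩ := hH.exists_lastLetter none
  obtain ⟨ρ, hρ⟩ := β.exists_orbit_map hy₀ fun h =>
    if τ (β.act (r h) y₀) then y₀ else (Φ i₀).toFun y₀
  have hfix : ∀ l ∈ Λ₀, r l = l := by
    intro l hl
    have := hr2 1 l hl
    rwa [hr3, one_mul] at this
  have h0 : ρ y₀ = y₀ := by
    have := hρ 1
    rw [β.act_one, hr3, β.act_one, if_pos hτ1] at this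
    exact this
  have h1 : ρ ((Φ i₀).toFun y₀) = (Φ i₀).toFun y₀ := by
    obtain ⟨l, hl, hl'⟩ := hΦ.exists_mem hR₀ i₀ hi₀
    have := hρ l
    rwa [hfix l hl, hl', if_neg hτ2] at this
  have hbig : ∀ q', ∀ l ∈ Λ q', ∀ h, ρ (β.act l (β.act h y₀)) = ρ (β.act h y₀) := by
    intro q' l hl h
    rw [← β.act_mul, hρ, hρ]
    rcases hr4 (some q') l hl h with ⟨h1, h2⟩ | h1
    · exact absurd h1 (by simp)
    · rw [h1]
  have hsmall : ∀ i h, β.act h y₀ ∈ (Φ i).src → ¬ (i = i₀ ∧ β.act h y₀ = y₀) →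
      ρ ((Φ i).toFun (β.act h y₀)) = ρ (β.act h y₀) := by
    intro i h hi hne
    obtain ⟨l, hl, hl'⟩ := hΦ.exists_mem hR₀ i hi
    have hlh : β.act (l * h) y₀ = (Φ i).toFun (β.act h y₀) := by rw [β.act_mul, hl']
    rw [← hlh, hρ, hρ]
    rcases hr4 none l hl h with ⟨-, h2⟩ | h1
    · rw [hfix h h2, hfix _ (mul_mem hl h2), hlh]
      have := hτ i _ hi hne
      by_cases h3 : τ (β.act h y₀)
      · rw [if_pos h3, if_pos (this.mp h3)]
      · rw [if_neg h3, if_neg (this.not.mp h3)]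
    · rw [h1]
  refine ⟨ρ, h0, h1, fun h => ?_, hbig, hsmall, ?_⟩
  · rw [hρ]
    split_ifs
    exacts [Or.inl rfl, Or.inr rfl]
  have key : ∀ i h, β.act h y₀ ∈ (Φ i).src →
      ρ (β.act h y₀) = ρ ((Φ i).toFun (β.act h y₀)) ∨ (ρ (β.act h y₀) = β.act h y₀ ∧
      ρ ((Φ i).toFun (β.act h y₀)) = (Φ i).toFun (β.act h y₀)) := by
    intro i h hi
    by_cases hc : i = i₀ ∧ β.act h y₀ = y₀
    · obtain ⟨rfl, hc⟩ := hc
      rw [hc]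
      exact Or.inr ⟨h0, h1⟩
    · exact Or.inl (hsmall i h hi hc).symm
  rintro h y' (⟨q', l, hl, rfl⟩ | ⟨i, hi, rfl⟩ | ⟨i, hi, he⟩)
  · exact Or.inl (hbig q' l hl h).symm
  · exact key i h hi
  · obtain ⟨l, hl, hl'⟩ := hΦ.exists_mem hR₀ i hi
    have : y' = β.act (l⁻¹ * h) y₀ := by rw [β.act_mul, ← he, ← hl', β.act_inv_act]
    subst this
    rw [← he]
    exact (key i _ hi).imp Eq.symm And.symm

end

namespace OrbitCorr

variable {G H X Y Q : Type} [Group G] [Group H] [MeasurableSpace X] [MeasurableSpace Y]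
    {μ : Measure X} {ν : Measure Y} {α : PMPAction G X μ} {β : PMPAction H Y ν}
    (L : OrbitCorr α β)

/-- A choice of roots as in `exists_roots`. -/
structure IsRootSystem (T : CBER X) (Adj : Y → Y → Prop) (Rt : X → Y → Prop) : Prop where
  corr : ∀ {x y}, Rt x y → L.E x y
  uniq : ∀ {x x' y}, T.rel x x' → Rt x y → Rt x' y → x' = x
  exist : ∀ {x y}, L.E x y → ∃ x', T.rel x x' ∧ Rt x' y
  compat : ∀ {ρ : Y → Y} {x y}, Rt x y →
    (∀ y₁ y₂, L.E x y₁ → Adj y₁ y₂ → ρ y₁ = ρ y₂ ∨ (ρ y₁ = y₁ ∧ ρ y₂ = y₂)) →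
    ∀ x', T.rel x x' → (Rt x' (ρ (L.toRight x)) ↔ Rt x' (ρ y))

variable {L}

theorem E_of_rel {Γ : Subgroup G} {T : CBER X} (hT : IsOrbitRel α Γ T) {x x' y} (h : T.rel x x')
    (hE : L.E x y) : L.E x' y := by
  obtain ⟨γ, -, rfl⟩ := (hT.2 _ _).mp h
  exact L.smul_left hE γ

/-- A retraction of the graph induces a map on each class, through the choice of roots. -/
theorem IsRootSystem.exists_map {Γ : Subgroup G} {T : CBER X} (hT : IsOrbitRel α Γ T)
    {Adj : Y → Y → Prop} {Rt : X → Y → Prop} (hR : L.IsRootSystem T Adj Rt) {ρ : Y → Y} {x₀ : X}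
    (hρE : ∀ y, L.E x₀ y → L.E x₀ (ρ y))
    (hρ : ∀ y₁ y₂, L.E x₀ y₁ → Adj y₁ y₂ → ρ y₁ = ρ y₂ ∨ (ρ y₁ = y₁ ∧ ρ y₂ = y₂)) :
    ∃ P : X → X, (∀ w y w' y', T.rel x₀ w → Rt w y → T.rel x₀ w' → Rt w' y' → ρ y = ρ y' →
        P w = P w') ∧
      (∀ w y, T.rel x₀ w → Rt w y → ρ y = y → P w = w) ∧
      (∀ w y, T.rel x₀ w → Rt w y → Rt (P w) (ρ y)) ∧
      ∀ w w', T.rel x₀ w → T.rel w w' → Rt w' (L.toRight w) → P w' = P w := by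
  classical
  let rr : Y → X := fun y => if h : ∃ x', T.rel x₀ x' ∧ Rt x' y then h.choose else x₀
  have hrr : ∀ y, L.E x₀ y → T.rel x₀ (rr y) ∧ Rt (rr y) y := fun y hy => by
    have h := hR.exist hy
    simp only [rr, dif_pos h]
    exact h.choose_spec
  have hrr' : ∀ w y, T.rel x₀ w → Rt w y → rr y = w := fun w y hw hwy => by
    have := hrr y (E_of_rel hT (T.symm hw) (hR.corr hwy))
    exact hR.uniq (T.trans (T.symm hw) this.1) hwy this.2
  have hP : ∀ w y, T.rel x₀ w → Rt w y → rr (ρ (L.toRight w)) = rr (ρ y) := by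
    intro w y hw hwy
    have hEy : L.E x₀ y := E_of_rel hT (T.symm hw) (hR.corr hwy)
    have h1 := hrr _ (hρE y hEy)
    refine hrr' _ _ h1.1 ((hR.compat (ρ := ρ) hwy (fun y₁ y₂ h => ?_) _
      (T.trans (T.symm hw) h1.1)).mpr h1.2)
    exact hρ y₁ y₂ (E_of_rel hT (T.symm hw) h)
  refine ⟨fun w => rr (ρ (L.toRight w)), ?_, ?_, ?_, ?_⟩
  · intro w y w' y' hw hwy hw' hwy' h
    dsimp only
    rw [hP w y hw hwy, hP w' y' hw' hwy', h]
  · intro w y hw hwy h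
    dsimp only
    rw [hP w y hw hwy, h, hrr' w y hw hwy]
  · intro w y hw hwy
    dsimp only
    rw [hP w y hw hwy]
    exact (hrr _ (hρE y (E_of_rel hT (T.symm hw) (hR.corr hwy)))).2
  · exact fun w z hw hwz => hP z _ (T.trans hw hwz)

/-- `h` labels the point `x` relative to the `Λ q`-coset of `y`. -/
def Lab (L : OrbitCorr α β) (Λ : Q → Subgroup H) (Rt : X → Y → Prop) (q : Q) (h : H) (x : X)
    (y : Y) : Prop :=
  Rt x (β.act h (L.toRight x)) ∧ ∃ l ∈ Λ q, β.act l y = β.act h (L.toRight x)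

/-- No label smaller than `h` occurs in the class of `x` relative to the coset of `y`. -/
def MinLab (L : OrbitCorr α β) (Γ : Subgroup G) (Λ : Q → Subgroup H) (Rt : X → Y → Prop)
    (enc : H → ℕ) (q : Q) (h : H) (x : X) (y : Y) : Prop :=
  ∀ k, enc k < enc h → ∀ γ ∈ Γ, ¬ L.Lab Λ Rt q k (α.act γ x) y

/-- `x` carries the smallest label of its class relative to the coset of `y`. -/
def Core (L : OrbitCorr α β) (Γ : Subgroup G) (Λ : Q → Subgroup H) (Rt : X → Y → Prop)
    (enc : H → ℕ) (q : Q) (x : X) (y : Y) : Prop :=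
  ∃ h, L.Lab Λ Rt q h x y ∧ L.MinLab Γ Λ Rt enc q h x y

/-- Equivalence of two points carrying the same smallest label relative to the same coset. -/
def CoreRel (L : OrbitCorr α β) (Γ : Subgroup G) (Λ : Q → Subgroup H) (Rt : X → Y → Prop)
    (enc : H → ℕ) (b : Q × H) (x z : X) : Prop :=
  (∃ γ ∈ Γ, α.act γ x = z) ∧ Rt x (β.act b.2 (L.toRight x)) ∧
    Rt z (β.act b.2 (L.toRight z)) ∧
    (∃ l ∈ Λ b.1, β.act l (β.act b.2 (L.toRight x)) = β.act b.2 (L.toRight z)) ∧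
    L.MinLab Γ Λ Rt enc b.1 b.2 x (β.act b.2 (L.toRight x)) ∧
    L.MinLab Γ Λ Rt enc b.1 b.2 z (β.act b.2 (L.toRight z))

/-- Sources of the edges joining the non-core points of a coset to its core. -/
def spoke (L : OrbitCorr α β) (Γ : Subgroup G) (Λ : Q → Subgroup H) (Rt : X → Y → Prop)
    (enc : H → ℕ) (encG : G → ℕ) (a : Q × H × Γ) : Set X :=
  {x | Rt x (β.act a.2.1 (L.toRight x)) ∧
    (∀ h', enc h' < enc a.2.1 → ¬ L.Lab Λ Rt a.1 h' x (β.act a.2.1 (L.toRight x))) ∧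
    ¬ L.Core Γ Λ Rt enc a.1 x (β.act a.2.1 (L.toRight x)) ∧
    L.Core Γ Λ Rt enc a.1 (α.act a.2.2 x) (β.act a.2.1 (L.toRight x)) ∧
    ∀ γ' ∈ Γ, encG γ' < encG a.2.2 →
      ¬ L.Core Γ Λ Rt enc a.1 (α.act γ' x) (β.act a.2.1 (L.toRight x))}

/-- Sources of the edges coming from the graphing `Φ`. -/
def treeEdge (L : OrbitCorr α β) (Γ : Subgroup G) (Φ : ℕ → PBI Y) (Rt : X → Y → Prop)
    (a : ℕ × H × Γ) : Set X :=
  {x | Rt x (β.act a.2.1 (L.toRight x)) ∧ β.act a.2.1 (L.toRight x) ∈ (Φ a.1).src ∧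
    Rt (α.act a.2.2 x) ((Φ a.1).toFun (β.act a.2.1 (L.toRight x))) ∧ α.act a.2.2 x ≠ x}

/-- Sources of the edges joining a point to the root of its image. -/
def hair (L : OrbitCorr α β) (Γ : Subgroup G) (Rt : X → Y → Prop) (γ : Γ) : Set X :=
  {x | Rt (α.act γ x) (L.toRight x) ∧ α.act γ x ≠ x}

section Measurability

variable [Countable H] [StandardBorelSpace Y] {Γ : Subgroup G} {Λ : Q → Subgroup H}
  {Rt : X → Y → Prop} {enc : H → ℕ}

theorem measurable_Lab (hRt : Measurable (Function.uncurry Rt)) (q : Q) (h : H) :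
    Measurable (Function.uncurry (L.Lab Λ Rt q h)) := by
  unfold Lab Function.uncurry
  fun_prop

variable [Countable G]

theorem measurable_MinLab (hRt : Measurable (Function.uncurry Rt)) (q : Q) (h : H) :
    Measurable (Function.uncurry (L.MinLab Γ Λ Rt enc q h)) := by
  have := measurable_Lab (L := L) (Λ := Λ) hRt q
  unfold MinLab
  unfold Function.uncurry
  fun_prop

theorem measurable_Core (hRt : Measurable (Function.uncurry Rt)) (q : Q) :
    Measurable (Function.uncurry (L.Core Γ Λ Rt enc q)) := by
  have := measurable_Lab (L := L) (Λ := Λ) hRt q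
  have := measurable_MinLab (L := L) (Γ := Γ) (Λ := Λ) (enc := enc) hRt q
  unfold Core
  unfold Function.uncurry
  fun_prop

theorem measurable_CoreRel [StandardBorelSpace X] (hRt : Measurable (Function.uncurry Rt))
    (b : Q × H) : Measurable (Function.uncurry (L.CoreRel Γ Λ Rt enc b)) := by
  have := measurable_MinLab (L := L) (Γ := Γ) (Λ := Λ) (enc := enc) hRt b.1 b.2
  unfold CoreRel
  unfold Function.uncurry
  fun_prop

theorem measurableSet_spoke (hRt : Measurable (Function.uncurry Rt)) (encG : G → ℕ)
    (a : Q × H × Γ) : MeasurableSet (L.spoke Γ Λ Rt enc encG a) := by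
  have := measurable_Lab (L := L) (Λ := Λ) hRt a.1
  have := measurable_Core (L := L) (Γ := Γ) (Λ := Λ) (enc := enc) hRt a.1
  refine measurableSet_setOfPred.mpr ?_
  fun_prop

end Measurability

section Algebra

variable {Γ : Subgroup G} {Λ : Q → Subgroup H} {Rt : X → Y → Prop} {enc : H → ℕ}

theorem measurableSet_treeEdge [StandardBorelSpace X] (hRt : Measurable (Function.uncurry Rt))
    (Φ : ℕ → PBI Y) (a : ℕ × H × Γ) : MeasurableSet (L.treeEdge Γ Φ Rt a) := by
  have : Measurable fun x => β.act a.2.1 (L.toRight x) ∈ (Φ a.1).src :=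
    (measurableSet_setOfPred.mp (Φ a.1).src_meas).comp
      ((β.measurable_act _).comp L.meas_toRight)
  refine measurableSet_setOfPred.mpr ?_
  fun_prop

theorem measurableSet_hair [StandardBorelSpace X] (hRt : Measurable (Function.uncurry Rt))
    (γ : Γ) : MeasurableSet (L.hair Γ Rt γ) := by
  refine measurableSet_setOfPred.mpr ?_
  fun_prop

theorem Lab.of_coset {q : Q} {h : H} {x : X} {y : Y} {l : H} (hl : l ∈ Λ q)
    (hLab : L.Lab Λ Rt q h x (β.act l y)) : L.Lab Λ Rt q h x y := by
  obtain ⟨h1, l', hl', h2⟩ := hLab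
  exact ⟨h1, l' * l, mul_mem hl' hl, by rw [β.act_mul, h2]⟩

theorem lab_coset {q : Q} {h : H} {x : X} {y : Y} {l : H} (hl : l ∈ Λ q) :
    L.Lab Λ Rt q h x (β.act l y) ↔ L.Lab Λ Rt q h x y :=
  ⟨fun h' => h'.of_coset hl, fun h' => Lab.of_coset (inv_mem hl) (by rwa [β.act_inv_act])⟩

theorem minLab_coset {q : Q} {h : H} {x : X} {y : Y} {l : H} (hl : l ∈ Λ q) :
    L.MinLab Γ Λ Rt enc q h x (β.act l y) ↔ L.MinLab Γ Λ Rt enc q h x y := by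
  simp only [MinLab, lab_coset hl]

theorem core_coset {q : Q} {x : X} {y : Y} {l : H} (hl : l ∈ Λ q) :
    L.Core Γ Λ Rt enc q x (β.act l y) ↔ L.Core Γ Λ Rt enc q x y := by
  simp only [Core, lab_coset hl, minLab_coset hl]

theorem MinLab.act {q : Q} {h : H} {x : X} {y : Y} {γ : G} (hγ : γ ∈ Γ)
    (hm : L.MinLab Γ Λ Rt enc q h x y) : L.MinLab Γ Λ Rt enc q h (α.act γ x) y := by
  intro h' hh' γ' hγ'
  rw [← α.act_mul]
  exact hm h' hh' _ (mul_mem hγ' hγ)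

theorem MinLab.rel {T : CBER X} (hT : IsOrbitRel α Γ T) {q : Q} {h : H} {x x' : X} {y : Y}
    (hm : L.MinLab Γ Λ Rt enc q h x y) (hx : T.rel x x') : L.MinLab Γ Λ Rt enc q h x' y := by
  obtain ⟨γ, hγ, rfl⟩ := (hT.2 _ _).mp hx
  exact hm.act hγ

theorem MinLab.not_lt {T : CBER X} (hT : IsOrbitRel α Γ T) {q : Q} {h h' : H} {x x' : X} {y : Y}
    (hm : L.MinLab Γ Λ Rt enc q h x y) (hx : T.rel x x') (hL : L.Lab Λ Rt q h' x' y) :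
    ¬ enc h' < enc h := by
  obtain ⟨γ, hγ, rfl⟩ := (hT.2 _ _).mp hx
  exact fun hlt => hm h' hlt γ hγ hL

theorem CoreRel.symm {b : Q × H} {x x' : X} (h : L.CoreRel Γ Λ Rt enc b x x') :
    L.CoreRel Γ Λ Rt enc b x' x := by
  obtain ⟨⟨γ, hγ, rfl⟩, h1, h2, ⟨l, hl, h3⟩, h4, h5⟩ := h
  exact ⟨⟨γ⁻¹, inv_mem hγ, α.act_inv_act _ _⟩, h2, h1,
    ⟨l⁻¹, inv_mem hl, by rw [← h3, β.act_inv_act]⟩, h5, h4⟩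

theorem CoreRel.trans {b : Q × H} {x x' x'' : X} (h : L.CoreRel Γ Λ Rt enc b x x')
    (h' : L.CoreRel Γ Λ Rt enc b x' x'') : L.CoreRel Γ Λ Rt enc b x x'' := by
  obtain ⟨⟨γ, hγ, rfl⟩, h1, h2, ⟨l, hl, h3⟩, h4, h5⟩ := h
  obtain ⟨⟨γ', hγ', rfl⟩, -, h2', ⟨l', hl', h3'⟩, -, h5'⟩ := h'
  exact ⟨⟨γ' * γ, mul_mem hγ' hγ, α.act_mul _ _ _⟩, h1, h2',
    ⟨l' * l, mul_mem hl' hl, by rw [β.act_mul, h3, h3']⟩, h4, h5'⟩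

theorem CoreRel.core {b : Q × H} {x x' : X} (h : L.CoreRel Γ Λ Rt enc b x x') :
    L.Core Γ Λ Rt enc b.1 x (β.act b.2 (L.toRight x)) :=
  ⟨b.2, ⟨h.2.1, 1, one_mem _, β.act_one _⟩, h.2.2.2.2.1⟩

/-- Two core points of the same class relative to the same coset are related. -/
theorem Core.exists_coreRel {T : CBER X} (hT : IsOrbitRel α Γ T) (henc : Function.Injective enc)
    {q : Q} {x x' : X} {y : Y} (hx : L.Core Γ Λ Rt enc q x y) (hx' : L.Core Γ Λ Rt enc q x' y)
    (hxx' : T.rel x x') : ∃ h, L.CoreRel Γ Λ Rt enc (q, h) x x' := by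
  obtain ⟨h, ⟨h1, l, hl, h2⟩, h3⟩ := hx
  obtain ⟨h', ⟨h1', l', hl', h2'⟩, h3'⟩ := hx'
  have : h = h' := by
    rcases lt_trichotomy (enc h) (enc h') with hlt | he | hlt
    · exact absurd hlt (h3'.not_lt hT (T.symm hxx') ⟨h1, l, hl, h2⟩)
    · exact henc he
    · exact absurd hlt (h3.not_lt hT hxx' ⟨h1', l', hl', h2'⟩)
  subst this
  refine ⟨h, (hT.2 _ _).mp hxx', h1, h1', ⟨l' * l⁻¹, mul_mem hl' (inv_mem hl), ?_⟩, ?_, ?_⟩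
  · rw [← h2, β.act_mul, β.act_inv_act, h2']
  · rw [← h2]
    exact (minLab_coset hl).mpr h3
  · rw [← h2']
    exact (minLab_coset hl').mpr h3'

end Algebra

end OrbitCorr

namespace OrbitCorr

variable {G H X Y Q : Type} [Group G] [Group H] [MeasurableSpace X] [MeasurableSpace Y]
    {μ : Measure X} {ν : Measure Y} {α : PMPAction G X μ} {β : PMPAction H Y ν}
    {L : OrbitCorr α β} {Γ : Subgroup G} {Λ : Q → Subgroup H} {Λ₀ : Subgroup H} {Φ : ℕ → PBI Y}
    {R₀ : CBER Y} {T : CBER X} {Rt : X → Y → Prop} {enc : H → ℕ} {encG : G → ℕ}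

/-- The retraction onto a coset, transported to a class of `X`. -/
theorem IsRootSystem.exists_coset_map (hH : IsFreeProductOf H (fun j : Option Q => j.elim Λ₀ Λ))
    (hR₀ : IsOrbitRel β Λ₀ R₀) (hΦ : GeneratesCBER Φ R₀) (hT : IsOrbitRel α Γ T)
    (hR : L.IsRootSystem T (CosetAdj β Λ Φ) Rt) {x₀ : X} {y₀ : Y} (h₀ : L.E x₀ y₀) (q : Q) :
    ∃ P : X → X,
      (∀ w y, T.rel x₀ w → Rt w y → (∃ l ∈ Λ q, β.act l y₀ = y) → P w = w) ∧
      (∀ q' w y w' y', T.rel x₀ w → Rt w y → T.rel x₀ w' → Rt w' y' →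
        (∃ l ∈ Λ q', β.act l y = y') → (q' = q ∧ ∃ l ∈ Λ q, β.act l y₀ = y) ∨ P w = P w') ∧
      (∀ i w y w', T.rel x₀ w → Rt w y → T.rel x₀ w' → y ∈ (Φ i).src →
        Rt w' ((Φ i).toFun y) → P w = P w') ∧
      ∀ w w', T.rel x₀ w → T.rel w w' → Rt w' (L.toRight w) → P w' = P w := by
  obtain ⟨ρ, hfix, him, hbig, hsmall, hstep⟩ :=
    exists_coset_retraction hH hR₀ hΦ (L.free_right h₀) q
  obtain ⟨P, hP1, hP2, -, hP4⟩ := hR.exists_map hT (x₀ := x₀) (ρ := ρ)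
    (fun y hy => by
      obtain ⟨h, rfl⟩ := L.exists_right h₀ hy
      obtain ⟨l, -, hl⟩ := him h
      rw [hl]
      exact L.smul_right h₀ l)
    (fun y₁ y₂ hy₁ hA => by
      obtain ⟨h, rfl⟩ := L.exists_right h₀ hy₁
      exact hstep h y₂ hA)
  have hE : ∀ w y, T.rel x₀ w → Rt w y → ∃ h, β.act h y₀ = y := fun w y hw hwy =>
    L.exists_right h₀ (E_of_rel hT (T.symm hw) (hR.corr hwy))
  refine ⟨P, ?_, ?_, ?_, hP4⟩
  · rintro w y hw hwy ⟨l, hl, rfl⟩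
    exact hP2 w _ hw hwy (hfix l hl)
  · rintro q' w y w' y' hw hwy hw' hwy' ⟨l, hl, rfl⟩
    obtain ⟨h, rfl⟩ := hE w y hw hwy
    rcases hbig q' l hl h with ⟨h1, h2⟩ | h1
    · exact Or.inl ⟨h1, h, h2, rfl⟩
    · exact Or.inr (hP1 _ _ _ _ hw hwy hw' hwy' h1.symm)
  · intro i w y w' hw hwy hw' hi hwy'
    obtain ⟨h, rfl⟩ := hE w y hw hwy
    exact hP1 _ _ _ _ hw hwy hw' hwy' (hsmall i h hi).symm

/-- The retraction onto an edge of the treeing, transported to a class of `X`. -/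
theorem IsRootSystem.exists_edge_map (hH : IsFreeProductOf H (fun j : Option Q => j.elim Λ₀ Λ))
    (hR₀ : IsOrbitRel β Λ₀ R₀) (hΦ : GeneratesCBER Φ R₀) (hΦt : IsTreeing Φ)
    (hT : IsOrbitRel α Γ T) (hR : L.IsRootSystem T (CosetAdj β Λ Φ) Rt) {x₀ x₁ : X} {y₀ : Y}
    {i₀ : ℕ} (h₀ : Rt x₀ y₀) (hi₀ : y₀ ∈ (Φ i₀).src) (h₁ : Rt x₁ ((Φ i₀).toFun y₀))
    (h₀₁ : T.rel x₀ x₁) :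
    ∃ P : X → X, P x₀ = x₀ ∧ P x₁ = x₁ ∧
      (∀ q' w y w' y', T.rel x₀ w → Rt w y → T.rel x₀ w' → Rt w' y' →
        (∃ l ∈ Λ q', β.act l y = y') → P w = P w') ∧
      (∀ i w y w', T.rel x₀ w → Rt w y → T.rel x₀ w' → y ∈ (Φ i).src →
        Rt w' ((Φ i).toFun y) → ¬ (i = i₀ ∧ y = y₀) → P w = P w') ∧
      ∀ w w', T.rel x₀ w → T.rel w w' → Rt w' (L.toRight w) → P w' = P w := by
  have hE₀ := hR.corr h₀
  have hE₁ : L.E x₀ ((Φ i₀).toFun y₀) := E_of_rel hT (T.symm h₀₁) (hR.corr h₁)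
  obtain ⟨ρ, hfix, hfix', him, hbig, hsmall, hstep⟩ :=
    exists_edge_retraction hH hR₀ hΦ hΦt (L.free_right hE₀) hi₀
  obtain ⟨P, hP1, hP2, -, hP4⟩ := hR.exists_map hT (x₀ := x₀) (ρ := ρ)
    (fun y hy => by
      obtain ⟨h, rfl⟩ := L.exists_right hE₀ hy
      rcases him h with hl | hl <;> rwa [hl])
    (fun y₁ y₂ hy₁ hA => by
      obtain ⟨h, rfl⟩ := L.exists_right hE₀ hy₁
      exact hstep h y₂ hA)
  have hE : ∀ w y, T.rel x₀ w → Rt w y → ∃ h, β.act h y₀ = y := fun w y hw hwy =>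
    L.exists_right hE₀ (E_of_rel hT (T.symm hw) (hR.corr hwy))
  refine ⟨P, hP2 _ _ (T.trans h₀₁ (T.symm h₀₁)) h₀ hfix, hP2 _ _ h₀₁ h₁ hfix', ?_, ?_, hP4⟩
  · rintro q' w y w' y' hw hwy hw' hwy' ⟨l, hl, rfl⟩
    obtain ⟨h, rfl⟩ := hE w y hw hwy
    exact hP1 _ _ _ _ hw hwy hw' hwy' (hbig q' l hl h).symm
  · intro i w y w' hw hwy hw' hi hwy' hne
    obtain ⟨h, rfl⟩ := hE w y hw hwy
    exact hP1 _ _ _ _ hw hwy hw' hwy' (hsmall i h hi hne).symm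

/-- The edges of the three kinds. -/
def edgeSet (L : OrbitCorr α β) (Γ : Subgroup G) (Λ : Q → Subgroup H) (Φ : ℕ → PBI Y)
    (Rt : X → Y → Prop) (enc : H → ℕ) (encG : G → ℕ) :
    (Q × H × Γ) ⊕ (ℕ × H × Γ) ⊕ Γ → Set X :=
  Sum.elim (L.spoke Γ Λ Rt enc encG) (Sum.elim (L.treeEdge Γ Φ Rt) (L.hair Γ Rt))

/-- The group element moving along an edge. -/
def edgeElt (Γ : Subgroup G) : (Q × H × Γ) ⊕ (ℕ × H × Γ) ⊕ Γ → Γ :=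
  Sum.elim (fun a => a.2.2) (Sum.elim (fun a => a.2.2) id)

/-- Every point of the coset is joined to the core. -/
theorem exists_core_eqvGen (hT : IsOrbitRel α Γ T)
    (hR : L.IsRootSystem T (CosetAdj β Λ Φ) Rt) {q : Q} {w : X} {y : Y} (hw : Rt w y) :
    ∃ c, T.rel w c ∧ L.Core Γ Λ Rt enc q c y ∧
      (c = w ∨ ∃ a, w ∈ L.edgeSet Γ Λ Φ Rt enc encG a ∧ α.act (edgeElt (Q := Q) Γ a) w = c) := by
  by_cases hc : L.Core Γ Λ Rt enc q w y
  · exact ⟨w, (hT.2 _ _).mpr ⟨1, one_mem _, α.act_one _⟩, hc, Or.inl rfl⟩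
  have hE := hR.corr hw
  obtain ⟨h₀, hh₀⟩ := L.exists_right (L.toRight_spec hE) hE
  have hLab₀ : L.Lab Λ Rt q h₀ w y :=
    ⟨by rwa [hh₀], 1, one_mem _, by rw [β.act_one, hh₀]⟩
  obtain ⟨h, ⟨hRt, l, hl, hly⟩, hmin⟩ := exists_minimal_of_encode enc
    (p := fun h => L.Lab Λ Rt q h w y) ⟨h₀, hLab₀⟩
  obtain ⟨k, ⟨γ₀, hγ₀, hk⟩, hkmin⟩ := exists_minimal_of_encode enc
    (p := fun h => ∃ γ ∈ Γ, L.Lab Λ Rt q h (α.act γ w) y)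
    ⟨h₀, 1, one_mem _, by rwa [α.act_one]⟩
  have hcore : L.Core Γ Λ Rt enc q (α.act γ₀ w) y := by
    refine ⟨k, hk, fun h' hh' γ hγ hL => hkmin h' hh' ⟨γ * γ₀, mul_mem hγ hγ₀, ?_⟩⟩
    rwa [α.act_mul]
  obtain ⟨γ, ⟨hγ, hγc⟩, hγmin⟩ := exists_minimal_of_encode encG
    (p := fun γ => γ ∈ Γ ∧ L.Core Γ Λ Rt enc q (α.act γ w) y) ⟨γ₀, hγ₀, hcore⟩
  refine ⟨α.act γ w, (hT.2 _ _).mpr ⟨γ, hγ, rfl⟩, hγc,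
    Or.inr ⟨Sum.inl (q, h, ⟨γ, hγ⟩), ⟨hRt, ?_, ?_, ?_, ?_⟩, rfl⟩⟩
  · intro h' hh' hL
    rw [← hly, lab_coset hl] at hL
    exact hmin h' hh' hL
  · rwa [← hly, core_coset hl]
  · rwa [← hly, core_coset hl]
  · intro γ' hγ' hlt hc'
    rw [← hly, core_coset hl] at hc'
    exact hγmin γ' hlt ⟨hγ', hc'⟩

theorem IsRootSystem.eqvGen (hH : IsFreeProductOf H (fun j : Option Q => j.elim Λ₀ Λ))
    (hR₀ : IsOrbitRel β Λ₀ R₀) (hΦ : GeneratesCBER Φ R₀) (hT : IsOrbitRel α Γ T)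
    (hR : L.IsRootSystem T (CosetAdj β Λ Φ) Rt) (henc : Function.Injective enc) {x z : X}
    (hx : L.E x (L.toRight x)) (hxz : T.rel x z) :
    Relation.EqvGen (fun u v => (∃ b, L.CoreRel Γ Λ Rt enc b u v) ∨
      ∃ a, u ∈ L.edgeSet Γ Λ Φ Rt enc encG a ∧ α.act (edgeElt (Q := Q) Γ a) u = v) x z := by
  set s := Relation.EqvGen (fun u v => (∃ b, L.CoreRel Γ Λ Rt enc b u v) ∨
      ∃ a, u ∈ L.edgeSet Γ Λ Φ Rt enc encG a ∧ α.act (edgeElt (Q := Q) Γ a) u = v) with hs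
  have htrans : ∀ {u v w}, s u v → s v w → s u w := fun h h' => .trans _ _ _ h h'
  have hsymm : ∀ {u v}, s u v → s v u := fun h => .symm _ _ h
  have hadj : ∀ y y' w w', CosetAdj β Λ Φ y y' → Rt w y → Rt w' y' → T.rel w w' → s w w' := by
    have hsm : ∀ i y w w', y ∈ (Φ i).src → Rt w y → Rt w' ((Φ i).toFun y) → T.rel w w' →
        s w w' := by
      intro i y w w' hi hw hw' hww'
      by_cases he : w' = w
      · rw [he]; exact .refl _
      obtain ⟨γ, hγ, rfl⟩ := (hT.2 _ _).mp hww'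
      have hE := hR.corr hw
      obtain ⟨h, hh⟩ := L.exists_right (L.toRight_spec hE) hE
      subst hh
      exact .rel _ _ (Or.inr ⟨Sum.inr (Sum.inl (i, h, ⟨γ, hγ⟩)), ⟨hw, hi, hw', he⟩, rfl⟩)
    rintro y y' w w' (⟨q, l, hl, rfl⟩ | ⟨i, hi, rfl⟩ | ⟨i, hi, rfl⟩) hw hw' hww'
    · have hcs : ∀ w y, Rt w y → ∃ c, T.rel w c ∧ L.Core Γ Λ Rt enc q c y ∧ s w c := by
        intro w y hw
        obtain ⟨c, h1, h2, h3⟩ := exists_core_eqvGen (enc := enc) (encG := encG) hT hR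
          (q := q) hw
        refine ⟨c, h1, h2, ?_⟩
        rcases h3 with rfl | h3
        · exact .refl _
        · exact .rel _ _ (Or.inr h3)
      obtain ⟨c, h1, h2, h3⟩ := hcs w _ hw
      obtain ⟨c', h1', h2', h3'⟩ := hcs w' _ hw'
      rw [core_coset hl] at h2'
      obtain ⟨h, hh⟩ := h2.exists_coreRel hT henc h2' (T.trans (T.symm h1) (T.trans hww' h1'))
      exact htrans h3 (htrans (.rel _ _ (Or.inl ⟨_, hh⟩)) (hsymm h3'))
    · exact hsm i _ _ _ hi hw hw' hww'
    · exact hsymm (hsm i _ _ _ hi hw' hw (T.symm hww'))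
  have hwalk : ∀ y y', Relation.EqvGen (CosetAdj β Λ Φ) y y' → ∀ w w', T.rel x w → T.rel x w' →
      Rt w y → Rt w' y' → s w w' := by
    intro y y' hyy'
    induction hyy' with
    | rel u v huv =>
      exact fun w w' hw hw' h h' => hadj _ _ _ _ huv h h' (T.trans (T.symm hw) hw')
    | refl u =>
      intro w w' hw hw' h h'
      rw [hR.uniq (T.trans (T.symm hw) hw') h h']
      exact .refl _
    | symm u v _ ih => exact fun w w' hw hw' h h' => hsymm (ih _ _ hw' hw h' h)
    | trans u v t huv _ ih ih' =>
      intro w w' hw hw' h h'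
      have hEv : L.E x v := by
        have hEu := E_of_rel hT (T.symm hw) (hR.corr h)
        have : (L.E x u ↔ L.E x v) := huv.of_le (s := fun u v => (L.E x u ↔ L.E x v))
          (fun a b hab => by
            obtain ⟨k, rfl⟩ := hab.exists_act hR₀ hΦ
            refine ⟨fun h => L.smul_right h k, fun h => ?_⟩
            simpa only [β.act_inv_act] using L.smul_right h k⁻¹)
          ⟨fun _ => Iff.rfl, Iff.symm, Iff.trans⟩
        exact this.mp hEu
      obtain ⟨m, hm, hmv⟩ := hR.exist hEv
      exact htrans (ih w m hw hm h hmv) (ih' m w' hm hw' hmv h')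
  have hhair : ∀ w w', T.rel w w' → Rt w' (L.toRight w) → s w w' := by
    intro w w' hww' h
    by_cases he : w' = w
    · rw [he]; exact .refl _
    obtain ⟨γ, hγ, rfl⟩ := (hT.2 _ _).mp hww'
    exact .rel _ _ (Or.inr ⟨Sum.inr (Sum.inr ⟨γ, hγ⟩), ⟨h, he⟩, rfl⟩)
  have hz : L.E z (L.toRight z) := L.toRight_spec (E_of_rel hT hxz hx)
  obtain ⟨a, ha, ha'⟩ := hR.exist hx
  obtain ⟨b, hb, hb'⟩ := hR.exist hz
  obtain ⟨h, hh⟩ := L.exists_right hx (E_of_rel hT (T.symm hxz) hz)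
  refine htrans (hhair _ _ ha ha') (htrans ?_ (hsymm (hhair _ _ hb hb')))
  refine hwalk _ _ ?_ a b ha (T.trans hxz hb) ha' hb'
  rw [← hh]
  exact CosetAdj.connected hH hR₀ hΦ _ h

end OrbitCorr

namespace OrbitCorr

variable {G H X Y Q : Type} [Group G] [Group H] [MeasurableSpace X] [MeasurableSpace Y]
    {μ : Measure X} {ν : Measure Y} {α : PMPAction G X μ} {β : PMPAction H Y ν}
    {L : OrbitCorr α β} {Γ : Subgroup G} {Λ : Q → Subgroup H} {Λ₀ : Subgroup H} {Φ : ℕ → PBI Y}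
    {R₀ : CBER Y} {T : CBER X} {Rt : X → Y → Prop} {enc : H → ℕ} {encG : G → ℕ}

theorem eq_of_minLab (hT : IsOrbitRel α Γ T) (henc : Function.Injective enc) {q : Q} {h h' : H}
    {x x' : X} {y : Y} (hL : L.Lab Λ Rt q h x y) (hm : L.MinLab Γ Λ Rt enc q h x y)
    (hL' : L.Lab Λ Rt q h' x' y) (hm' : L.MinLab Γ Λ Rt enc q h' x' y) (hxx' : T.rel x x') :
    h = h' := by
  rcases lt_trichotomy (enc h) (enc h') with hlt | he | hlt
  · exact absurd hlt (hm'.not_lt hT (T.symm hxx') hL)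
  · exact henc he
  · exact absurd hlt (hm.not_lt hT hxx' hL')

theorem rel_refl (hT : IsOrbitRel α Γ T) (x : X) : T.rel x x :=
  (hT.2 _ _).mpr ⟨1, one_mem _, α.act_one _⟩

theorem rel_act (hT : IsOrbitRel α Γ T) (x : X) (γ : Γ) : T.rel x (α.act γ x) :=
  (hT.2 _ _).mpr ⟨γ, γ.2, rfl⟩

/-- Each class of `CoreRel` is a retract, compatibly with the other relations and edges. -/
theorem IsRootSystem.exists_core_cut (hH : IsFreeProductOf H (fun j : Option Q => j.elim Λ₀ Λ))
    (hR₀ : IsOrbitRel β Λ₀ R₀) (hΦ : GeneratesCBER Φ R₀) (hT : IsOrbitRel α Γ T)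
    (hR : L.IsRootSystem T (CosetAdj β Λ Φ) Rt) (henc : Function.Injective enc)
    (hencG : Function.Injective encG) (b : Q × H) (x₀ : X) (hb : L.CoreRel Γ Λ Rt enc b x₀ x₀) :
    ∃ f : X → X, (∀ w w', L.CoreRel Γ Λ Rt enc b x₀ w → L.CoreRel Γ Λ Rt enc b x₀ w' →
        f w = f w' → w = w') ∧
      (∀ b' w w', T.rel x₀ w → L.CoreRel Γ Λ Rt enc b' w w' →
        (b' ≠ b ∨ ¬ L.CoreRel Γ Λ Rt enc b x₀ w) → f w = f w') ∧
      ∀ a w, T.rel x₀ w → w ∈ L.edgeSet Γ Λ Φ Rt enc encG a →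
        f w = f (α.act (edgeElt (Q := Q) Γ a) w) := by
  classical
  obtain ⟨q, h⟩ := b
  set y₀ := β.act h (L.toRight x₀) with hy₀
  have hRt₀ : Rt x₀ y₀ := hb.2.1
  have hcore₀ : L.Core Γ Λ Rt enc q x₀ y₀ := hb.core
  obtain ⟨P, hfix, hbig, hsmall, hhair⟩ := hR.exists_coset_map hH hR₀ hΦ hT (hR.corr hRt₀) q
  let good : X → G → Prop := fun x γ => (γ ∈ Γ ∧ L.Core Γ Λ Rt enc q (α.act γ x) y₀) ∧
    ∀ γ', encG γ' < encG γ → ¬ (γ' ∈ Γ ∧ L.Core Γ Λ Rt enc q (α.act γ' x) y₀)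
  let κ : X → X := fun x => if L.Core Γ Λ Rt enc q x y₀ then x else
    if h : ∃ γ, good x γ then α.act h.choose x else x
  have hκ1 : ∀ x, L.Core Γ Λ Rt enc q x y₀ → κ x = x := fun x hx => if_pos hx
  have hκ2 : ∀ x γ, ¬ L.Core Γ Λ Rt enc q x y₀ → good x γ → κ x = α.act γ x := by
    intro x γ hx hγ
    have hex : ∃ γ, good x γ := ⟨γ, hγ⟩
    simp only [κ, if_neg hx, dif_pos hex]
    rw [eq_of_minimal_of_encode (p := fun γ => γ ∈ Γ ∧ L.Core Γ Λ Rt enc q (α.act γ x) y₀)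
      hencG hex.choose_spec.1 hex.choose_spec.2 hγ.1 hγ.2]
  have hCR : ∀ w, L.CoreRel Γ Λ Rt enc (q, h) x₀ w → κ (P w) = w := by
    intro w hw
    obtain ⟨l, hl, hly⟩ := hw.2.2.2.1
    rw [hfix w _ ((hT.2 _ _).mpr hw.1) hw.2.2.1 ⟨l, hl, hly⟩]
    apply hκ1
    have := hw.symm.core
    dsimp only at this hly
    rwa [← hly, core_coset hl] at this
  refine ⟨fun w => κ (P w), ?_, ?_, ?_⟩
  · intro w w' hw hw' he
    dsimp only at he
    rwa [hCR w hw, hCR w' hw'] at he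
  · rintro ⟨q', h'⟩ w w' hw hww' hne
    dsimp only
    rcases hbig q' w _ w' _ hw hww'.2.1 (T.trans hw ((hT.2 _ _).mpr hww'.1)) hww'.2.2.1
      hww'.2.2.2.1 with ⟨rfl, l, hl, hly⟩ | he
    · exfalso
      dsimp only at hly
      have hm : L.MinLab Γ Λ Rt enc q' h' w y₀ := by
        rw [← minLab_coset hl, hly]
        exact hww'.2.2.2.2.1
      have hhh : h = h' := eq_of_minLab hT henc ⟨hRt₀, 1, one_mem _, β.act_one _⟩ hb.2.2.2.2.1
        ⟨hww'.2.1, l, hl, hly⟩ hm hw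
      subst hhh
      rcases hne with hne | hne
      · exact hne rfl
      · exact hne ⟨(hT.2 _ _).mp hw, hRt₀, hww'.2.1, ⟨l, hl, hly⟩, hb.2.2.2.2.1,
          hww'.2.2.2.2.1⟩
    · rw [he]
  · rintro (⟨q', h', γ⟩ | ⟨i, h', γ⟩ | γ) w hw hwa
    · obtain ⟨h1, h2, h3, h4, h5⟩ := hwa
      dsimp only at h1 h2 h3 h4 h5
      dsimp only [edgeElt, Sum.elim_inl]
      obtain ⟨k, ⟨hk, l, hl, hlk⟩, -⟩ := id h4
      have hwγ := T.trans hw (rel_act hT w γ)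
      rcases hbig q' w _ _ _ hw h1 hwγ hk ⟨l, hl, hlk⟩ with ⟨rfl, l', hl', hly⟩ | he
      · rw [hfix w _ hw h1 ⟨l', hl', hly⟩, hfix _ _ hwγ hk
          ⟨l * l', mul_mem hl hl', by rw [β.act_mul, hly, hlk]⟩]
        rw [← hly, core_coset hl'] at h3 h4
        rw [hκ1 _ h4, hκ2 w γ h3 ⟨⟨γ.2, h4⟩, fun γ' hlt hc => ?_⟩]
        refine h5 γ' hc.1 hlt ?_
        rw [← hly, core_coset hl']
        exact hc.2
      · rw [he]
    · obtain ⟨h1, h2, h3, h4⟩ := hwa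
      exact congrArg κ (hsmall i w _ _ hw h1 (T.trans hw (rel_act hT w γ)) h2 h3)
    · exact congrArg κ (hhair w _ hw (rel_act hT w γ) hwa.1).symm

/-- Each edge separates its endpoints. -/
theorem IsRootSystem.exists_edge_cut (hH : IsFreeProductOf H (fun j : Option Q => j.elim Λ₀ Λ))
    (hR₀ : IsOrbitRel β Λ₀ R₀) (hΦ : GeneratesCBER Φ R₀) (hΦt : IsTreeing Φ)
    (hT : IsOrbitRel α Γ T) (hR : L.IsRootSystem T (CosetAdj β Λ Φ) Rt)
    (henc : Function.Injective enc) (hencG : Function.Injective encG)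
    (a : (Q × H × Γ) ⊕ (ℕ × H × Γ) ⊕ Γ) (x₀ : X) (ha : x₀ ∈ L.edgeSet Γ Λ Φ Rt enc encG a) :
    ∃ f : X → Prop, f x₀ ∧ ¬ f (α.act (edgeElt (Q := Q) Γ a) x₀) ∧
      (∀ b w w', T.rel x₀ w → L.CoreRel Γ Λ Rt enc b w w' → (f w ↔ f w')) ∧
      ∀ a' w, T.rel x₀ w → w ∈ L.edgeSet Γ Λ Φ Rt enc encG a' → ¬ (a' = a ∧ w = x₀) →
        (f w ↔ f (α.act (edgeElt (Q := Q) Γ a') w)) := by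
  rcases a with ⟨q, h, γ⟩ | ⟨i, h, γ⟩ | γ
  · obtain ⟨h1, h2, h3, h4, h5⟩ := ha
    dsimp only at h1 h2 h3 h4 h5
    dsimp only [edgeElt, Sum.elim_inl]
    set y₀ := β.act h (L.toRight x₀) with hy₀
    obtain ⟨P, hfix, hbig, hsmall, hhair⟩ := hR.exists_coset_map hH hR₀ hΦ hT (hR.corr h1) q
    obtain ⟨k, ⟨hk, l, hl, hlk⟩, -⟩ := id h4
    refine ⟨fun w => P w = x₀, hfix _ _ (rel_refl hT _) h1 ⟨1, one_mem _, β.act_one _⟩, ?_,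
      ?_, ?_⟩
    · dsimp only
      rw [hfix _ _ (rel_act hT x₀ γ) hk ⟨l, hl, hlk⟩]
      intro he
      rw [he] at h4
      exact h3 h4
    · rintro ⟨q', h'⟩ w w' hw hww'
      dsimp only
      have hw' := T.trans hw ((hT.2 _ _).mpr hww'.1)
      rcases hbig q' w _ w' _ hw hww'.2.1 hw' hww'.2.2.1 hww'.2.2.2.1 with ⟨rfl, m, hm, hmy⟩ | he
      · obtain ⟨m', hm', hmy'⟩ := hww'.2.2.2.1
        dsimp only at hmy hmy'
        rw [hfix w _ hw hww'.2.1 ⟨m, hm, hmy⟩, hfix w' _ hw' hww'.2.2.1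
          ⟨m' * m, mul_mem hm' hm, by rw [β.act_mul, hmy, hmy']⟩]
        have hc := hww'.core
        have hc' := hww'.symm.core
        dsimp only at hc hc'
        rw [← hmy, core_coset hm] at hc
        rw [← hmy', core_coset hm', ← hmy, core_coset hm] at hc'
        exact ⟨fun he => absurd (he ▸ hc) h3, fun he => absurd (he ▸ hc') h3⟩
      · rw [he]
    · rintro (⟨q', h', γ'⟩ | ⟨i, h', γ'⟩ | γ') w hw hwa hne
      · obtain ⟨g1, g2, g3, g4, g5⟩ := hwa
        dsimp only at g1 g2 g3 g4 g5
        dsimp only [Sum.elim_inl]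
        obtain ⟨k', ⟨hk', m', hm', hmk'⟩, -⟩ := id g4
        have hwγ := T.trans hw (rel_act hT w γ')
        rcases hbig q' w _ _ _ hw g1 hwγ hk' ⟨m', hm', hmk'⟩ with ⟨rfl, m, hm, hmy⟩ | he
        · rw [hfix w _ hw g1 ⟨m, hm, hmy⟩, hfix _ _ hwγ hk'
            ⟨m' * m, mul_mem hm' hm, by rw [β.act_mul, hmy, hmk']⟩]
          rw [← hmy, core_coset hm] at g3 g4
          refine ⟨fun he => absurd he fun he => hne ?_, fun he => absurd (he ▸ g4) h3⟩
          subst he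
          refine ⟨?_, rfl⟩
          have hhh : h' = h := by
            refine eq_of_minimal_of_encode (p := fun h => L.Lab Λ Rt q' h w y₀) henc
              ⟨g1, m, hm, hmy⟩ (fun j hj hL => g2 j hj ?_)
              ⟨h1, 1, one_mem _, β.act_one _⟩ (fun j hj hL => h2 j hj hL)
            rw [← hmy, lab_coset hm]
            exact hL
          have hγγ : (γ' : G) = γ := by
            refine eq_of_minimal_of_encode
              (p := fun γ => γ ∈ Γ ∧ L.Core Γ Λ Rt enc q' (α.act γ w) y₀) hencG
              ⟨γ'.2, g4⟩ (fun j hj hL => g5 j hL.1 hj ?_)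
              ⟨γ.2, h4⟩ (fun j hj hL => h5 j hL.1 hj hL.2)
            rw [← hmy, core_coset hm]
            exact hL.2
          rw [hhh, Subtype.ext hγγ]
        · rw [he]
      · obtain ⟨g1, g2, g3, g4⟩ := hwa
        dsimp only [Sum.elim_inl, Sum.elim_inr]
        rw [hsmall i w _ _ hw g1 (T.trans hw (rel_act hT w γ')) g2 g3]
      · dsimp only [Sum.elim_inr]
        rw [id_eq, hhair w _ hw (rel_act hT w γ') hwa.1]
  · obtain ⟨h1, h2, h3, h4⟩ := ha
    dsimp only at h1 h2 h3 h4
    dsimp only [edgeElt, Sum.elim_inl, Sum.elim_inr]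
    obtain ⟨P, hP0, hP1, hbig, hsmall, hhair⟩ :=
      hR.exists_edge_map hH hR₀ hΦ hΦt hT h1 h2 h3 (rel_act hT x₀ γ)
    refine ⟨fun w => P w = x₀, hP0, by dsimp only; rwa [hP1], ?_, ?_⟩
    · rintro ⟨q', h'⟩ w w' hw hww'
      dsimp only
      rw [hbig q' w _ w' _ hw hww'.2.1 (T.trans hw ((hT.2 _ _).mpr hww'.1)) hww'.2.2.1
        hww'.2.2.2.1]
    · rintro (⟨q', h', γ'⟩ | ⟨i', h', γ'⟩ | γ') w hw hwa hne
      · obtain ⟨g1, g2, g3, g4, g5⟩ := hwa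
        obtain ⟨k', ⟨hk', m', hm', hmk'⟩, -⟩ := id g4
        dsimp only [Sum.elim_inl]
        rw [hbig q' w _ _ _ hw g1 (T.trans hw (rel_act hT w γ')) hk' ⟨m', hm', hmk'⟩]
      · obtain ⟨g1, g2, g3, g4⟩ := hwa
        dsimp only at g1 g2 g3 g4
        dsimp only [Sum.elim_inl, Sum.elim_inr]
        by_cases he : i' = i ∧ β.act h' (L.toRight w) = β.act h (L.toRight x₀)
        · obtain ⟨rfl, he⟩ := he
          have hwx : w = x₀ := by
            rw [he] at g1
            exact hR.uniq hw h1 g1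
          subst hwx
          refine absurd ⟨?_, rfl⟩ hne
          have hEw := hR.corr h1
          have hh : h' = h := β.eq_of_act_eq (L.free_right (L.toRight_spec hEw)) he
          rw [he] at g3
          have hγ : (γ' : G) = γ := by
            refine α.eq_of_act_eq (L.free_left hEw) ?_
            refine hR.uniq ?_ h3 g3
            exact T.trans (T.symm (rel_act hT w γ)) (rel_act hT w γ')
          rw [hh, Subtype.ext hγ]
        · rw [hsmall i' w _ _ hw g1 (T.trans hw (rel_act hT w γ')) g2 g3 he]
      · dsimp only [Sum.elim_inr]
        rw [id_eq, hhair w _ hw (rel_act hT w γ') hwa.1]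
  · obtain ⟨h1, h2⟩ := ha
    dsimp only [edgeElt, Sum.elim_inl, Sum.elim_inr]
    rw [id_eq]
    have hnot : ∀ y, ¬ Rt x₀ y := by
      intro y hy
      have := (hR.compat (ρ := id) hy (fun _ _ _ _ => Or.inr ⟨rfl, rfl⟩) x₀ (rel_refl hT _)).mpr hy
      exact h2 (hR.uniq (rel_act hT x₀ γ) this h1)
    refine ⟨fun w => w = x₀, rfl, h2, ?_, ?_⟩
    · rintro ⟨q', h'⟩ w w' hw hww'
      exact ⟨fun he => absurd (he ▸ hww'.2.1) (hnot _), fun he => absurd (he ▸ hww'.2.2.1) (hnot _)⟩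
    · rintro (⟨q', h', γ'⟩ | ⟨i', h', γ'⟩ | γ') w hw hwa hne
      · obtain ⟨k', ⟨hk', -⟩, -⟩ := hwa.2.2.2.1
        exact ⟨fun he => absurd (he ▸ hwa.1) (hnot _), fun he => absurd hk' (by
          change α.act γ' w = x₀ at he
          dsimp only
          rw [he]
          exact hnot _)⟩
      · refine ⟨fun he => absurd (he ▸ hwa.1) (hnot _), fun he => ?_⟩
        change α.act γ' w = x₀ at he
        have := hwa.2.2.1
        dsimp only at this
        rw [he] at this
        exact absurd this (hnot _)
      · refine ⟨fun he => ?_, fun he => ?_⟩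
        · dsimp only at he
          subst he
          refine absurd ⟨?_, rfl⟩ hne
          have hγ : α.act γ' w = α.act γ w := hR.uniq
            (T.trans (T.symm (rel_act hT w γ)) (rel_act hT w γ')) h1 hwa.1
          have hE := E_of_rel hT (T.symm (rel_act hT w γ)) (hR.corr h1)
          rw [Subtype.ext (α.eq_of_act_eq (L.free_left hE) hγ)]
        · change α.act γ' w = x₀ at he
          have := hwa.1
          rw [he] at this
          exact absurd this (hnot _)

end OrbitCorr

namespace OrbitCorr

variable {G H X Y Q : Type} [Group G] [Group H] [MeasurableSpace X] [MeasurableSpace Y]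
    {μ : Measure X} {ν : Measure Y} {α : PMPAction G X μ} {β : PMPAction H Y ν}

/-- A Borel `Γ`-invariant assignment to almost every point of `X` of a coset of some `Λ q` in the
corresponding orbit of `Y`. -/
structure IsFixedCoset (L : OrbitCorr α β) (Γ : Subgroup G) (Λ : Q → Subgroup H)
    (F : Q → X → Y → Prop) : Prop where
  meas : ∀ q, Measurable (Function.uncurry (F q))
  corr : ∀ {q x y}, F q x y → L.E x y
  left : ∀ {q x y γ}, γ ∈ Γ → F q x y → F q (α.act γ x) y
  right : ∀ {q x y l}, l ∈ Λ q → F q x y → F q x (β.act l y)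
  uniq : ∀ {q q' x y y'}, F q x y → F q' x y' → q = q' ∧ ∃ l ∈ Λ q, β.act l y = y'
  ae : ∀ᵐ x ∂μ, ∃ q y, F q x y

/-- If `Γ` acts by a freely indecomposable relation, then almost every `Γ`-orbit fixes a coset of some
`Λ q`, in an essentially unique and Borel way. -/
theorem exists_isFixedCoset [Countable G] [Countable H] [Countable Q] [StandardBorelSpace X]
    [StandardBorelSpace Y] [IsFiniteMeasure μ] (L : OrbitCorr α β) (hE : ∀ᵐ x ∂μ, ∃ y, L.E x y)
    (hfree : α.IsFree) {Γ : Subgroup G} (hΓ : Infinite Γ) {T : CBER X} (hT : IsOrbitRel α Γ T)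
    (hFI : FreelyIndecomposableMod μ T) {Λ : Q → Subgroup H} {Λ₀ : Subgroup H}
    (hH : IsFreeProductOf H (fun j : Option Q => j.elim Λ₀ Λ)) {R₀ : CBER Y}
    (hR₀ : IsOrbitRel β Λ₀ R₀) (htree : R₀.Treeable) :
    ∃ F : Q → X → Y → Prop, L.IsFixedCoset Γ Λ F := by
  obtain ⟨Φ, hΦt, hΦ⟩ := htree
  obtain ⟨enc, henc⟩ := exists_injective_nat H
  obtain ⟨encG, hencG⟩ := exists_injective_nat G
  obtain ⟨Rt, hRt, h1, h2, h3, h4⟩ := L.exists_roots Γ (CosetAdj β Λ Φ) CosetAdj.measurable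
    (fun _ _ h => h.symm) (fun _ _ h => h.exists_act hR₀ hΦ) (CosetAdj.connected hH hR₀ hΦ)
  have hR : L.IsRootSystem T (CosetAdj β Λ Φ) Rt := by
    refine ⟨h1 _ _, fun {x x' y} hxx' hx hx' => ?_, fun {x y} hx => ?_,
      fun {ρ x y} hx hρ x' hxx' => ?_⟩
    · obtain ⟨γ, hγ, rfl⟩ := (hT.2 _ _).mp hxx'
      exact h2 x y γ hγ hx hx'
    · obtain ⟨γ, hγ, h⟩ := h3 x y hx
      exact ⟨_, (hT.2 _ _).mpr ⟨γ, hγ, rfl⟩, h⟩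
    · obtain ⟨γ, hγ, rfl⟩ := (hT.2 _ _).mp hxx'
      exact h4 ρ x y hx hρ γ hγ
  have hX₀ : ∀ x y, Rt x y → L.E x (L.toRight x) := fun x y h => L.toRight_spec (h1 _ _ h)
  obtain ⟨U, hUm, hUX, hUae, hU⟩ := hFI.exists_section_core hfree hT
    (X₀ := {x | L.E x (L.toRight x)})
    (measurableSet_setOfPred.mpr (by fun_prop))
    (by
      refine mem_ae_iff.mp ?_
      exact hE.mono fun x ⟨y, hy⟩ => L.toRight_spec hy)
    (fun x hx γ _ => L.toRight_spec (L.smul_left hx γ))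
    (L.CoreRel Γ Λ Rt enc)
    (fun b => measurableSet_setOfPred.mpr (measurable_CoreRel hRt b))
    (fun b x y h => h.symm) (fun b x y z h h' => h.trans h')
    (fun b x y h => ⟨hX₀ _ _ h.2.1, (hT.2 _ _).mpr h.1⟩)
    (L.edgeSet Γ Λ Φ Rt enc encG)
    (by
      rintro (a | a | a)
      · exact measurableSet_spoke hRt encG a
      · exact measurableSet_treeEdge hRt Φ a
      · exact measurableSet_hair hRt a)
    (by
      rintro (a | a | a) x hx
      · exact hX₀ _ _ hx.1
      · exact hX₀ _ _ hx.1
      · exact L.toRight_spec (L.of_smul_left (h1 _ _ hx.1)))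
    (fun a => (edgeElt (Q := Q) Γ a : G)) (fun a => (edgeElt Γ a).2)
    (by
      rintro (a | a | a) x hx
      · intro he
        have := hx.2.2.2.1
        change α.act a.2.2 x = x at he
        rw [he] at this
        exact hx.2.2.1 this
      · exact hx.2.2.2
      · exact hx.2)
    (fun x hx y hxy => hR.eqvGen hH hR₀ hΦ hT henc hx hxy)
    (fun b x₀ hb => hR.exists_core_cut hH hR₀ hΦ hT henc hencG b x₀ hb)
    (fun a x₀ ha => hR.exists_edge_cut hH hR₀ hΦ hΦt hT henc hencG a x₀ ha)
  refine ⟨fun q x y => ∃ γ ∈ Γ, ∃ h, α.act γ x ∈ U (q, h) ∧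
    ∃ l ∈ Λ q, β.act l (β.act h (L.toRight (α.act γ x))) = y, ?_⟩
  constructor
  case meas =>
    intro q
    have : ∀ h, Measurable fun x => x ∈ U (q, h) := fun h => measurableSet_setOfPred.mp (hUm _)
    have : ∀ γ h, Measurable fun p : X × Y => α.act γ p.1 ∈ U (q, h) := fun γ h =>
      (this h).comp ((α.measurable_act γ).comp measurable_fst)
    unfold Function.uncurry
    fun_prop
  case corr =>
    rintro q x y ⟨γ, hγ, h, hx, l, hl, rfl⟩
    exact L.of_smul_left (L.smul_right (L.smul_right (hUX _ hx) h) l)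
  case left =>
    rintro q x y γ hγ ⟨γ', hγ', h, hx, l, hl, rfl⟩
    refine ⟨γ' * γ⁻¹, mul_mem hγ' (inv_mem hγ), h, ?_, l, hl, ?_⟩ <;>
      rw [α.act_mul, α.act_inv_act]
    exact hx
  case right =>
    rintro q x y k hk ⟨γ', hγ', h, hx, l, hl, rfl⟩
    exact ⟨γ', hγ', h, hx, k * l, mul_mem hk hl, β.act_mul _ _ _⟩
  case uniq =>
    rintro q q' x y y' ⟨γ, hγ, h, hx, l, hl, rfl⟩ ⟨γ', hγ', h', hx', l', hl', rfl⟩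
    have he : α.act γ' x = α.act (γ' * γ⁻¹) (α.act γ x) := by rw [α.act_mul, α.act_inv_act]
    rw [he] at hx'
    obtain ⟨hb, hW⟩ := hU _ _ _ _ hx (mul_mem hγ' (inv_mem hγ)) hx'
    rw [Prod.mk.injEq] at hb
    obtain ⟨rfl, rfl⟩ := hb
    rw [← he] at hW
    refine ⟨rfl, ?_⟩
    have hm : ∃ m ∈ Λ q, β.act m (β.act h (L.toRight (α.act γ x))) =
        β.act h (L.toRight (α.act γ' x)) := by
      rcases hW with hW | hW
      · exact ⟨1, one_mem _, by rw [β.act_one, hW]⟩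
      · exact hW.2.2.2.1
    obtain ⟨m, hm, hmy⟩ := hm
    refine ⟨l' * m * l⁻¹, mul_mem (mul_mem hl' hm) (inv_mem hl), ?_⟩
    rw [β.act_mul, β.act_inv_act, β.act_mul, hmy]
  case ae =>
    refine hUae.mono ?_
    rintro x ⟨⟨q, h⟩, γ, hγ, hx⟩
    exact ⟨q, _, γ, hγ, h, hx, 1, one_mem _, rfl⟩

end OrbitCorr

/-- A Borel isomorphism between Borel subsets of two measured spaces, multiplying the measure
by `c`. -/
structure ScaledIso {X Y : Type} [MeasurableSpace X] [MeasurableSpace Y] (μ : Measure X)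
    (ν : Measure Y) (c : ENNReal) where
  src : Set X
  tgt : Set Y
  src_meas : MeasurableSet src
  tgt_meas : MeasurableSet tgt
  toFun : X → Y
  invFun : Y → X
  meas_toFun : Measurable toFun
  meas_invFun : Measurable invFun
  mapsTo : Set.MapsTo toFun src tgt
  mapsTo_inv : Set.MapsTo invFun tgt src
  left_inv : ∀ x ∈ src, invFun (toFun x) = x
  right_inv : ∀ y ∈ tgt, toFun (invFun y) = y
  measure_image : ∀ S ⊆ src, MeasurableSet S → ν (toFun '' S) = c * μ S

namespace ScaledIso

variable {X Y : Type} [MeasurableSpace X] [MeasurableSpace Y] {μ : Measure X} {ν : Measure Y}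
  {c : ENNReal}

attribute [fun_prop] meas_toFun meas_invFun

theorem image_eq (φ : ScaledIso μ ν c) {S : Set X} (hS : S ⊆ φ.src) :
    φ.toFun '' S = φ.tgt ∩ φ.invFun ⁻¹' S := by
  ext y
  constructor
  · rintro ⟨x, hx, rfl⟩
    refine ⟨φ.mapsTo (hS hx), ?_⟩
    rwa [Set.mem_preimage, φ.left_inv x (hS hx)]
  · rintro ⟨hy, hy'⟩
    exact ⟨_, hy', φ.right_inv y hy⟩

theorem measurableSet_image (φ : ScaledIso μ ν c) {S : Set X} (hS : S ⊆ φ.src)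
    (hSm : MeasurableSet S) : MeasurableSet (φ.toFun '' S) := by
  rw [φ.image_eq hS]
  exact φ.tgt_meas.inter (φ.meas_invFun hSm)

/-- The inverse isomorphism. -/
def symm (φ : ScaledIso μ ν c) (hc : c ≠ 0) (hc' : c ≠ ⊤) : ScaledIso ν μ c⁻¹ where
  src := φ.tgt
  tgt := φ.src
  src_meas := φ.tgt_meas
  tgt_meas := φ.src_meas
  toFun := φ.invFun
  invFun := φ.toFun
  meas_toFun := φ.meas_invFun
  meas_invFun := φ.meas_toFun
  mapsTo := φ.mapsTo_inv
  mapsTo_inv := φ.mapsTo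
  left_inv := φ.right_inv
  right_inv := φ.left_inv
  measure_image := fun S hS hSm => by
    have h1 : φ.invFun '' S = φ.src ∩ φ.toFun ⁻¹' S := by
      ext x
      constructor
      · rintro ⟨y, hy, rfl⟩
        refine ⟨φ.mapsTo_inv (hS hy), ?_⟩
        rwa [Set.mem_preimage, φ.right_inv y (hS hy)]
      · rintro ⟨hx, hx'⟩
        exact ⟨_, hx', φ.left_inv x hx⟩
    have h2 := φ.measure_image (φ.invFun '' S) (by rw [h1]; exact Set.inter_subset_left)
      (by rw [h1]; exact φ.src_meas.inter (φ.meas_toFun hSm))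
    have h3 : φ.toFun '' (φ.invFun '' S) = S := by
      rw [Set.image_image, Set.image_congr (fun y hy => φ.right_inv y (hS hy)), Set.image_id']
    rw [h3] at h2
    rw [h2, ← mul_assoc, ENNReal.inv_mul_cancel hc hc', one_mul]

theorem null_preimage (φ : ScaledIso μ ν c) (hc : c ≠ 0) {N : Set Y} (hN : ν N = 0) :
    μ (φ.src ∩ φ.toFun ⁻¹' N) = 0 := by
  obtain ⟨N', hNN', hN'm, hN'⟩ := exists_measurable_superset_of_null hN
  refine measure_mono_null (Set.inter_subset_inter_right _ (Set.preimage_mono hNN')) ?_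
  have h := φ.measure_image (φ.src ∩ φ.toFun ⁻¹' N') Set.inter_subset_left
    (φ.src_meas.inter (φ.meas_toFun hN'm))
  have h0 : ν (φ.toFun '' (φ.src ∩ φ.toFun ⁻¹' N')) = 0 := by
    refine measure_mono_null ?_ hN'
    rintro _ ⟨x, hx, rfl⟩
    exact hx.2
  rw [h0] at h
  exact (mul_eq_zero.mp h.symm).resolve_left hc

/-- Greedy matching: among countably many partial isomorphisms, a maximal one whose graph is
contained in `M`. -/
theorem exists_matching (θ : ℕ → ScaledIso μ ν c) {M : X → Y → Prop}
    (hM : Measurable (Function.uncurry M)) :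
    ∃ φ : ScaledIso μ ν c, (∀ x ∈ φ.src, M x (φ.toFun x)) ∧
      ∀ n, ∀ x ∈ (θ n).src, M x ((θ n).toFun x) → x ∈ φ.src ∨ (θ n).toFun x ∈ φ.tgt := by
  let d : ℕ → Set X × Set Y → Set X := fun n p =>
    {x | x ∈ (θ n).src ∧ M x ((θ n).toFun x) ∧ x ∉ p.1 ∧ (θ n).toFun x ∉ p.2}
  let s : ℕ → Set X × Set Y := fun n =>
    n.rec (∅, ∅) fun n p => (p.1 ∪ d n p, p.2 ∪ (θ n).toFun '' d n p)
  have hs : ∀ n, s (n + 1) = ((s n).1 ∪ d n (s n), (s n).2 ∪ (θ n).toFun '' d n (s n)) :=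
    fun n => rfl
  let D : ℕ → Set X := fun n => d n (s n)
  let I : ℕ → Set Y := fun n => (θ n).toFun '' D n
  have hDsrc : ∀ n, D n ⊆ (θ n).src := fun n x hx => hx.1
  have hsm : ∀ n, MeasurableSet (s n).1 ∧ MeasurableSet (s n).2 ∧ MeasurableSet (D n) := by
    have hd : ∀ n, MeasurableSet (s n).1 → MeasurableSet (s n).2 → MeasurableSet (D n) := by
      intro n h1 h2
      have h3 : Measurable fun x => M x ((θ n).toFun x) := by fun_prop
      exact (θ n).src_meas.inter ((measurableSet_setOfPred.mpr h3).inter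
        (h1.compl.inter ((θ n).meas_toFun h2.compl)))
    intro n
    induction n with
    | zero => exact ⟨.empty, .empty, hd 0 .empty .empty⟩
    | succ n ih =>
      have h1 : MeasurableSet (s (n + 1)).1 := ih.1.union ih.2.2
      have h2 : MeasurableSet (s (n + 1)).2 :=
        ih.2.1.union ((θ n).measurableSet_image (hDsrc n) ih.2.2)
      exact ⟨h1, h2, hd _ h1 h2⟩
  have hDm : ∀ n, MeasurableSet (D n) := fun n => (hsm n).2.2
  have hIm : ∀ n, MeasurableSet (I n) := fun n => (θ n).measurableSet_image (hDsrc n) (hDm n)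
  have hmono : ∀ m n, m < n → D m ⊆ (s n).1 ∧ I m ⊆ (s n).2 := by
    intro m n hmn
    induction n, hmn using Nat.le_induction with
    | base => exact ⟨Set.subset_union_right, Set.subset_union_right⟩
    | succ n _ ih =>
      exact ⟨ih.1.trans Set.subset_union_left, ih.2.trans Set.subset_union_left⟩
  have hsub : ∀ n, (s n).1 ⊆ ⋃ m, D m ∧ (s n).2 ⊆ ⋃ m, I m := by
    intro n
    induction n with
    | zero => exact ⟨Set.empty_subset _, Set.empty_subset _⟩
    | succ n ih =>
      exact ⟨Set.union_subset ih.1 (Set.subset_iUnion D n),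
        Set.union_subset ih.2 (Set.subset_iUnion I n)⟩
  have hDdisj : Pairwise (Function.onFun Disjoint D) := by
    refine (pairwise_disjoint_on D).mpr fun m n hmn => Set.disjoint_left.mpr fun x hm hn => ?_
    exact hn.2.2.1 ((hmono m n hmn).1 hm)
  have hIdisj : Pairwise (Function.onFun Disjoint I) := by
    refine (pairwise_disjoint_on I).mpr fun m n hmn => Set.disjoint_left.mpr ?_
    rintro _ hm ⟨x, hn, rfl⟩
    exact hn.2.2.2 ((hmono m n hmn).2 hm)
  obtain ⟨f, hfm, hf⟩ := exists_measurable_piecewise D hDm (fun n => (θ n).toFun)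
    (fun n => (θ n).meas_toFun) (fun m n hmn x hx =>
      absurd hx.2 (Set.disjoint_left.mp (hDdisj hmn) hx.1))
  obtain ⟨g, hgm, hg⟩ := exists_measurable_piecewise I hIm (fun n => (θ n).invFun)
    (fun n => (θ n).meas_invFun) (fun m n hmn x hx =>
      absurd hx.2 (Set.disjoint_left.mp (hIdisj hmn) hx.1))
  have hfI : ∀ n x, x ∈ D n → f x ∈ I n := fun n x hx => by
    rw [hf n hx]
    exact ⟨x, hx, rfl⟩
  refine ⟨⟨⋃ n, D n, ⋃ n, I n, .iUnion hDm, .iUnion hIm, f, g, hfm, hgm, ?_, ?_, ?_, ?_, ?_⟩,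
    ?_, ?_⟩
  · intro x hx
    obtain ⟨n, hn⟩ := Set.mem_iUnion.mp hx
    exact Set.mem_iUnion.mpr ⟨n, hfI n x hn⟩
  · intro y hy
    obtain ⟨n, x, hx, rfl⟩ := Set.mem_iUnion.mp hy
    rw [hg n ⟨x, hx, rfl⟩, (θ n).left_inv x (hDsrc n hx)]
    exact Set.mem_iUnion.mpr ⟨n, hx⟩
  · intro x hx
    obtain ⟨n, hn⟩ := Set.mem_iUnion.mp hx
    rw [hg n (hfI n x hn), hf n hn, (θ n).left_inv x (hDsrc n hn)]
  · intro y hy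
    obtain ⟨n, x, hx, rfl⟩ := Set.mem_iUnion.mp hy
    rw [hg n ⟨x, hx, rfl⟩, (θ n).left_inv x (hDsrc n hx), hf n hx]
  · intro S hS hSm
    have h1 : S = ⋃ n, S ∩ D n := by rw [← Set.inter_iUnion, Set.inter_eq_left.mpr hS]
    have h2 : f '' S = ⋃ n, (θ n).toFun '' (S ∩ D n) := by
      conv_lhs => rw [h1, Set.image_iUnion]
      exact Set.iUnion_congr fun n => Set.image_congr fun x hx => hf n hx.2
    have h3 : ∀ n, S ∩ D n ⊆ (θ n).src := fun n => Set.inter_subset_right.trans (hDsrc n)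
    rw [h2, measure_iUnion (fun m n hmn => (hIdisj hmn).mono
        (Set.image_mono Set.inter_subset_right) (Set.image_mono Set.inter_subset_right))
      (fun n => (θ n).measurableSet_image (h3 n) (hSm.inter (hDm n)))]
    conv_rhs => rw [h1]
    rw [measure_iUnion (fun m n hmn => (hDdisj hmn).mono Set.inter_subset_right
      Set.inter_subset_right) (fun n => hSm.inter (hDm n)), ← ENNReal.tsum_mul_left]
    exact tsum_congr fun n => (θ n).measure_image _ (h3 n) (hSm.inter (hDm n))
  · intro x hx
    obtain ⟨n, hn⟩ := Set.mem_iUnion.mp hx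
    dsimp only
    rw [hf n hn]
    exact hn.2.1
  · intro n x hx hMx
    by_contra hcon
    push Not at hcon
    have h1 : x ∉ (s n).1 := fun h => hcon.1 ((hsub n).1 h)
    have h2 : (θ n).toFun x ∉ (s n).2 := fun h => hcon.2 ((hsub n).2 h)
    exact hcon.1 (Set.mem_iUnion.mpr ⟨n, hx, hMx, h1, h2⟩)

end ScaledIso

/-- A Borel map agreeing at each point with one of countably many partially defined maps. -/
theorem exists_measurable_select {X Y : Type} [MeasurableSpace X] [MeasurableSpace Y]
    {D : ℕ → Set X} (hD : ∀ n, MeasurableSet (D n)) {f : ℕ → X → Y} (hf : ∀ n, Measurable (f n)) :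
    ∃ t : X → Y, Measurable t ∧ ∀ n, ∀ x ∈ D n, ∃ m, x ∈ D m ∧ t x = f m x := by
  obtain ⟨t, htm, ht⟩ := exists_measurable_piecewise (disjointed D)
    (fun n => MeasurableSet.disjointed hD n) f hf (fun m n hmn x hx =>
      absurd hx.2 (Set.disjoint_left.mp (disjoint_disjointed D hmn) hx.1))
  refine ⟨t, htm, fun n x hx => ?_⟩
  have : x ∈ ⋃ n, disjointed D n := by
    rw [iUnion_disjointed]
    exact Set.mem_iUnion.mpr ⟨n, hx⟩
  obtain ⟨m, hm⟩ := Set.mem_iUnion.mp this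
  exact ⟨m, disjointed_subset D m hm, ht m hm⟩

section

variable {G H X Y : Type} [Group G] [Group H] [MeasurableSpace X] [MeasurableSpace Y]
    {μ : Measure X} {ν : Measure Y}

/-- The inverse correspondence. -/
def OrbitCorr.symm {α : PMPAction G X μ} {β : PMPAction H Y ν} (L : OrbitCorr α β) :
    OrbitCorr β α where
  E y x := L.E x y
  meas := L.meas.comp measurable_swap
  smul_left := L.smul_right
  smul_right := L.smul_left
  exists_right := L.exists_left
  exists_left := L.exists_right
  free_left := L.free_right
  free_right := L.free_left
  toRight := L.toLeft
  meas_toRight := L.meas_toLeft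
  toRight_spec := L.toLeft_spec
  toLeft := L.toRight
  meas_toLeft := L.meas_toRight
  toLeft_spec := L.toRight_spec

/-- An orbit correspondence made of countably many partial isomorphisms multiplying the measure
by `c`. -/
structure OrbitLink (α : PMPAction G X μ) (β : PMPAction H Y ν) (c : ENNReal) extends
    OrbitCorr α β where
  iso : ℕ → ScaledIso μ ν c
  E_iff : ∀ x y, E x y ↔ ∃ n, x ∈ (iso n).src ∧ (iso n).toFun x = y
  ae_left : ∀ᵐ x ∂μ, ∃ y, E x y
  ae_right : ∀ᵐ y ∂ν, ∃ x, E x y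

namespace OrbitLink

variable {α : PMPAction G X μ} {β : PMPAction H Y ν} {c : ENNReal}

/-- The inverse link. -/
def symm (L : OrbitLink α β c) (hc : c ≠ 0) (hc' : c ≠ ⊤) : OrbitLink β α c⁻¹ where
  toOrbitCorr := L.toOrbitCorr.symm
  iso := fun n => (L.iso n).symm hc hc'
  E_iff := fun y x => by
    refine (L.E_iff x y).trans (exists_congr fun n => ⟨?_, ?_⟩)
    · rintro ⟨hx, rfl⟩
      exact ⟨(L.iso n).mapsTo hx, (L.iso n).left_inv x hx⟩
    · rintro ⟨hy, rfl⟩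
      exact ⟨(L.iso n).mapsTo_inv hy, (L.iso n).right_inv y hy⟩
  ae_left := L.ae_right
  ae_right := L.ae_left

theorem null_left (L : OrbitLink α β c) (hc : c ≠ 0) {N : Set Y} (hN : ν N = 0) :
    μ {x | ∃ y ∈ N, L.E x y} = 0 := by
  refine measure_mono_null ?_
    (measure_iUnion_null fun n => (L.iso n).null_preimage hc hN)
  rintro x ⟨y, hy, hxy⟩
  obtain ⟨n, hn, rfl⟩ := (L.E_iff x y).mp hxy
  exact Set.mem_iUnion.mpr ⟨n, hn, hy⟩

end OrbitLink

theorem PMPAction.free_of_act {α : PMPAction G X μ} {g : G} {x : X}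
    (h : ∀ k, α.act k (α.act g x) = α.act g x → k = 1) (k : G) (hk : α.act k x = x) : k = 1 := by
  have := h (g * k * g⁻¹) (by rw [α.act_mul, α.act_inv_act, α.act_mul, hk])
  simpa using this

/-- Composition of a partial isomorphism with group elements. -/
def ScaledIso.translate {c : ENNReal} (φ : ScaledIso μ ν c) (α : PMPAction G X μ)
    (β : PMPAction H Y ν) (g : G) (h : H) : ScaledIso μ ν c where
  src := α.act g ⁻¹' φ.src
  tgt := β.act h⁻¹ ⁻¹' φ.tgt
  src_meas := α.measurable_act g φ.src_meas
  tgt_meas := β.measurable_act _ φ.tgt_meas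
  toFun := fun x => β.act h (φ.toFun (α.act g x))
  invFun := fun y => α.act g⁻¹ (φ.invFun (β.act h⁻¹ y))
  meas_toFun := by fun_prop
  meas_invFun := by fun_prop
  mapsTo := fun x hx => by
    rw [Set.mem_preimage, β.act_inv_act]
    exact φ.mapsTo hx
  mapsTo_inv := fun y hy => by
    rw [Set.mem_preimage, α.act_act_inv]
    exact φ.mapsTo_inv hy
  left_inv := fun x hx => by rw [β.act_inv_act, φ.left_inv _ hx, α.act_inv_act]
  right_inv := fun y hy => by rw [α.act_act_inv, φ.right_inv _ hy, β.act_act_inv]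
  measure_image := fun S hS hSm => by
    have h1 : α.act g '' S = α.act g⁻¹ ⁻¹' S := by
      ext x
      constructor
      · rintro ⟨x, hx, rfl⟩
        rwa [Set.mem_preimage, α.act_inv_act]
      · exact fun hx => ⟨_, hx, α.act_act_inv _ _⟩
    have h2 : ∀ V : Set Y, β.act h '' V = β.act h⁻¹ ⁻¹' V := by
      intro V
      ext x
      constructor
      · rintro ⟨x, hx, rfl⟩
        rwa [Set.mem_preimage, β.act_inv_act]
      · exact fun hx => ⟨_, hx, β.act_act_inv _ _⟩
    have h3 : α.act g '' S ⊆ φ.src := by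
      rintro _ ⟨x, hx, rfl⟩
      exact hS hx
    have h4 : MeasurableSet (α.act g '' S) := by
      rw [h1]
      exact α.measurable_act _ hSm
    have h5 : (fun x => β.act h (φ.toFun (α.act g x))) '' S =
        β.act h '' (φ.toFun '' (α.act g '' S)) := by
      rw [Set.image_image, Set.image_image]
    rw [h5, h2, β.measure_preimage_act _ (φ.measurableSet_image h3 h4),
      φ.measure_image _ h3 h4, h1, α.measure_preimage_act _ hSm]

/-- A stable orbit equivalence of free actions yields a link. -/
theorem SOEquiv.exists_link [Countable G] [Countable H] [StandardBorelSpace X]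
    [StandardBorelSpace Y] [IsFiniteMeasure μ] [IsFiniteMeasure ν] {α : PMPAction G X μ}
    {β : PMPAction H Y ν} (hα : α.IsFree) (hβ : β.IsFree) {Rα : CBER X} {Rβ : CBER Y}
    (hRα : IsOrbitRel α ⊤ Rα) (hRβ : IsOrbitRel β ⊤ Rβ) (Θ : SOEquiv Rα μ Rβ ν) :
    ∃ c : ENNReal, c ≠ 0 ∧ c ≠ ⊤ ∧ Nonempty (OrbitLink α β c) := by
  obtain ⟨C, hCm, hC0, hC⟩ := Θ.rel_iff
  let c : ENNReal := ν Θ.B / μ Θ.A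
  have hA0 : μ Θ.A ≠ 0 := Θ.A_pos.ne'
  have hB0 : ν Θ.B ≠ 0 := Θ.B_pos.ne'
  have hAt : μ Θ.A ≠ ⊤ := measure_ne_top _ _
  have hBt : ν Θ.B ≠ ⊤ := measure_ne_top _ _
  have hc : c ≠ 0 := ENNReal.div_ne_zero.mpr ⟨hB0, hAt⟩
  have hc' : c ≠ ⊤ := ENNReal.div_ne_top hBt hA0
  let Ψ : ScaledIso μ ν c :=
    { src := Θ.A, tgt := Θ.B, src_meas := Θ.measA, tgt_meas := Θ.measB, toFun := Θ.toFun
      invFun := Θ.invFun, meas_toFun := Θ.meas_toFun, meas_invFun := Θ.meas_invFun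
      mapsTo := Θ.mapsTo, mapsTo_inv := Θ.mapsTo_inv, left_inv := Θ.left_inv
      right_inv := Θ.right_inv
      measure_image := fun S hS hSm => by
        have h := congrArg (ν Θ.B * ·) (Θ.measure_eq S hS hSm)
        rw [← mul_assoc, ← mul_assoc, ENNReal.mul_inv_cancel hB0 hBt, one_mul] at h
        exact h.symm }
  let fX : Set X := {x | ∀ g, α.act g x = x → g = 1}
  let fY : Set Y := {y | ∀ h, β.act h y = y → h = 1}
  have hfX : MeasurableSet fX := measurableSet_setOfPred.mpr (by fun_prop)
  have hfY : MeasurableSet fY := measurableSet_setOfPred.mpr (by fun_prop)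
  let A₁ : Set X := Θ.A ∩ (C ∩ fX ∩ Θ.toFun ⁻¹' fY)
  have hA₁ : A₁ ⊆ Θ.A := Set.inter_subset_left
  have hA₁m : MeasurableSet A₁ :=
    Θ.measA.inter ((hCm.inter hfX).inter (Θ.meas_toFun hfY))
  have hdiff : μ (Θ.A \ A₁) = 0 := by
    have : Θ.A \ A₁ ⊆ (Θ.A \ C) ∪ (fXᶜ ∪ (Ψ.src ∩ Ψ.toFun ⁻¹' fYᶜ)) := by
      rintro x ⟨hx, hx'⟩
      by_cases h1 : x ∈ C
      · by_cases h2 : x ∈ fX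
        · exact Or.inr (Or.inr ⟨hx, fun h3 => hx' ⟨hx, ⟨h1, h2⟩, h3⟩⟩)
        · exact Or.inr (Or.inl h2)
      · exact Or.inl ⟨hx, h1⟩
    exact measure_mono_null this (measure_union_null hC0
      (measure_union_null (mem_ae_iff.mp hα) (Ψ.null_preimage hc (mem_ae_iff.mp hβ))))
  let ψ : ScaledIso μ ν c :=
    { Ψ with
      src := A₁, tgt := Θ.toFun '' A₁, src_meas := hA₁m
      tgt_meas := Ψ.measurableSet_image hA₁ hA₁m
      mapsTo := fun x hx => ⟨x, hx, rfl⟩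
      mapsTo_inv := by
        rintro _ ⟨x, hx, rfl⟩
        change Θ.invFun (Θ.toFun x) ∈ A₁
        rwa [Θ.left_inv x (hA₁ hx)]
      left_inv := fun x hx => Θ.left_inv x (hA₁ hx)
      right_inv := by
        rintro _ ⟨x, hx, rfl⟩
        exact Θ.right_inv _ (Θ.mapsTo (hA₁ hx))
      measure_image := fun S hS => Ψ.measure_image S (hS.trans hA₁) }
  have hrel : ∀ x ∈ A₁, ∀ x' ∈ A₁, (∃ g, α.act g x = x') ↔
      ∃ h, β.act h (Θ.toFun x) = Θ.toFun x' := by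
    intro x hx x' hx'
    have := hC x ⟨hx.1, hx.2.1.1⟩ x' ⟨hx'.1, hx'.2.1.1⟩
    rw [hRα.2, hRβ.2] at this
    simpa using this
  obtain ⟨e, he⟩ := exists_surjective_nat (G × H)
  let iso : ℕ → ScaledIso μ ν c := fun n => ψ.translate α β (e n).1 (e n).2
  let E : X → Y → Prop := fun x y => ∃ n, x ∈ (iso n).src ∧ (iso n).toFun x = y
  have hE : ∀ x y, E x y ↔ ∃ g h, α.act g x ∈ A₁ ∧ β.act h (Θ.toFun (α.act g x)) = y := by
    refine fun x y => ⟨fun ⟨n, hn⟩ => ⟨_, _, hn⟩, fun ⟨g, h, hgh⟩ => ?_⟩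
    obtain ⟨n, hn⟩ := he (g, h)
    refine ⟨n, ?_⟩
    change α.act (e n).1 x ∈ A₁ ∧ β.act (e n).2 (Θ.toFun (α.act (e n).1 x)) = y
    rwa [hn]
  have hE' : ∀ x y, E x y ↔ ∃ n, y ∈ (iso n).tgt ∧ (iso n).invFun y = x := by
    refine fun x y => exists_congr fun n => ⟨?_, ?_⟩
    · rintro ⟨hx, rfl⟩
      exact ⟨(iso n).mapsTo hx, (iso n).left_inv x hx⟩
    · rintro ⟨hy, rfl⟩
      exact ⟨(iso n).mapsTo_inv hy, (iso n).right_inv y hy⟩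
  obtain ⟨r, hrm, hr⟩ := exists_measurable_select (fun n => (iso n).src_meas)
    (fun n => (iso n).meas_toFun)
  obtain ⟨l, hlm, hl⟩ := exists_measurable_select (fun n => (iso n).tgt_meas)
    (fun n => (iso n).meas_invFun)
  refine ⟨c, hc, hc', ⟨⟨⟨E, ?_, ?_, ?_, ?_, ?_, ?_, ?_, r, hrm, ?_, l, hlm, ?_⟩, iso,
    fun _ _ => Iff.rfl, ?_, ?_⟩⟩⟩
  · have : ∀ n, Measurable fun p : X × Y => p.1 ∈ (iso n).src := fun n =>
      (measurableSet_setOfPred.mp (iso n).src_meas).comp measurable_fst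
    unfold Function.uncurry
    fun_prop
  · intro x y hxy g
    obtain ⟨g', h, hg', rfl⟩ := (hE _ _).mp hxy
    refine (hE _ _).mpr ⟨g' * g⁻¹, h, ?_⟩
    rw [α.act_mul, α.act_inv_act]
    exact ⟨hg', rfl⟩
  · intro x y hxy k
    obtain ⟨g, h, hg, rfl⟩ := (hE _ _).mp hxy
    exact (hE _ _).mpr ⟨g, k * h, hg, β.act_mul _ _ _⟩
  · intro x y y' hxy hxy'
    obtain ⟨g, h, hg, rfl⟩ := (hE _ _).mp hxy
    obtain ⟨g', h', hg', rfl⟩ := (hE _ _).mp hxy'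
    obtain ⟨k, hk⟩ := (hrel _ hg _ hg').mp
      ⟨g' * g⁻¹, by rw [α.act_mul, α.act_inv_act]⟩
    exact ⟨h' * k * h⁻¹, by rw [β.act_mul, β.act_inv_act, β.act_mul, hk]⟩
  · intro x x' y hxy hxy'
    obtain ⟨g, h, hg, rfl⟩ := (hE _ _).mp hxy
    obtain ⟨g', h', hg', hh'⟩ := (hE _ _).mp hxy'
    obtain ⟨k, hk⟩ := (hrel _ hg _ hg').mpr
      ⟨h'⁻¹ * h, by rw [β.act_mul, ← hh', β.act_inv_act]⟩
    exact ⟨g'⁻¹ * k * g, by rw [α.act_mul, α.act_mul, hk, α.act_inv_act]⟩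
  · intro x y hxy
    obtain ⟨g, h, hg, rfl⟩ := (hE _ _).mp hxy
    exact PMPAction.free_of_act hg.2.1.2
  · intro x y hxy
    obtain ⟨g, h, hg, rfl⟩ := (hE _ _).mp hxy
    refine PMPAction.free_of_act (g := h⁻¹) ?_
    rw [β.act_inv_act]
    exact hg.2.2
  · intro x y hxy
    obtain ⟨n, hn, -⟩ := hxy
    obtain ⟨m, hm, hrx⟩ := hr n x hn
    exact ⟨m, hm, hrx.symm⟩
  · intro x y hxy
    obtain ⟨n, hn, -⟩ := (hE' _ _).mp hxy
    obtain ⟨m, hm, hly⟩ := hl n y hn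
    exact (hE' _ _).mpr ⟨m, hm, hly.symm⟩
  · have h0 := α.null_translates hdiff
    filter_upwards [Θ.A_section, measure_eq_zero_iff_ae_notMem.mp h0] with x hx hx'
    obtain ⟨z, hz, hxz⟩ := hx (by rw [hRα.1]; trivial)
    obtain ⟨g, -, rfl⟩ := (hRα.2 _ _).mp hxz
    have hg : α.act g x ∈ A₁ := by
      by_contra hcon
      exact hx' ⟨g, hz, hcon⟩
    exact ⟨_, (hE _ _).mpr ⟨g, 1, hg, rfl⟩⟩
  · have h1 : ν (Θ.toFun '' (Θ.A \ A₁)) = 0 := by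
      have := Ψ.measure_image (Θ.A \ A₁) Set.sdiff_subset (Θ.measA.diff hA₁m)
      rw [hdiff, mul_zero] at this
      exact this
    have h0 := β.null_translates h1
    filter_upwards [Θ.B_section, measure_eq_zero_iff_ae_notMem.mp h0] with y hy hy'
    obtain ⟨z, hz, hyz⟩ := hy (by rw [hRβ.1]; trivial)
    obtain ⟨h, -, rfl⟩ := (hRβ.2 _ _).mp hyz
    have hx : Θ.invFun (β.act h y) ∈ A₁ := by
      by_contra hcon
      exact hy' ⟨h, _, ⟨Θ.mapsTo_inv hz, hcon⟩, Θ.right_inv _ hz⟩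
    refine ⟨_, (hE _ _).mpr ⟨1, h⁻¹, by rwa [α.act_one], ?_⟩⟩
    rw [α.act_one, Θ.right_inv _ hz, β.act_inv_act]

end

section

variable {G H X Y P Q : Type} [Group G] [Group H] [MeasurableSpace X] [MeasurableSpace Y]
    {μ : Measure X} {ν : Measure Y} {α : PMPAction G X μ} {β : PMPAction H Y ν}
    {Γ : P → Subgroup G} {Λ : Q → Subgroup H}

/-- Passing to the fixed coset and back returns to the starting coset almost everywhere. -/
theorem OrbitCorr.ae_fixedCoset_involutive [Countable G] [Countable H] [Countable P] [Countable Q]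
    [IsFiniteMeasure μ] (L : OrbitCorr α β) (hfree : α.IsFree) {Γ₀ : Subgroup G}
    (hG : IsFreeProductOf G (fun j : Option P => j.elim Γ₀ Γ)) (p : P) (hΓ : Infinite (Γ p))
    {F : Q → X → Y → Prop} (hF : L.IsFixedCoset (Γ p) Λ F) {K : Q → P → Y → X → Prop}
    (hK : ∀ q, L.symm.IsFixedCoset (Λ q) Γ (K q)) :
    ∀ᵐ x ∂μ, ∀ q y p' x', F q x y → K q p' y x' → p' = p ∧ ∃ γ ∈ Γ p, α.act γ x = x' := by
  obtain ⟨ρ, hρ1, hρ2, -, hρ3⟩ := hG.exists_lastLetter (some p)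
  let V : Set X := {x | ∃ q h p' g, F q x (β.act h (L.toRight x)) ∧
    K q p' (β.act h (L.toRight x)) (α.act g x) ∧ ¬ (p' = p ∧ g ∈ Γ p) ∧ ρ g = 1}
  have hV : MeasurableSet V := by
    have h1 := hF.meas
    have h2 := fun q => (hK q).meas
    refine measurableSet_setOfPred.mpr ?_
    fun_prop
  have hV1 : ∀ x ∈ V, ∀ γ ∈ Γ p, α.act γ x ∈ V → α.act γ x = x := by
    rintro x ⟨q, h, p₁, g, h1, h2, h3, h4⟩ γ hγ ⟨q', h', p₂, g', h1', h2', h3', h4'⟩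
    have h5 := hF.left (inv_mem hγ) h1'
    rw [α.act_inv_act] at h5
    obtain ⟨rfl, l, hl, hly⟩ := hF.uniq h1 h5
    rw [← hly, ← α.act_mul] at h2'
    have h6 := (hK q).left (inv_mem hl) h2'
    rw [β.act_inv_act] at h6
    obtain ⟨rfl, δ, hδ, he⟩ := (hK q).uniq h2 h6
    rw [← α.act_mul] at he
    have he' : δ * g = g' * γ := α.eq_of_act_eq (L.free_left (hF.corr h1)) he
    have hγ1 : γ = 1 := by
      rcases hρ3 (some p₁) δ hδ g with ⟨hp, hg⟩ | hp
      · exact absurd ⟨Option.some_injective _ hp, hg⟩ h3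
      · rw [he', hρ2 g' γ hγ, h4, h4', one_mul] at hp
        exact hp
    rw [hγ1, α.act_one]
  have hV0 : μ V = 0 := α.null_of_orbit_le_two hfree (Γ p) hV
    fun x hx g hg _ _ hgx _ => Or.inl (hV1 x hx g hg hgx)
  filter_upwards [measure_eq_zero_iff_ae_notMem.mp (α.null_translates hV0)] with x hx
  intro q y p' x' hxy hyx'
  obtain ⟨g, rfl⟩ := L.exists_left (hF.corr hxy) ((hK q).corr hyx')
  by_contra hcon
  have hγ : ρ g ∈ Γ p := hρ1 g
  have h1 := hF.left hγ hxy
  have hE := hF.corr h1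
  obtain ⟨h, hh⟩ := L.exists_right (L.toRight_spec hE) hE
  refine hx ⟨ρ g, q, h, p', g * (ρ g)⁻¹, ?_, ?_, ?_, ?_⟩
  · rwa [hh]
  · rwa [hh, α.act_mul, α.act_inv_act]
  · rintro ⟨hp, hg⟩
    refine hcon ⟨hp, g, ?_, rfl⟩
    simpa using mul_mem hg hγ
  · rw [hρ2 g _ (inv_mem hγ), mul_inv_cancel]

theorem OrbitLink.ae_exists_mutual [Countable G] [Countable H] [Countable P] [Countable Q]
    [IsFiniteMeasure μ] {c : ENNReal} (L : OrbitLink α β c) (hc : c ≠ 0) (hfree : α.IsFree)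
    {Γ₀ : Subgroup G} (hG : IsFreeProductOf G (fun j : Option P => j.elim Γ₀ Γ)) (p : P)
    (hΓ : Infinite (Γ p)) {F : Q → X → Y → Prop} (hF : L.toOrbitCorr.IsFixedCoset (Γ p) Λ F)
    {K : Q → P → Y → X → Prop} (hK : ∀ q, L.toOrbitCorr.symm.IsFixedCoset (Λ q) Γ (K q)) :
    ∀ᵐ x ∂μ, ∃ q y, F q x y ∧ K q p y x := by
  have hN := fun q => L.null_left hc (mem_ae_iff.mp (hK q).ae)
  have hN' : ∀ᵐ x ∂μ, ∀ q, x ∉ {x | ∃ y ∈ {y | ∃ p' x', K q p' y x'}ᶜ, L.E x y} :=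
    ae_all_iff.mpr fun q => measure_eq_zero_iff_ae_notMem.mp (hN q)
  filter_upwards [hF.ae, hN', L.ae_fixedCoset_involutive hfree hG p hΓ hF hK] with x h1 h2 h3
  obtain ⟨q, y, hxy⟩ := h1
  have : ∃ p' x', K q p' y x' := by
    by_contra hcon
    exact h2 q ⟨y, hcon, hF.corr hxy⟩
  obtain ⟨p', x', hyx'⟩ := this
  obtain ⟨rfl, γ, hγ, rfl⟩ := h3 q y p' x' hxy hyx'
  refine ⟨q, y, hxy, ?_⟩
  have := (hK q).right (inv_mem hγ) hyx'
  rwa [α.act_inv_act] at this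

/-- A Borel correspondence between the cosets of the `Γ p` and those of the `Λ q`. -/
structure IsCosetMatching (L : OrbitCorr α β) (Γ : P → Subgroup G) (Λ : Q → Subgroup H)
    (M : P → Q → X → Y → Prop) : Prop where
  meas : ∀ p q, Measurable (Function.uncurry (M p q))
  corr : ∀ {p q x y}, M p q x y → L.E x y
  left : ∀ {p q x y γ}, γ ∈ Γ p → M p q x y → M p q (α.act γ x) y
  right : ∀ {p q x y l}, l ∈ Λ q → M p q x y → M p q x (β.act l y)
  uniq_right : ∀ {p q q' x y y'}, M p q x y → M p q' x y' → q = q' ∧ ∃ l ∈ Λ q, β.act l y = y'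
  uniq_left : ∀ {p p' q x x' y}, M p q x y → M p' q x' y → p = p' ∧ ∃ γ ∈ Γ p, α.act γ x = x'
  ae_left : ∀ p, ∀ᵐ x ∂μ, ∃ q y, M p q x y
  ae_right : ∀ q, ∀ᵐ y ∂ν, ∃ p x, M p q x y

theorem IsCosetMatching.symm {L : OrbitCorr α β} {M : P → Q → X → Y → Prop}
    (hM : IsCosetMatching L Γ Λ M) : IsCosetMatching L.symm Λ Γ fun q p y x => M p q x y where
  meas := fun q p => (hM.meas p q).comp measurable_swap
  corr := hM.corr
  left := hM.right
  right := hM.left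
  uniq_right := hM.uniq_left
  uniq_left := hM.uniq_right
  ae_left := hM.ae_right
  ae_right := hM.ae_left

theorem OrbitLink.exists_isCosetMatching [Countable G] [Countable H] [Countable P] [Countable Q]
    [StandardBorelSpace X] [StandardBorelSpace Y] [IsFiniteMeasure μ] [IsFiniteMeasure ν]
    {c : ENNReal} (L : OrbitLink α β c) (hc : c ≠ 0) (hc' : c ≠ ⊤)
    {Γ₀ : Subgroup G} {Λ₀ : Subgroup H}
    (hG : IsFreeProductOf G (fun j : Option P => j.elim Γ₀ Γ))
    (hH : IsFreeProductOf H (fun j : Option Q => j.elim Λ₀ Λ))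
    (hΓ : ∀ p, Infinite (Γ p)) (hΛ : ∀ q, Infinite (Λ q)) (hα : α.IsFree) (hβ : β.IsFree)
    {RΓ : P → CBER X} {RΛ : Q → CBER Y} {RΓ₀ : CBER X} {RΛ₀ : CBER Y}
    (hRΓ : ∀ p, IsOrbitRel α (Γ p) (RΓ p)) (hRΛ : ∀ q, IsOrbitRel β (Λ q) (RΛ q))
    (hRΓ₀ : IsOrbitRel α Γ₀ RΓ₀) (hRΛ₀ : IsOrbitRel β Λ₀ RΛ₀)
    (hFIΓ : ∀ p, FreelyIndecomposableMod μ (RΓ p)) (hFIΛ : ∀ q, FreelyIndecomposableMod ν (RΛ q))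
    (hTΓ₀ : RΓ₀.Treeable) (hTΛ₀ : RΛ₀.Treeable) :
    ∃ M : P → Q → X → Y → Prop, IsCosetMatching L.toOrbitCorr Γ Λ M := by
  choose F hF using fun p => L.toOrbitCorr.exists_isFixedCoset L.ae_left hα (hΓ p) (hRΓ p)
    (hFIΓ p) hH hRΛ₀ hTΛ₀
  choose K hK using fun q => L.toOrbitCorr.symm.exists_isFixedCoset L.ae_right hβ (hΛ q) (hRΛ q)
    (hFIΛ q) hG hRΓ₀ hTΓ₀
  refine ⟨fun p q x y => F p q x y ∧ K q p y x, ?_⟩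
  constructor
  · intro p q
    have h1 := (hF p).meas q
    have h2 := (hK q).meas p
    unfold Function.uncurry
    fun_prop
  · exact fun h => (hF _).corr h.1
  · exact fun hγ h => ⟨(hF _).left hγ h.1, (hK _).right hγ h.2⟩
  · exact fun hl h => ⟨(hF _).right hl h.1, (hK _).left hl h.2⟩
  · exact fun h h' => (hF _).uniq h.1 h'.1
  · exact fun h h' => (hK _).uniq h.2 h'.2
  · exact fun p => L.ae_exists_mutual hc hα hG p (hΓ p) (hF p) hK
  · intro q
    refine ((L.symm hc hc').ae_exists_mutual (ENNReal.inv_ne_zero.mpr hc') hβ hH q (hΛ q)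
      (hK q) hF).mono ?_
    rintro y ⟨p, x, h1, h2⟩
    exact ⟨p, x, h2, h1⟩

end

/-- Invariant sets covering the space up to a null set can be enlarged by null sets, after
discarding the null ones, to an invariant partition of the whole space. -/
theorem CBER.exists_partition_of_ae_cover {X ι : Type} [MeasurableSpace X] [Countable ι]
    {μ : Measure X} [NeZero μ] (R : CBER X) {U : ι → Set X} (hU : ∀ i, MeasurableSet (U i))
    (hdisj : ∀ i j x, x ∈ U i → x ∈ U j → i = j) (hcover : ∀ᵐ x ∂μ, ∃ i, x ∈ U i)
    (hinv : ∀ i, ∀ x ∈ U i, ∀ y, R.rel x y → y ∈ U i) :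
    ∃ V : {i // 0 < μ (U i)} → Set X, (∀ i, MeasurableSet (V i)) ∧
      Pairwise (Function.onFun Disjoint V) ∧ (⋃ i, V i) = Set.univ ∧
      (∀ i, ∀ x ∈ V i, ∀ y, R.rel x y → y ∈ V i) ∧ (∀ i, U i.1 ⊆ V i) ∧
      ∀ i, ∀ᵐ x ∂μ, x ∈ V i → x ∈ U i.1 := by
  have hpos : ∀ᵐ x ∂μ, ∃ i : {i // 0 < μ (U i)}, x ∈ U i := by
    have h0 : ∀ᵐ x ∂μ, ∀ i, x ∈ U i → 0 < μ (U i) := by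
      refine ae_all_iff.mpr fun i => ?_
      rcases (zero_le (a := μ (U i))).eq_or_lt with h | h
      · filter_upwards [measure_eq_zero_iff_ae_notMem.mp h.symm] with x hx hx'
        exact absurd hx' hx
      · exact Filter.Eventually.of_forall fun _ _ => h
    filter_upwards [hcover, h0] with x ⟨i, hi⟩ hx
    exact ⟨⟨i, hx i hi⟩, hi⟩
  obtain ⟨-, i₀, -⟩ := hpos.exists
  let N : Set X := {x | ∀ i : {i // 0 < μ (U i)}, x ∉ U i}
  have hN : MeasurableSet N := by
    have : N = (⋃ i : {i // 0 < μ (U i)}, U i)ᶜ := by ext; simp [N]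
    rw [this]
    exact (MeasurableSet.iUnion fun i : {i // 0 < μ (U i)} => hU i).compl
  refine ⟨fun i => U i ∪ {x | i = i₀ ∧ x ∈ N}, fun i => ?_, fun i j hij => ?_, ?_, ?_,
    fun i => Set.subset_union_left, fun i => ?_⟩
  · refine (hU i).union ?_
    by_cases h : i = i₀
    · simpa [h] using hN
    · simp [h]
  · refine Set.disjoint_left.mpr ?_
    rintro x (h | ⟨h, hx⟩) (h' | ⟨h', hx'⟩)
    · exact hij (Subtype.ext (hdisj _ _ x h h'))
    · exact hx' i h
    · exact hx j h'
    · exact hij (h.trans h'.symm)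
  · refine Set.eq_univ_of_forall fun x => Set.mem_iUnion.mpr ?_
    by_cases h : x ∈ N
    · exact ⟨i₀, Or.inr ⟨rfl, h⟩⟩
    · simp only [N, Set.mem_ofPred_eq, not_forall, not_not] at h
      exact h.imp fun i hi => Or.inl hi
  · rintro i x (h | ⟨h, hx⟩) y hxy
    · exact Or.inl (hinv _ x h y hxy)
    · exact Or.inr ⟨h, fun j hj => hx j (hinv _ y hj x (R.symm hxy))⟩
  · filter_upwards [hpos] with x ⟨j, hj⟩
    rintro (h | ⟨-, hx⟩)
    · exact h
    · exact absurd hj (hx j)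

section

variable {G H X Y P Q : Type} [Group G] [Group H] [MeasurableSpace X] [MeasurableSpace Y]
    {μ : Measure X} {ν : Measure Y} {α : PMPAction G X μ} {β : PMPAction H Y ν}
    {Γ : P → Subgroup G} {Λ : Q → Subgroup H} {M : P → Q → X → Y → Prop}

theorem IsCosetMatching.measurableSet_left [Countable H] {L : OrbitCorr α β}
    (hM : IsCosetMatching L Γ Λ M) (p : P) (q : Q) : MeasurableSet {x | ∃ y, M p q x y} := by
  have h : {x | ∃ y, M p q x y} = {x | ∃ h, M p q x (β.act h (L.toRight x))} := by
    ext x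
    refine ⟨fun ⟨y, hy⟩ => ?_, fun ⟨h, hh⟩ => ⟨_, hh⟩⟩
    have hE := hM.corr hy
    obtain ⟨h, rfl⟩ := L.exists_right (L.toRight_spec hE) hE
    exact ⟨h, hy⟩
  rw [h]
  have h1 := hM.meas p q
  refine measurableSet_setOfPred.mpr ?_
  fun_prop

theorem IsCosetMatching.invariant_left {L : OrbitCorr α β} (hM : IsCosetMatching L Γ Λ M)
    {p : P} {R : CBER X} (hR : IsOrbitRel α (Γ p) R) (q : Q) :
    ∀ x ∈ {x | ∃ y, M p q x y}, ∀ x', R.rel x x' → x' ∈ {x | ∃ y, M p q x y} := by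
  rintro x ⟨y, hxy⟩ x' hx'
  obtain ⟨γ, hγ, rfl⟩ := (hR.2 x x').mp hx'
  exact ⟨y, hM.left hγ hxy⟩

theorem IsCosetMatching.exists_partition [Countable H] [Countable Q] [NeZero μ]
    {L : OrbitCorr α β} (hM : IsCosetMatching L Γ Λ M) (p : P) {R : CBER X}
    (hR : IsOrbitRel α (Γ p) R) :
    ∃ V : {q // 0 < μ {x | ∃ y, M p q x y}} → Set X, (∀ q, MeasurableSet (V q)) ∧
      Pairwise (Function.onFun Disjoint V) ∧ (⋃ q, V q) = Set.univ ∧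
      (∀ q, ∀ x ∈ V q, ∀ x', R.rel x x' → x' ∈ V q) ∧ (∀ q, {x | ∃ y, M p q.1 x y} ⊆ V q) ∧
      ∀ q, ∀ᵐ x ∂μ, x ∈ V q → ∃ y, M p q.1 x y :=
  R.exists_partition_of_ae_cover (fun q => hM.measurableSet_left p q)
    (fun _ _ _ ⟨_, h⟩ ⟨_, h'⟩ => (hM.uniq_right h h').1) (hM.ae_left p)
    (fun q => hM.invariant_left hR q)

theorem IsCosetMatching.measure_pos_right {c : ENNReal} {L : OrbitLink α β c}
    (hM : IsCosetMatching L.toOrbitCorr Γ Λ M) (hc : c ≠ 0) {p : P} {q : Q}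
    (h : 0 < μ {x | ∃ y, M p q x y}) : 0 < ν {y | ∃ x, M p q x y} := by
  by_contra h0
  refine h.ne' (measure_mono_null ?_ (L.null_left hc (nonpos_iff_eq_zero.mp (not_lt.mp h0))))
  rintro x ⟨y, hxy⟩
  exact ⟨y, ⟨x, hxy⟩, hM.corr hxy⟩

/-- Matched pieces carry stably orbit equivalent relations. -/
theorem IsCosetMatching.soe [Countable G] [IsFiniteMeasure μ] [IsFiniteMeasure ν]
    {c : ENNReal} {L : OrbitLink α β c} (hM : IsCosetMatching L.toOrbitCorr Γ Λ M)
    (hc : c ≠ 0) (hc' : c ≠ ⊤) {p : P} {q : Q} {R : CBER X} {S : CBER Y}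
    (hR : IsOrbitRel α (Γ p) R) (hS : IsOrbitRel β (Λ q) S)
    (hpos : 0 < μ {x | ∃ y, M p q x y}) {V : Set X} (hV : MeasurableSet V) {W : Set Y}
    (hW : MeasurableSet W) (hUV : {x | ∃ y, M p q x y} ⊆ V) (hUW : {y | ∃ x, M p q x y} ⊆ W)
    (haeV : ∀ᵐ x ∂μ, x ∈ V → ∃ y, M p q x y) (haeW : ∀ᵐ y ∂ν, y ∈ W → ∃ x, M p q x y) :
    SOE (R.restrict V hV) μ (S.restrict W hW) ν := by
  obtain ⟨φ, hφM, hφ⟩ := ScaledIso.exists_matching L.iso (hM.meas p q)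
  have hφM' : ∀ y ∈ φ.tgt, M p q (φ.invFun y) y := fun y hy => by
    simpa only [φ.right_inv y hy] using hφM _ (φ.mapsTo_inv hy)
  have hAV : φ.src ⊆ V := fun x hx => hUV ⟨_, hφM x hx⟩
  have hBW : φ.tgt ⊆ W := fun y hy => hUW ⟨_, hφM' y hy⟩
  have hmax : ∀ {x y}, M p q x y → x ∈ φ.src ∨ y ∈ φ.tgt := fun {x y} hxy => by
    obtain ⟨n, hn, rfl⟩ := (L.E_iff x y).mp (hM.corr hxy)
    exact hφ n x hn hxy
  have hleft : ∀ {x y}, M p q x y → ∃ γ ∈ Γ p, α.act γ x ∈ φ.src := fun {x y} hxy => by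
    rcases hmax hxy with hx | hy
    · exact ⟨1, one_mem _, by rwa [α.act_one]⟩
    · obtain ⟨-, γ, hγ, he⟩ := hM.uniq_left hxy (hφM' y hy)
      exact ⟨γ, hγ, he ▸ φ.mapsTo_inv hy⟩
  have hright : ∀ {x y}, M p q x y → ∃ l ∈ Λ q, β.act l y ∈ φ.tgt := fun {x y} hxy => by
    rcases hmax hxy with hx | hy
    · obtain ⟨-, l, hl, he⟩ := hM.uniq_right hxy (hφM x hx)
      exact ⟨l, hl, he ▸ φ.mapsTo hx⟩
    · exact ⟨1, one_mem _, by rwa [β.act_one]⟩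
  have hA : μ φ.src ≠ 0 := fun h0 => by
    refine hpos.ne' (measure_mono_null ?_ (α.null_translates h0))
    rintro x ⟨y, hxy⟩
    obtain ⟨γ, -, hγ⟩ := hleft hxy
    exact ⟨γ, hγ⟩
  have himage : φ.toFun '' φ.src = φ.tgt :=
    Set.Subset.antisymm (Set.image_subset_iff.mpr φ.mapsTo)
      fun y hy => ⟨_, φ.mapsTo_inv hy, φ.right_inv y hy⟩
  have hνB : ν φ.tgt = c * μ φ.src := by
    rw [← himage, φ.measure_image _ subset_rfl φ.src_meas]
  refine ⟨{ A := φ.src, B := φ.tgt, toFun := φ.toFun, invFun := φ.invFun, measA := φ.src_meas,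
            measB := φ.tgt_meas, A_sub := ?_, B_sub := ?_, A_pos := pos_iff_ne_zero.mpr hA,
            B_pos := ?_, A_section := ?_, B_section := ?_, meas_toFun := φ.meas_toFun,
            meas_invFun := φ.meas_invFun, mapsTo := φ.mapsTo, mapsTo_inv := φ.mapsTo_inv,
            left_inv := φ.left_inv, right_inv := φ.right_inv, measure_eq := ?_, rel_iff := ?_ }⟩
  · exact fun x hx => ⟨hR.1 ▸ Set.mem_univ x, hAV hx⟩
  · exact fun y hy => ⟨hS.1 ▸ Set.mem_univ y, hBW hy⟩
  · rw [hνB]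
    exact pos_iff_ne_zero.mpr (mul_ne_zero hc hA)
  · filter_upwards [haeV] with x hx hxd
    obtain ⟨y, hxy⟩ := hx hxd.2
    obtain ⟨γ, hγ, hγx⟩ := hleft hxy
    exact ⟨_, hγx, (hR.2 _ _).mpr ⟨γ, hγ, rfl⟩, hxd.2, hAV hγx⟩
  · filter_upwards [haeW] with y hy hyd
    obtain ⟨x, hxy⟩ := hy hyd.2
    obtain ⟨l, hl, hly⟩ := hright hxy
    exact ⟨_, hly, (hS.2 _ _).mpr ⟨l, hl, rfl⟩, hyd.2, hBW hly⟩
  · intro E hE hEm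
    rw [hνB, φ.measure_image E hE hEm, ENNReal.mul_inv (Or.inl hc) (Or.inl hc'),
      mul_mul_mul_comm, ENNReal.inv_mul_cancel hc hc', one_mul]
  · refine ⟨Set.univ, MeasurableSet.univ, by simp, fun x ⟨hx, _⟩ x' ⟨hx', _⟩ => ⟨?_, ?_⟩⟩
    · rintro ⟨h, -, -⟩
      obtain ⟨γ, hγ, rfl⟩ := (hR.2 _ _).mp h
      obtain ⟨-, l, hl, he⟩ := hM.uniq_right (hM.left hγ (hφM x hx)) (hφM _ hx')
      exact ⟨(hS.2 _ _).mpr ⟨l, hl, he⟩, hBW (φ.mapsTo hx), hBW (φ.mapsTo hx')⟩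
    · rintro ⟨h, -, -⟩
      obtain ⟨l, hl, he⟩ := (hS.2 _ _).mp h
      obtain ⟨-, γ, hγ, he'⟩ := hM.uniq_left (he ▸ hM.right hl (hφM x hx)) (hφM _ hx')
      exact ⟨(hR.2 _ _).mpr ⟨γ, hγ, he'⟩, hAV hx, hAV hx'⟩

end

/-- SOE Bass-Serre rigidity (Framework): the components of the two free
product decompositions are, up to countable invariant partitions, in bijective stably
orbit equivalent correspondence. -/
theorem SOE_BassSerre_rigidity_framework
    {X Y : Type} [MeasurableSpace X] [StandardBorelSpace X]
    [MeasurableSpace Y] [StandardBorelSpace Y]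
    (μ : MeasureTheory.Measure X) [MeasureTheory.IsProbabilityMeasure μ]
    (ν : MeasureTheory.Measure Y) [MeasureTheory.IsProbabilityMeasure ν]
    {G H : Type} [Group G] [Countable G] [Group H] [Countable H]
    {P Q : Type} [Nonempty P] [Countable P] [Nonempty Q] [Countable Q]
    (Γ : P → Subgroup G) (Γ₀ : Subgroup G) (Λ : Q → Subgroup H) (Λ₀ : Subgroup H)
    (hG : IsFreeProductOf G (fun i : Option P => i.elim Γ₀ Γ))
    (hH : IsFreeProductOf H (fun j : Option Q => j.elim Λ₀ Λ))
    (hΓinf : ∀ p, Infinite (Γ p)) (hΛinf : ∀ q, Infinite (Λ q))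
    (α : PMPAction G X μ) (β : PMPAction H Y ν)
    (hαfree : α.IsFree) (hβfree : β.IsFree)
    (Rα : CBER X) (Rβ : CBER Y)
    (hRα : IsOrbitRel α ⊤ Rα) (hRβ : IsOrbitRel β ⊤ Rβ)
    (RΓ : P → CBER X) (RΛ : Q → CBER Y) (RΓ₀ : CBER X) (RΛ₀ : CBER Y)
    (hRΓ : ∀ p, IsOrbitRel α (Γ p) (RΓ p)) (hRΛ : ∀ q, IsOrbitRel β (Λ q) (RΛ q))
    (hRΓ₀ : IsOrbitRel α Γ₀ RΓ₀) (hRΛ₀ : IsOrbitRel β Λ₀ RΛ₀)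
    (hFIΓ : ∀ p, FreelyIndecomposableMod μ (RΓ p))
    (hFIΛ : ∀ q, FreelyIndecomposableMod ν (RΛ q))
    (hTΓ₀ : RΓ₀.Treeable) (hTΛ₀ : RΛ₀.Treeable)
    (hsoe : SOE Rα μ Rβ ν) :
    ∃ (K : P → Type) (L : Q → Type),
      (∀ p, Countable (K p)) ∧ (∀ q, Countable (L q)) ∧
      ∃ (XK : (Σ p, K p) → Set X) (YL : (Σ q, L q) → Set Y),
      ∃ (hXK : ∀ k, MeasurableSet (XK k)) (hYL : ∀ l, MeasurableSet (YL l)),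
        (∀ p, Pairwise (Function.onFun Disjoint (fun k : K p => XK ⟨p, k⟩))) ∧
        (∀ q, Pairwise (Function.onFun Disjoint (fun l : L q => YL ⟨q, l⟩))) ∧
        (∀ p, (⋃ k : K p, XK ⟨p, k⟩) = Set.univ) ∧
        (∀ q, (⋃ l : L q, YL ⟨q, l⟩) = Set.univ) ∧
        (∀ k : Σ p, K p, ∀ x ∈ XK k, ∀ y, (RΓ k.1).rel x y → y ∈ XK k) ∧
        (∀ l : Σ q, L q, ∀ y ∈ YL l, ∀ z, (RΛ l.1).rel y z → z ∈ YL l) ∧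
        ∃ θ : (Σ p, K p) ≃ (Σ q, L q),
          ∀ k : Σ p, K p,
            SOE ((RΓ k.1).restrict (XK k) (hXK k)) μ
              ((RΛ (θ k).1).restrict (YL (θ k)) (hYL (θ k))) ν := by
  obtain ⟨Θ⟩ := hsoe
  obtain ⟨c, hc, hc', ⟨L⟩⟩ := Θ.exists_link hαfree hβfree hRα hRβ
  obtain ⟨M, hM⟩ := L.exists_isCosetMatching hc hc' hG hH hΓinf hΛinf hαfree hβfree hRΓ hRΛ
    hRΓ₀ hRΛ₀ hFIΓ hFIΛ hTΓ₀ hTΛ₀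
  have hM' : IsCosetMatching (L.symm hc hc').toOrbitCorr Λ Γ fun q p y x => M p q x y := hM.symm
  have hpos : ∀ p q, 0 < μ {x | ∃ y, M p q x y} ↔ 0 < ν {y | ∃ x, M p q x y} := fun p q =>
    ⟨hM.measure_pos_right hc, hM'.measure_pos_right (ENNReal.inv_ne_zero.mpr hc')⟩
  choose V hVm hVd hVu hVi hVs hVae using fun p => hM.exists_partition p (hRΓ p)
  choose W hWm hWd hWu hWi hWs hWae using fun q => hM'.exists_partition q (hRΛ q)
  refine ⟨fun p => {q // 0 < μ {x | ∃ y, M p q x y}}, fun q => {p // 0 < ν {y | ∃ x, M p q x y}},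
    fun p => inferInstance, fun q => inferInstance, fun k => V k.1 k.2, fun l => W l.1 l.2, fun k => hVm k.1 k.2, fun l => hWm l.1 l.2, hVd, hWd, hVu, hWu,
    fun k => hVi k.1 k.2, fun l => hWi l.1 l.2, ?_⟩
  refine ⟨⟨fun k => ⟨k.2.1, k.1, (hpos _ _).mp k.2.2⟩, fun l => ⟨l.2.1, l.1, (hpos _ _).mpr l.2.2⟩,
    fun _ => rfl, fun _ => rfl⟩, fun k => ?_⟩
  exact hM.soe hc hc' (hRΓ _) (hRΛ _) k.2.2 _ _ (hVs _ _)
    (hWs k.2.1 ⟨k.1, (hpos _ _).mp k.2.2⟩) (hVae _ _) (hWae k.2.1 ⟨k.1, (hpos _ _).mp k.2.2⟩)
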